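/- arXiv:2002.05470 — 4 statements merged into one kernel-verified Lean document; each statement's English description precedes it below -/
import Mathlib

section
/- Let μ be a finite positive Borel measure on the unit circle T and n ∈ ℕ. For a holomorphic function f(z)=Σ_{j} \hat f(j) z^j on a neighbourhood of the closed unit disc, the weighted Dirichlet integral D_{μ,n}(f) = (1/(n!(n-1)!)) ∫_D P_μ(z)|f^{(n)}(z)|²(1-|z|²)^{n-1} dA(z) equals Σ_{k,l ≥ n} binom(min(k,l), n) \hat μ(l-k) \hat f(k) \overline{\hat f(l)}, where \hat μ(j) = ∫_T ζ^{-j} dμ(ζ), and the double series converges absolutely. -/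
open MeasureTheory
open scoped ENNReal

/-- Normalized Lebesgue area measure on `ℂ` (total mass `1` on the unit disc). -/
noncomputable def area : Measure ℂ := (ENNReal.ofReal Real.pi)⁻¹ • volume

/-- The Poisson integral `P_μ(z) = ∫ (1-|z|²)/|z-ζ|² dμ(ζ)` of a finite positive Borel
measure `μ` on the unit circle. -/
noncomputable def poisson (μ : Measure ℂ) (z : ℂ) : ℝ :=
  ∫ ζ, (1 - ‖z‖ ^ 2) / ‖z - ζ‖ ^ 2 ∂μ

/-- The weighted Dirichlet integral of order `n ≥ 1`:
`D_{μ,n}(f) = (1/(n!(n-1)!)) ∫_D P_μ(z)|f⁽ⁿ⁾(z)|²(1-|z|²)^{n-1} dA(z)`,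
as an extended nonnegative real. -/
noncomputable def eDirichlet (μ : Measure ℂ) (n : ℕ) (f : ℂ → ℂ) : ℝ≥0∞ :=
  (((n.factorial * (n - 1).factorial : ℕ) : ℝ≥0∞))⁻¹ *
    ∫⁻ z in Metric.ball (0 : ℂ) 1,
      ENNReal.ofReal (poisson μ z * ‖iteratedDeriv n f z‖ ^ 2 * (1 - ‖z‖ ^ 2) ^ (n - 1)) ∂area


lemma beta_aux (m p : ℕ) : ∫ r in (0:ℝ)..1, r * (r ^ (2 * m) * (1 - r ^ 2) ^ p)
    = (m.factorial * p.factorial : ℝ) / (2 * (m + p + 1).factorial) := by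
  induction p generalizing m with
  | zero =>
    have : ∀ r : ℝ, r * (r ^ (2 * m) * (1 - r ^ 2) ^ 0) = r ^ (2 * m + 1) := by intro r; ring
    simp only [this, integral_pow]
    rw [add_zero, Nat.factorial_succ]
    have := Nat.factorial_ne_zero m
    push_cast
    field_simp
    simp
    ring
  | succ p ih =>
    have h : ∀ r : ℝ, r * (r ^ (2 * m) * (1 - r ^ 2) ^ (p + 1)) =
       r * (r ^ (2 * m) * (1 - r ^ 2) ^ p) - r * (r ^ (2 * (m + 1)) * (1 - r ^ 2) ^ p) := by
      intro r; ring
    simp only [h]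
    rw [intervalIntegral.integral_sub (Continuous.intervalIntegrable (by fun_prop) _ _)
      (Continuous.intervalIntegrable (by fun_prop) _ _), ih, ih]
    rw [show m + 1 + p + 1 = (m + p + 1) + 1 by ring, show m + (p + 1) + 1 = (m + p + 1) + 1 by ring,
      Nat.factorial_succ (m + p + 1), Nat.factorial_succ m, Nat.factorial_succ p]
    have := Nat.factorial_ne_zero (m + p + 1)
    push_cast
    field_simp
    ring

noncomputable def KK (ζ z : ℂ) : ℝ := (1 - ‖z‖ ^ 2) / ‖z - ζ‖ ^ 2

lemma KK_nonneg {ζ z : ℂ} (hz : ‖z‖ ≤ 1) : 0 ≤ KK ζ z := by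
  unfold KK
  have : ‖z‖ ^ 2 ≤ 1 := pow_le_one₀ (norm_nonneg _) hz
  exact div_nonneg (by linarith) (by positivity)

lemma KK_cont {ζ : ℂ} (hζ : ‖ζ‖ = 1) {r : ℝ} (h0 : 0 ≤ r) (h1 : r < 1) :
    Continuous fun θ : ℝ => KK ζ (circleMap 0 r θ) := by
  unfold KK
  refine Continuous.div (by fun_prop) (by fun_prop) ?_
  intro θ h
  rw [sq_eq_zero_iff, norm_eq_zero, sub_eq_zero] at h
  have := congrArg norm h
  simp [abs_of_nonneg h0, hζ] at this
  linarith

lemma circ_aux {ζ : ℂ} (hζ : ‖ζ‖ = 1) {r : ℝ} (h0 : 0 ≤ r) (h1 : r < 1) (m : ℕ) :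
    ∫ θ in (-Real.pi)..Real.pi, (KK ζ (circleMap 0 r θ) : ℂ) * (circleMap 0 r θ) ^ m
      = 2 * Real.pi * (r ^ (2 * m) * ζ ^ m) := by
  have key := DiffContOnCl.circleAverage_poissonKernel_smul' (f := fun z : ℂ => z ^ m) (R := 1)
    (c := 0) (w := r * ζ) (Differentiable.diffContOnCl (by fun_prop))
    (by simp [hζ, abs_of_nonneg h0, h1])
  rw [Real.circleAverage_eq_integral_add (-Real.pi)] at key
  rw [← sub_eq_zero, intervalIntegral.integral_comp_add_right (f := fun θ => 
    (fun z : ℂ ↦ ((‖z - 0‖ ^ 2 - ‖r * ζ - 0‖ ^ 2) / ‖(z - 0) - (r * ζ - 0)‖ ^ 2) • z ^ m) (circleMap 0 1 θ)), sub_eq_zero] at key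
  rw [show 0 + -Real.pi = -Real.pi by ring, show 2 * Real.pi + -Real.pi = Real.pi by ring] at key
  have e : ∀ θ : ℝ, (KK ζ (circleMap 0 r θ) : ℂ) * (circleMap 0 r θ) ^ m = 
     (r : ℂ) ^ m * ((fun z : ℂ ↦ ((‖z - 0‖ ^ 2 - ‖r * ζ - 0‖ ^ 2) / ‖(z - 0) - (r * ζ - 0)‖ ^ 2) • z ^ m) (circleMap 0 1 θ)) := by
    intro θ
    have e1 : ‖circleMap 0 r θ - ζ‖ ^ 2 = ‖circleMap 0 1 θ - r * ζ‖ ^ 2 := by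
      have hz : ‖circleMap 0 1 θ‖ = 1 := by simp
      have hr : circleMap 0 r θ = r * circleMap 0 1 θ := by simp [circleMap]
      rw [hr]
      generalize circleMap 0 1 θ = w at *
      have a1 : ‖w‖ ^ 2 = 1 := by rw [hz]; norm_num
      have a2 : ‖ζ‖ ^ 2 = 1 := by rw [hζ]; norm_num
      simp only [← Complex.normSq_eq_norm_sq, Complex.normSq_apply] at *
      simp
      linear_combination (r^2 - 1) * a1 + (1 - r ^ 2) * a2
    have e2 : circleMap 0 r θ = r * circleMap 0 1 θ := by simp [circleMap]
    simp only [KK, sub_zero, e1]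
    rw [e2]
    simp [hζ, abs_of_nonneg h0]
    ring
  simp only [e]
  rw [intervalIntegral.integral_const_mul]
  rw [inv_smul_eq_iff₀ (by positivity)] at key
  rw [key]
  simp
  ring

lemma circ_aux2 {ζ : ℂ} (hζ : ‖ζ‖ = 1) {r : ℝ} (h0 : 0 ≤ r) (h1 : r < 1) (j k : ℕ) :
    ∫ θ in (-Real.pi)..Real.pi, (KK ζ (circleMap 0 r θ) : ℂ) * ((circleMap 0 r θ) ^ j *
        (starRingEnd ℂ (circleMap 0 r θ)) ^ k)
      = 2 * Real.pi * (r ^ (2 * max j k) * (ζ ^ j * (starRingEnd ℂ ζ) ^ k)) := by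
  have n1 : ζ * starRingEnd ℂ ζ = 1 := by rw [Complex.mul_conj, Complex.normSq_eq_norm_sq, hζ]; simp
  have n2 : ∀ θ, circleMap 0 r θ * starRingEnd ℂ (circleMap 0 r θ) = r ^ 2 := by
    intro θ; rw [Complex.mul_conj, Complex.normSq_eq_norm_sq]; simp
  have main : ∀ k m : ℕ, ∫ θ in (-Real.pi)..Real.pi, (KK ζ (circleMap 0 r θ) : ℂ) * ((circleMap 0 r θ) ^ (k + m) *
        (starRingEnd ℂ (circleMap 0 r θ)) ^ k)
      = 2 * Real.pi * (r ^ (2 * (k + m)) * (ζ ^ (k + m) * (starRingEnd ℂ ζ) ^ k)) := by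
    intro k m
    have : ∀ θ, (KK ζ (circleMap 0 r θ) : ℂ) * ((circleMap 0 r θ) ^ (k + m) *
        (starRingEnd ℂ (circleMap 0 r θ)) ^ k) = (r ^ 2) ^ k * ((KK ζ (circleMap 0 r θ) : ℂ) * (circleMap 0 r θ) ^ m) := by
      intro θ
      rw [← n2 θ]; ring
    simp only [this]
    rw [intervalIntegral.integral_const_mul, circ_aux hζ h0 h1]
    rw [show ζ ^ (k + m) * (starRingEnd ℂ ζ) ^ k = (ζ * starRingEnd ℂ ζ) ^ k * ζ ^ m by ring, n1]
    ring
  rcases le_total k j with h | h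
  · obtain ⟨m, rfl⟩ := Nat.exists_eq_add_of_le h
    rw [main, max_eq_left h]
  · obtain ⟨m, rfl⟩ := Nat.exists_eq_add_of_le h
    have := congrArg (starRingEnd ℂ) (main j m)
    rw [intervalIntegral.integral_of_le (by linarith [Real.pi_pos]), ← integral_conj, ← intervalIntegral.integral_of_le (by linarith [Real.pi_pos])] at this
    rw [max_eq_right h]
    simp only [map_mul, map_pow, Complex.conj_conj, Complex.conj_ofReal] at this
    rw [Complex.conj_ofNat] at this
    simp only [mul_comm ((starRingEnd ℂ) _ ^ (j + m))] at this
    exact this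

lemma taylor_aux (n : ℕ) (f : ℂ → ℂ) (a : ℕ → ℂ) (R : ℝ) (hR : 1 < R)
    (hf : ∀ z ∈ Metric.ball (0 : ℂ) R, HasSum (fun j => a j * z ^ j) (f z)) :
    ∀ z ∈ Metric.ball (0 : ℂ) R,
      HasSum (fun j => (((j + n).factorial : ℂ) / j.factorial * a (j + n)) * z ^ j) (iteratedDeriv n f z) := by
  have hps : HasFPowerSeriesOnBall f (FormalMultilinearSeries.ofScalars ℂ a) 0 (ENNReal.ofReal R) := by
    refine ⟨?_, by simp; linarith, ?_⟩
    · refine ENNReal.le_of_forall_nnreal_lt fun r hr => ?_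
      refine FormalMultilinearSeries.le_radius_of_summable _ ?_
      have h := (hf (r : ℝ) ?_).summable.norm
      · simpa [FormalMultilinearSeries.ofScalars_norm] using h
      · simpa [ENNReal.lt_ofReal_iff_toReal_lt] using hr
    · intro y hy
      simp_rw [FormalMultilinearSeries.ofScalars_apply_eq]
      have := hf y (by simpa [Metric.eball_ofReal] using hy)
      simpa using this
  have hco : ∀ m, iteratedDeriv m f 0 = m.factorial * a m := by
    intro m
    have := hps.factorial_smul 1 m
    rw [iteratedDeriv_eq_iteratedFDeriv, ← this]
    simp
  have hd : DifferentiableOn ℂ (iteratedDeriv n f) (Metric.ball 0 R) := by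
    have h1 : AnalyticOnNhd ℂ f (Metric.ball 0 R) := by
      have := hps.analyticOnNhd
      rwa [Metric.eball_ofReal] at this
    exact (iteratedDeriv_eq_iterate (𝕜 := ℂ) (n := n) (f := f)) ▸ (h1.iterated_deriv n).differentiableOn
  intro z hz
  have := Complex.hasSum_taylorSeries_on_ball hd hz
  refine (funext (fun j => ?_) : (fun j : ℕ => (((j + n).factorial : ℂ) / j.factorial * a (j + n)) * z ^ j) = _) ▸ this
  have : iteratedDeriv j (iteratedDeriv n f) 0 = iteratedDeriv (j + n) f 0 := by
    simp only [iteratedDeriv_eq_iterate, Function.iterate_add_apply]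
  rw [this, hco]
  simp
  ring

lemma symm_eq (p : ℝ × ℝ) : Complex.polarCoord.symm p = circleMap 0 p.1 p.2 := by
  rw [Complex.polarCoord_symm_apply, circleMap, zero_add, Complex.exp_mul_I]
  push_cast
  rfl

lemma measurable_KK : Measurable fun p : ℂ × ℂ => KK p.1 p.2 := by
  unfold KK
  fun_prop

lemma disc_lint {ζ : ℂ} (hζ : ‖ζ‖ = 1) :
    ∫⁻ z in Metric.ball (0 : ℂ) 1, ENNReal.ofReal (KK ζ z) ≤ ENNReal.ofReal (2 * Real.pi) := by
  have hK : Measurable fun z => KK ζ z := by unfold KK; fun_prop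
  rw [← lintegral_indicator Metric.isOpen_ball.measurableSet, ← Complex.lintegral_comp_polarCoord_symm]
  rw [polarCoord_target, Measure.volume_eq_prod, ← Measure.prod_restrict, lintegral_prod]
  · calc _ ≤ ∫⁻ r in Set.Ioi (0:ℝ), (Set.Iio (1:ℝ)).indicator (fun _ => ENNReal.ofReal (2 * Real.pi)) r := by
          refine setLIntegral_mono ?_ ?_
          · exact measurable_const.indicator measurableSet_Iio
          intro r hr
          have hr0 : 0 < r := hr
          by_cases h1 : r < 1
          · rw [Set.indicator_of_mem (show r ∈ Set.Iio 1 from h1)]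
            have : ∀ θ : ℝ, ENNReal.ofReal r • (Metric.ball (0:ℂ) 1).indicator (fun z => ENNReal.ofReal (KK ζ z)) (Complex.polarCoord.symm (r, θ))
               ≤ ENNReal.ofReal (KK ζ (circleMap 0 r θ)) := by
              intro θ
              rw [symm_eq, Set.indicator_of_mem (by simp [abs_of_pos hr0, h1])]
              rw [smul_eq_mul]
              refine mul_le_of_le_one_left (by simp) ?_
              simpa using h1.le
            refine (lintegral_mono this).trans ?_
            rw [← ofReal_integral_eq_lintegral_ofReal]
            · rw [← integral_Ioc_eq_integral_Ioo, ← intervalIntegral.integral_of_le (by linarith [Real.pi_pos])]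
              have := circ_aux hζ hr0.le h1 0
              simp only [pow_zero, mul_one, mul_zero] at this
              rw [intervalIntegral.integral_ofReal] at this
              refine ENNReal.ofReal_le_ofReal (le_of_eq ?_)
              exact_mod_cast this
            · exact ((KK_cont hζ hr0.le h1).integrableOn_Icc).mono_set Set.Ioo_subset_Icc_self
            · refine Filter.Eventually.of_forall fun θ => KK_nonneg ?_
              simp [abs_of_pos hr0, h1.le]
          · have : ∀ θ : ℝ, ENNReal.ofReal r • (Metric.ball (0:ℂ) 1).indicator (fun z => ENNReal.ofReal (KK ζ z)) (Complex.polarCoord.symm (r, θ))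
               = 0 := by
              intro θ
              rw [symm_eq, Set.indicator_of_notMem (by simpa [abs_of_pos hr0] using h1)]
              simp
            simp only [this]
            simp
    _ = _ := by
        rw [lintegral_indicator measurableSet_Iio, Measure.restrict_restrict measurableSet_Iio]
        have : Set.Iio (1:ℝ) ∩ Set.Ioi 0 = Set.Ioo 0 1 := by ext; simp [and_comm]
        simp [this]
  · refine Measurable.aemeasurable ?_
    refine Measurable.smul (f := fun p : ℝ × ℝ => ENNReal.ofReal p.1) (by fun_prop) ?_
    refine (hK.ennreal_ofReal.indicator Metric.isOpen_ball.measurableSet).comp ?_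
    simp only [funext symm_eq]
    unfold circleMap
    fun_prop

lemma disc_polar (F : ℂ → ℂ) (hm : Measurable F) (hF : IntegrableOn F (Metric.ball 0 1)) :
    ∫ z in Metric.ball (0 : ℂ) 1, F z = 
      ∫ r in Set.Ioo (0:ℝ) 1, r • ∫ θ in (-Real.pi)..Real.pi, F (circleMap 0 r θ) := by
  have hcm : Measurable (fun p : ℝ × ℝ => Complex.polarCoord.symm p) := by
    simp only [funext symm_eq]
    unfold circleMap
    fun_prop
  have hmi : Measurable ((Metric.ball (0:ℂ) 1).indicator F) := hm.indicator Metric.isOpen_ball.measurableSet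
  rw [← integral_indicator Metric.isOpen_ball.measurableSet, ← Complex.integral_comp_polarCoord_symm]
  have hI : IntegrableOn (fun p : ℝ × ℝ => p.1 • (Metric.ball (0:ℂ) 1).indicator F (Complex.polarCoord.symm p))
      polarCoord.target := by
    refine ⟨(measurable_fst.smul (hmi.comp hcm)).aestronglyMeasurable, ?_⟩
    have h2 := ((integrable_indicator_iff Metric.isOpen_ball.measurableSet).2 hF).2
    unfold HasFiniteIntegral at h2 ⊢
    rw [← Complex.lintegral_comp_polarCoord_symm] at h2
    refine lt_of_le_of_lt (setLIntegral_mono' ?_ ?_) h2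
    · rw [polarCoord_target]; measurability
    · intro p hp
      rw [polarCoord_target] at hp
      have : 0 < p.1 := hp.1
      rw [enorm_smul, Real.enorm_eq_ofReal this.le]
      rfl
  rw [polarCoord_target, Measure.volume_eq_prod] at *
  rw [setIntegral_prod _ hI]
  have hs : Set.Ioo (0:ℝ) 1 ⊆ Set.Ioi 0 := Set.Ioo_subset_Ioi_self
  rw [setIntegral_eq_of_subset_of_forall_sdiff_eq_zero measurableSet_Ioi hs]
  · refine setIntegral_congr_fun measurableSet_Ioo fun r hr => ?_
    simp only
    rw [integral_smul, intervalIntegral.integral_of_le (by linarith [Real.pi_pos]), integral_Ioc_eq_integral_Ioo]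
    congr 1
    refine integral_congr_ae (Filter.Eventually.of_forall fun θ => ?_)
    simp only [symm_eq]
    rw [Set.indicator_of_mem (by simp [abs_of_pos hr.1, hr.2])]
  · intro r hr
    have h0 : 0 < r := hr.1
    have h1 : 1 ≤ r := by
      by_contra h
      exact hr.2 ⟨h0, not_le.1 h⟩
    have : ∀ θ, (Metric.ball (0:ℂ) 1).indicator F (Complex.polarCoord.symm (r, θ)) = 0 := by
      intro θ
      rw [symm_eq, Set.indicator_of_notMem (by simpa [abs_of_pos h0] using h1)]
    simp only [this]
    simp

lemma disc_int {ζ : ℂ} (hζ : ‖ζ‖ = 1) (p j k : ℕ) :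
    ∫ z in Metric.ball (0 : ℂ) 1, ((KK ζ z * (1 - ‖z‖ ^ 2) ^ p : ℝ) : ℂ) * (z ^ j * (starRingEnd ℂ z) ^ k)
     = Real.pi * (((max j k).factorial * p.factorial : ℝ) / ((max j k + p + 1).factorial : ℝ) : ℝ)
        * (ζ ^ j * (starRingEnd ℂ ζ) ^ k) := by
  have hK : Measurable fun z => KK ζ z := by unfold KK; fun_prop
  rw [disc_polar]
  · have : ∀ r ∈ Set.Ioo (0:ℝ) 1, r • ∫ θ in (-Real.pi)..Real.pi, 
        ((KK ζ (circleMap 0 r θ) * (1 - ‖circleMap 0 r θ‖ ^ 2) ^ p : ℝ) : ℂ) * ((circleMap 0 r θ) ^ j * (starRingEnd ℂ (circleMap 0 r θ)) ^ k)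
        = ((r * (r ^ (2 * max j k) * (1 - r ^ 2) ^ p) : ℝ) : ℂ) * (2 * Real.pi * (ζ ^ j * (starRingEnd ℂ ζ) ^ k)) := by
      intro r hr
      have e : ∀ θ, ((KK ζ (circleMap 0 r θ) * (1 - ‖circleMap 0 r θ‖ ^ 2) ^ p : ℝ) : ℂ) * ((circleMap 0 r θ) ^ j * (starRingEnd ℂ (circleMap 0 r θ)) ^ k)
         = ((1 - r ^ 2) ^ p : ℂ) * ((KK ζ (circleMap 0 r θ) : ℂ) * ((circleMap 0 r θ) ^ j *
        (starRingEnd ℂ (circleMap 0 r θ)) ^ k)) := by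
        intro θ
        rw [norm_circleMap_zero, sq_abs]
        push_cast
        ring
      simp only [e]
      rw [intervalIntegral.integral_const_mul, circ_aux2 hζ hr.1.le hr.2]
      rw [Complex.real_smul]
      push_cast
      ring
    rw [setIntegral_congr_fun measurableSet_Ioo this, integral_mul_const, integral_complex_ofReal,
      ← integral_Ioc_eq_integral_Ioo, ← intervalIntegral.integral_of_le zero_le_one, beta_aux]
    have := Nat.factorial_ne_zero (max j k + p + 1)
    push_cast
    field_simp
  · refine Measurable.mul (Complex.measurable_ofReal.comp (by fun_prop)) (by fun_prop)
  · have hKi : IntegrableOn (fun z => KK ζ z) (Metric.ball 0 1) := by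
      refine ⟨hK.aestronglyMeasurable, ?_⟩
      rw [hasFiniteIntegral_iff_ofReal]
      · exact (disc_lint hζ).trans_lt ENNReal.ofReal_lt_top
      · filter_upwards [ae_restrict_mem Metric.isOpen_ball.measurableSet] with z hz
        exact KK_nonneg ((mem_ball_zero_iff.1 hz).le)
    refine Integrable.mono hKi ?_ ?_
    · exact (Measurable.mul (Complex.measurable_ofReal.comp (by fun_prop)) (by fun_prop)).aestronglyMeasurable
    · filter_upwards [ae_restrict_mem Metric.isOpen_ball.measurableSet] with z hz
      have hz' : ‖z‖ ≤ 1 := (mem_ball_zero_iff.1 hz).le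
      have h2 : ‖z‖ ^ 2 ≤ 1 := pow_le_one₀ (norm_nonneg _) hz'
      simp only [norm_mul, norm_pow, RCLike.norm_conj, Complex.norm_real]
      have a1 : ‖1 - ‖z‖ ^ 2‖ ^ p ≤ 1 := by
        refine pow_le_one₀ (norm_nonneg _) ?_
        rw [Real.norm_eq_abs, abs_le]
        constructor <;> nlinarith [sq_nonneg ‖z‖]
      have a2 : ‖z‖ ^ j * ‖z‖ ^ k ≤ 1 := mul_le_one₀ (pow_le_one₀ (norm_nonneg _) hz') (by positivity) (pow_le_one₀ (norm_nonneg _) hz')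
      calc _ ≤ ‖KK ζ z‖ * 1 * 1 := by gcongr
        _ = _ := by ring

lemma area_restrict : area.restrict (Metric.ball (0:ℂ) 1) =
    (ENNReal.ofReal Real.pi)⁻¹ • (volume : Measure ℂ).restrict (Metric.ball (0:ℂ) 1) := by
  rw [area, Measure.restrict_smul]

lemma inv_ne_top' : (ENNReal.ofReal Real.pi)⁻¹ ≠ ⊤ := by
  simp [Real.pi_pos]

lemma area_finite : IsFiniteMeasure (area.restrict (Metric.ball (0:ℂ) 1)) := by
  rw [area_restrict]
  have : IsFiniteMeasure ((volume : Measure ℂ).restrict (Metric.ball (0:ℂ) 1)) :=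
    ⟨by rw [Measure.restrict_apply_univ]; exact measure_ball_lt_top⟩
  exact Measure.smul_finite _ inv_ne_top'

lemma joint_int (μ : Measure ℂ) [IsFiniteMeasure μ] (hμ : ∀ᵐ ζ ∂μ, ‖ζ‖ = 1) :
    Integrable (fun p : ℂ × ℂ => KK p.1 p.2) (μ.prod (area.restrict (Metric.ball (0:ℂ) 1))) := by
  have := area_finite
  refine ⟨measurable_KK.aestronglyMeasurable, ?_⟩
  rw [hasFiniteIntegral_iff_ofReal]
  · rw [lintegral_prod _ measurable_KK.ennreal_ofReal.aemeasurable]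
    have : ∀ᵐ ζ ∂μ, ∫⁻ z in Metric.ball (0:ℂ) 1, ENNReal.ofReal (KK ζ z) ∂area ≤
        (ENNReal.ofReal Real.pi)⁻¹ * ENNReal.ofReal (2 * Real.pi) := by
      filter_upwards [hμ] with ζ hζ
      rw [area_restrict, lintegral_smul_measure, smul_eq_mul]
      gcongr
      exact disc_lint hζ
    refine (lintegral_mono_ae this).trans_lt ?_
    rw [lintegral_const]
    exact ENNReal.mul_lt_top (ENNReal.mul_lt_top inv_ne_top'.lt_top ENNReal.ofReal_lt_top) (measure_lt_top _ _)
  · have h : ∀ᵐ z ∂(area.restrict (Metric.ball (0:ℂ) 1)), z ∈ Metric.ball (0:ℂ) 1 :=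
      ae_restrict_mem Metric.isOpen_ball.measurableSet
    filter_upwards [Measure.quasiMeasurePreserving_snd.ae h] with p hp
    exact KK_nonneg (mem_ball_zero_iff.1 hp).le

lemma core_sum (μ : Measure ℂ) [IsFiniteMeasure μ] (hμ : ∀ᵐ ζ ∂μ, ‖ζ‖ = 1) (q : ℕ)
    (g : ℂ → ℂ) (b : ℕ → ℂ) (hb : Summable fun j => ‖b j‖)
    (hg : ∀ z ∈ Metric.ball (0:ℂ) 1, HasSum (fun j => b j * z ^ j) (g z)) :
    Integrable (fun z => poisson μ z * ‖g z‖ ^ 2 * (1 - ‖z‖ ^ 2) ^ q) (area.restrict (Metric.ball (0:ℂ) 1)) ∧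
    HasSum (fun p : ℕ × ℕ => b p.1 * starRingEnd ℂ (b p.2) *
        (((max p.1 p.2).factorial * q.factorial : ℝ) / ((max p.1 p.2 + q + 1).factorial : ℝ) : ℝ) *
        ∫ ζ, ζ ^ p.1 * (starRingEnd ℂ ζ) ^ p.2 ∂μ)
      ((∫ z in Metric.ball (0:ℂ) 1, poisson μ z * ‖g z‖ ^ 2 * (1 - ‖z‖ ^ 2) ^ q ∂area : ℝ) : ℂ) := by
  have := area_finite
  set ν := area.restrict (Metric.ball (0:ℂ) 1) with hν
  have hJ := joint_int μ hμ
  rw [← hν] at hJ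
  have hball : ∀ᵐ z ∂ν, z ∈ Metric.ball (0:ℂ) 1 := ae_restrict_mem Metric.isOpen_ball.measurableSet
  have hball2 : ∀ᵐ x ∂(μ.prod ν), x.2 ∈ Metric.ball (0:ℂ) 1 := Measure.quasiMeasurePreserving_snd.ae hball
  let F : ℕ × ℕ → ℂ × ℂ → ℂ := fun p x =>
    (b p.1 * starRingEnd ℂ (b p.2)) * 
      (((KK x.1 x.2 * (1 - ‖x.2‖ ^ 2) ^ q : ℝ) : ℂ) * (x.2 ^ p.1 * (starRingEnd ℂ x.2) ^ p.2))
  have hKm := measurable_KK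
  have hFm : ∀ p, Measurable (F p) := by
    intro p
    refine Measurable.const_mul (Measurable.mul (Complex.measurable_ofReal.comp (by fun_prop)) (by fun_prop)) _
  have hFb : ∀ p, ∀ᵐ x ∂(μ.prod ν), ‖F p x‖ ≤ ‖b p.1‖ * ‖b p.2‖ * KK x.1 x.2 := by
    intro p
    filter_upwards [hball2] with x hx
    have hz' : ‖x.2‖ ≤ 1 := (mem_ball_zero_iff.1 hx).le
    have h2 : ‖x.2‖ ^ 2 ≤ 1 := pow_le_one₀ (norm_nonneg _) hz'
    simp only [F, norm_mul, norm_pow, RCLike.norm_conj, Complex.norm_real]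
    have a1 : ‖1 - ‖x.2‖ ^ 2‖ ^ q ≤ 1 := by
      refine pow_le_one₀ (norm_nonneg _) ?_
      rw [Real.norm_eq_abs, abs_le]
      constructor <;> nlinarith [sq_nonneg ‖x.2‖]
    have a2 : ‖x.2‖ ^ p.1 * ‖x.2‖ ^ p.2 ≤ 1 := mul_le_one₀ (pow_le_one₀ (norm_nonneg _) hz') (by positivity) (pow_le_one₀ (norm_nonneg _) hz')
    calc _ ≤ ‖b p.1‖ * ‖b p.2‖ * (‖KK x.1 x.2‖ * 1 * 1) := by gcongr
      _ = _ := by rw [Real.norm_of_nonneg (KK_nonneg hz')]; ring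
  have hFi : ∀ p, Integrable (F p) (μ.prod ν) := fun p =>
    Integrable.mono' (hJ.const_mul _) (hFm p).aestronglyMeasurable (hFb p)
  have hbb : Summable fun p : ℕ × ℕ => ‖b p.1‖ * ‖b p.2‖ :=
    hb.mul_of_nonneg hb (fun _ => norm_nonneg _) (fun _ => norm_nonneg _)
  have hFs : Summable fun p => ∫ x, ‖F p x‖ ∂(μ.prod ν) := by
    refine Summable.of_nonneg_of_le (fun p => integral_nonneg fun x => norm_nonneg _) (fun p => ?_)
      (hbb.mul_right (∫ x, KK x.1 x.2 ∂(μ.prod ν)))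
    rw [← integral_const_mul]
    exact integral_mono_ae (hFi p).norm (hJ.const_mul _) (hFb p)
  have hS := hasSum_integral_of_summable_integral_norm hFi hFs
  have hsumm : ∀ z ∈ Metric.ball (0:ℂ) 1, Summable fun j => ‖b j * z ^ j‖ := by
    intro z hz
    exact (hg z hz).summable.norm
  have hT : ∀ x : ℂ × ℂ, x.2 ∈ Metric.ball (0:ℂ) 1 →
      ∑' p, F p x = ((KK x.1 x.2 * ‖g x.2‖ ^ 2 * (1 - ‖x.2‖ ^ 2) ^ q : ℝ) : ℂ) := by
    intro x hx
    have e : ∀ p, F p x = ((KK x.1 x.2 * (1 - ‖x.2‖ ^ 2) ^ q : ℝ) : ℂ) *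
       ((b p.1 * x.2 ^ p.1) * starRingEnd ℂ (b p.2 * x.2 ^ p.2)) := by
      intro p
      simp only [F, map_mul, map_pow]
      ring
    simp only [e]
    have s2 : Summable fun j => ‖starRingEnd ℂ (b j * x.2 ^ j)‖ := by
      simpa only [RCLike.norm_conj] using hsumm x.2 hx
    rw [tsum_mul_left, ← tsum_mul_tsum_of_summable_norm (hsumm x.2 hx) s2, ← Complex.conj_tsum,
      (hg _ hx).tsum_eq, Complex.mul_conj, Complex.normSq_eq_norm_sq]
    push_cast
    ring
  have hTae : (fun x => ∑' p, F p x) =ᵐ[μ.prod ν] 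
      fun x => ((KK x.1 x.2 * ‖g x.2‖ ^ 2 * (1 - ‖x.2‖ ^ 2) ^ q : ℝ) : ℂ) := by
    filter_upwards [hball2] with x hx using hT x hx
  -- g is ae measurable
  have hgm : AEMeasurable g ν := by
    refine aemeasurable_of_tendsto_metrizable_ae Filter.atTop
      (f := fun N z => ∑ j ∈ Finset.range N, b j * z ^ j) (fun N => by fun_prop) ?_
    filter_upwards [hball] with z hz using (hg z hz).tendsto_sum_nat
  have hGi : Integrable (fun x : ℂ × ℂ => KK x.1 x.2 * ‖g x.2‖ ^ 2 * (1 - ‖x.2‖ ^ 2) ^ q) (μ.prod ν) := by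
    have hgm2 : AEMeasurable (fun x : ℂ × ℂ => g x.2) (μ.prod ν) := hgm.comp_quasiMeasurePreserving Measure.quasiMeasurePreserving_snd
    refine Integrable.mono' (hJ.mul_const ((∑' j, ‖b j‖) ^ 2)) ?_ ?_
    · exact ((hKm.aemeasurable.mul (hgm2.norm.pow_const 2)).mul (by fun_prop)).aestronglyMeasurable
    · filter_upwards [hball2] with x hx
      have hz' : ‖x.2‖ ≤ 1 := (mem_ball_zero_iff.1 hx).le
      have h2 : ‖x.2‖ ^ 2 ≤ 1 := pow_le_one₀ (norm_nonneg _) hz'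
      have h3 : ‖g x.2‖ ≤ ∑' j, ‖b j‖ := by
        rw [← (hg _ hx).tsum_eq]
        refine (norm_tsum_le_tsum_norm (hsumm _ hx)).trans ?_
        refine (hsumm _ hx).tsum_le_tsum (fun j => ?_) hb
        rw [norm_mul, norm_pow]
        exact mul_le_of_le_one_right (norm_nonneg _) (pow_le_one₀ (norm_nonneg _) hz')
      have hK0 := KK_nonneg (ζ := x.1) hz'
      have a1 : (1 - ‖x.2‖ ^ 2) ^ q ≤ 1 := pow_le_one₀ (by linarith) (by nlinarith [sq_nonneg ‖x.2‖])
      have a0 : 0 ≤ (1 - ‖x.2‖ ^ 2) ^ q := pow_nonneg (by linarith) _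
      rw [Real.norm_of_nonneg (by positivity)]
      calc _ ≤ KK x.1 x.2 * (∑' j, ‖b j‖) ^ 2 * 1 := by gcongr
        _ = _ := by ring
  have hin : ∀ z, ∫ ζ, KK ζ z * ‖g z‖ ^ 2 * (1 - ‖z‖ ^ 2) ^ q ∂μ = poisson μ z * ‖g z‖ ^ 2 * (1 - ‖z‖ ^ 2) ^ q := by
    intro z
    rw [integral_mul_const, integral_mul_const]
    rfl
  refine ⟨?_, ?_⟩
  · have := hGi.integral_prod_right
    simpa only [hin] using this
  · rw [integral_congr_ae hTae, integral_complex_ofReal, integral_prod_symm _ hGi] at hS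
    simp only [hin] at hS
    refine (funext (fun p => ?_) : (fun p : ℕ × ℕ => _) = (fun p => ∫ x, F p x ∂(μ.prod ν))) ▸ hS
    rw [integral_prod _ (hFi p), ← integral_const_mul]
    refine integral_congr_ae ?_
    filter_upwards [hμ] with ζ hζ
    simp only [F]
    rw [integral_const_mul, hν, area_restrict, integral_smul_measure, disc_int hζ]
    rw [ENNReal.toReal_inv, ENNReal.toReal_ofReal Real.pi_pos.le, Complex.real_smul]
    have := Real.pi_ne_zero
    push_cast
    field_simp

/-- For `f(z) = Σ_j \hat f(j) z^j` holomorphic on a neighbourhood of the closed unit disc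
and a finite positive Borel measure `μ` on the unit circle,
`D_{μ,n}(f) = Σ_{k,l ≥ n} binom(min(k,l),n) \hat μ(l-k) \hat f(k) \overline{\hat f(l)}`
where `\hat μ(l-k) = ∫ ζ^{k-l} dμ = ∫ ζ^k \bar ζ^l dμ`, the double series converging
absolutely. -/
theorem eDirichlet_eq_sum (μ : Measure ℂ) [IsFiniteMeasure μ]
    (hμ : μ {z : ℂ | ‖z‖ ≠ 1} = 0) (n : ℕ) (hn : 1 ≤ n)
    (f : ℂ → ℂ) (a : ℕ → ℂ) (R : ℝ) (hR : 1 < R)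
    (hf : ∀ z ∈ Metric.ball (0 : ℂ) R, HasSum (fun j => a j * z ^ j) (f z)) :
    Summable (fun p : ℕ × ℕ =>
      ‖((min p.1 p.2).choose n : ℂ) * (∫ z, z ^ p.1 * (starRingEnd ℂ z) ^ p.2 ∂μ)
        * a p.1 * (starRingEnd ℂ) (a p.2)‖) ∧
    eDirichlet μ n f ≠ ⊤ ∧
    (∑' p : ℕ × ℕ, ((min p.1 p.2).choose n : ℂ) *
        (∫ z, z ^ p.1 * (starRingEnd ℂ z) ^ p.2 ∂μ) * a p.1 * (starRingEnd ℂ) (a p.2))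
      = ((eDirichlet μ n f).toReal : ℂ) := by
  have hμ' : ∀ᵐ ζ ∂μ, ‖ζ‖ = 1 := hμ
  obtain ⟨hI, hS⟩ := core_sum μ hμ' (n - 1) (iteratedDeriv n f)
    (fun j => ((j + n).factorial : ℂ) / j.factorial * a (j + n))
    (by
      have := (taylor_aux n f a R hR hf 1 (by simpa using hR)).summable.norm
      simpa only [one_pow, mul_one] using this)
    (fun z hz => taylor_aux n f a R hR hf z (Metric.ball_subset_ball hR.le hz))
  have hnn : ∀ᵐ z ∂(area.restrict (Metric.ball (0:ℂ) 1)),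
      0 ≤ poisson μ z * ‖iteratedDeriv n f z‖ ^ 2 * (1 - ‖z‖ ^ 2) ^ (n - 1) := by
    filter_upwards [ae_restrict_mem Metric.isOpen_ball.measurableSet] with z hz
    have hz' : ‖z‖ ≤ 1 := (mem_ball_zero_iff.1 hz).le
    have h2 : ‖z‖ ^ 2 ≤ 1 := pow_le_one₀ (norm_nonneg _) hz'
    have a0 : 0 ≤ (1 - ‖z‖ ^ 2) ^ (n - 1) := pow_nonneg (by linarith) _
    have : 0 ≤ poisson μ z := integral_nonneg fun ζ => KK_nonneg hz'
    positivity
  have hfac : ((n.factorial * (n - 1).factorial : ℕ) : ℝ≥0∞) ≠ 0 := by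
    exact_mod_cast (Nat.mul_pos (Nat.factorial_pos _) (Nat.factorial_pos _)).ne'
  have hE : eDirichlet μ n f = (((n.factorial * (n - 1).factorial : ℕ) : ℝ≥0∞))⁻¹ *
      ENNReal.ofReal (∫ z in Metric.ball (0:ℂ) 1,
        poisson μ z * ‖iteratedDeriv n f z‖ ^ 2 * (1 - ‖z‖ ^ 2) ^ (n - 1) ∂area) := by
    rw [ofReal_integral_eq_lintegral_ofReal hI hnn]
    rfl
  have hE' : (eDirichlet μ n f).toReal = ((n.factorial * (n - 1).factorial : ℕ) : ℝ)⁻¹ *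
      (∫ z in Metric.ball (0:ℂ) 1,
        poisson μ z * ‖iteratedDeriv n f z‖ ^ 2 * (1 - ‖z‖ ^ 2) ^ (n - 1) ∂area) := by
    rw [hE, ENNReal.toReal_mul, ENNReal.toReal_ofReal (integral_nonneg_of_ae hnn), ENNReal.toReal_inv,
      ENNReal.toReal_natCast]
  have hfin : eDirichlet μ n f ≠ ⊤ := by
    rw [hE]
    exact ENNReal.mul_ne_top (ENNReal.inv_ne_top.2 hfac) ENNReal.ofReal_ne_top
  let T : ℕ × ℕ → ℂ := fun p => ((min p.1 p.2).choose n : ℂ) *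
        (∫ z, z ^ p.1 * (starRingEnd ℂ z) ^ p.2 ∂μ) * a p.1 * (starRingEnd ℂ) (a p.2)
  let sh : ℕ × ℕ → ℕ × ℕ := fun p => (p.1 + n, p.2 + n)
  have hsh : Function.Injective sh := by
    rintro ⟨x, y⟩ ⟨x', y'⟩ h
    simp only [sh, Prod.mk.injEq] at h
    ext <;> simp <;> omega
  have hT : HasSum (T ∘ sh) ((eDirichlet μ n f).toReal : ℂ) := by
    have h1 := hS.mul_left (((n.factorial * (n - 1).factorial : ℕ) : ℂ)⁻¹)
    rw [hE', Complex.ofReal_mul, Complex.ofReal_inv, Complex.ofReal_natCast]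
    refine (funext (fun p => ?_) : T ∘ sh = _) ▸ h1
    obtain ⟨j, k⟩ := p
    have hint : ∫ z, z ^ (j + n) * (starRingEnd ℂ z) ^ (k + n) ∂μ = ∫ z, z ^ j * (starRingEnd ℂ z) ^ k ∂μ := by
      refine integral_congr_ae ?_
      filter_upwards [hμ'] with ζ hζ
      have n1 : ζ * starRingEnd ℂ ζ = 1 := by
        rw [Complex.mul_conj, Complex.normSq_eq_norm_sq, hζ]; simp
      calc _ = ζ ^ j * (starRingEnd ℂ ζ) ^ k * (ζ * starRingEnd ℂ ζ) ^ n := by ring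
        _ = _ := by rw [n1]; simp
    simp only [T, sh, Function.comp, hint, map_mul, map_div₀, map_natCast]
    rw [show max j k + (n - 1) + 1 = max j k + n by omega, min_add_add_right,
      Nat.cast_choose ℂ (Nat.le_add_left n _), Nat.add_sub_cancel]
    have f1 : ∀ m : ℕ, (m.factorial : ℂ) ≠ 0 := fun m => by exact_mod_cast Nat.factorial_ne_zero m
    have := f1 n
    have := f1 (n - 1)
    have := f1 j
    have := f1 k
    have := f1 (j + n)
    have := f1 (k + n)
    rcases le_total j k with h | h
    · rw [max_eq_right h, min_eq_left h]
      push_cast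
      field_simp
    · rw [max_eq_left h, min_eq_right h]
      push_cast
      field_simp
  have hT2 : HasSum T ((eDirichlet μ n f).toReal : ℂ) := by
    refine (hsh.hasSum_iff ?_).1 hT
    rintro ⟨x, y⟩ hxy
    have : min x y < n := by
      by_contra h
      apply hxy
      refine ⟨(x - n, y - n), ?_⟩
      simp only [sh, Prod.mk.injEq]
      omega
    simp [T, Nat.choose_eq_zero_of_lt this]
  exact ⟨hT2.summable.norm, hfin, hT2.tsum_eq⟩
end

section
/- Let μ be a finite positive Borel measure on the unit circle and n ∈ ℤ₊. For every function f holomorphic on a neighbourhood of the closed unit disc, D_{μ,n+1}(zf) - D_{μ,n+1}(f) = D_{μ,n}(f). -/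
open MeasureTheory
open scoped ENNReal

/-- The circle average `R ↦ ∫_𝕋 P_μ(Rζ)|f(Rζ)|² dσ(ζ)` (σ the normalized arc-length
measure), whose limit as `R → 1⁻` is the order-zero weighted Dirichlet integral
`D_{μ,0}(f)`. -/
noncomputable def circleAvg (μ : Measure ℂ) (f : ℂ → ℂ) (R : ℝ) : ℝ :=
  (2 * Real.pi)⁻¹ * ∫ θ in (0 : ℝ)..(2 * Real.pi),
    poisson μ (R * Complex.exp (θ * Complex.I)) * ‖f (R * Complex.exp (θ * Complex.I))‖ ^ 2

lemma dd_parseval (c : ℕ → ℂ) (hc : Summable fun m => ‖c m‖) (F : ℝ → ℂ)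
    (hF : ∀ θ : ℝ, HasSum (fun m : ℕ => c m * Complex.exp (θ * Complex.I) ^ m) (F θ))
    (a b : ℝ) (hab : b = a + 2 * Real.pi) :
    ∫ θ in a..b, ‖F θ‖ ^ 2 = 2 * Real.pi * ∑' m, ‖c m‖ ^ 2 := by
  have hexp : ∀ (θ : ℝ) (m : ℕ), ‖Complex.exp (θ * Complex.I) ^ m‖ = 1 := by
    intro θ m; rw [norm_pow, Complex.norm_exp_ofReal_mul_I, one_pow]
  have hFc : Continuous F := by
    have : F = fun θ : ℝ => ∑' m, c m * Complex.exp (θ * Complex.I) ^ m := by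
      funext θ; exact (hF θ).tsum_eq.symm
    rw [this]
    refine continuous_tsum (fun m => by fun_prop) hc (fun m θ => ?_)
    rw [norm_mul, hexp, mul_one]
  have hFb : ∀ θ, ‖F θ‖ ≤ ∑' m, ‖c m‖ := by
    intro θ
    rw [← (hF θ).tsum_eq]
    refine (norm_tsum_le_tsum_norm ?_).trans (le_of_eq ?_)
    · simpa [norm_mul, hexp] using hc
    · simp [norm_mul, hexp]
  -- orthogonality
  have horth : ∀ k l : ℕ, ∫ θ in a..b, Complex.exp (θ * Complex.I) ^ k *
      (starRingEnd ℂ) (Complex.exp (θ * Complex.I) ^ l) = if k = l then (2 * Real.pi : ℂ) else 0 := by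
    intro k l
    have e : ∀ θ : ℝ, Complex.exp (θ * Complex.I) ^ k *
      (starRingEnd ℂ) (Complex.exp (θ * Complex.I) ^ l) =
        Complex.exp ((((k : ℂ) - l) * Complex.I) * θ) := by
      intro θ
      rw [map_pow, ← Complex.exp_conj, ← Complex.exp_nat_mul, ← Complex.exp_nat_mul,
        ← Complex.exp_add]
      congr 1
      simp
      ring
    simp_rw [e]
    split_ifs with h
    · subst h
      simp [hab]
    · have hne : ((k : ℂ) - l) * Complex.I ≠ 0 := by
        refine mul_ne_zero (sub_ne_zero.mpr ?_) Complex.I_ne_zero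
        exact_mod_cast h
      rw [integral_exp_mul_complex hne]
      have : Complex.exp (((k : ℂ) - l) * Complex.I * b) =
          Complex.exp (((k : ℂ) - l) * Complex.I * a) := by
        rw [Complex.exp_eq_exp_iff_exists_int]
        refine ⟨(k : ℤ) - l, ?_⟩
        rw [hab]; push_cast; ring
      rw [this]; simp
  have hcF : ∀ k : ℕ, ∫ θ in a..b, Complex.exp (θ * Complex.I) ^ k * (starRingEnd ℂ) (F θ) =
      2 * Real.pi * (starRingEnd ℂ) (c k) := by
    intro k
    have h1 : HasSum (fun l : ℕ => ∫ θ in a..b, Complex.exp (θ * Complex.I) ^ k *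
        (starRingEnd ℂ) (c l * Complex.exp (θ * Complex.I) ^ l))
        (∫ θ in a..b, Complex.exp (θ * Complex.I) ^ k * (starRingEnd ℂ) (F θ)) := by
      refine intervalIntegral.hasSum_integral_of_dominated_convergence (fun l _ => ‖c l‖)
        (fun l => Continuous.aestronglyMeasurable (by fun_prop)) ?_ ?_ ?_ ?_
      · intro l
        refine Filter.Eventually.of_forall fun θ _ => ?_
        rw [norm_mul, hexp, RCLike.norm_conj, norm_mul, hexp]; simp
      · exact Filter.Eventually.of_forall fun θ _ => hc
      · exact intervalIntegrable_const
      · refine Filter.Eventually.of_forall fun θ _ => ?_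
        exact (((hF θ).map (starRingEnd ℂ) Complex.continuous_conj)).mul_left _
    refine h1.unique ?_
    have h2 : (fun l : ℕ => ∫ θ in a..b, Complex.exp (θ * Complex.I) ^ k *
        (starRingEnd ℂ) (c l * Complex.exp (θ * Complex.I) ^ l)) =
        fun l => if l = k then 2 * Real.pi * (starRingEnd ℂ) (c k) else 0 := by
      funext l
      have : ∀ θ : ℝ, Complex.exp (θ * Complex.I) ^ k *
        (starRingEnd ℂ) (c l * Complex.exp (θ * Complex.I) ^ l) = (starRingEnd ℂ) (c l) *
        (Complex.exp (θ * Complex.I) ^ k *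
        (starRingEnd ℂ) (Complex.exp (θ * Complex.I) ^ l)) := by
        intro θ; rw [map_mul]; ring
      simp_rw [this]
      rw [intervalIntegral.integral_const_mul, horth]
      by_cases h : k = l
      · subst h; simp; ring
      · simp [h, Ne.symm h]
    rw [h2]
    exact hasSum_ite_eq _ _
  have h3 : HasSum (fun k : ℕ => ∫ θ in a..b, (c k * Complex.exp (θ * Complex.I) ^ k) *
        (starRingEnd ℂ) (F θ))
        (∫ θ in a..b, F θ * (starRingEnd ℂ) (F θ)) := by
    refine intervalIntegral.hasSum_integral_of_dominated_convergence
      (fun l _ => ‖c l‖ * ∑' m, ‖c m‖)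
      (fun l => Continuous.aestronglyMeasurable (by fun_prop)) ?_ ?_ ?_ ?_
    · intro l
      refine Filter.Eventually.of_forall fun θ _ => ?_
      rw [norm_mul, RCLike.norm_conj, norm_mul, hexp, mul_one]
      exact mul_le_mul_of_nonneg_left (hFb θ) (norm_nonneg _)
    · exact Filter.Eventually.of_forall fun θ _ => hc.mul_right _
    · exact intervalIntegrable_const
    · exact Filter.Eventually.of_forall fun θ _ => (hF θ).mul_right _
  have h4 : HasSum (fun k : ℕ => ((2 * Real.pi * ‖c k‖ ^ 2 : ℝ) : ℂ))
      ((∫ θ in a..b, ‖F θ‖ ^ 2 : ℝ) : ℂ) := by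
    convert h3 using 1
    · funext k
      simp_rw [mul_assoc]
      rw [intervalIntegral.integral_const_mul, hcF]
      push_cast
      rw [← Complex.mul_conj']
      ring
    · rw [← intervalIntegral.integral_ofReal]
      congr 1
      funext θ
      rw [Complex.mul_conj']; push_cast; rfl
  have h5 : HasSum (fun k : ℕ => (2 * Real.pi * ‖c k‖ ^ 2 : ℝ))
      (∫ θ in a..b, ‖F θ‖ ^ 2 : ℝ) := by exact_mod_cast h4
  rw [← h5.tsum_eq, tsum_mul_left]

lemma dd_beta (N m : ℕ) : ∫ r in (0:ℝ)..1, 2 * r ^ (2 * m + 1) * (1 - r ^ 2) ^ N =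
    (m.factorial * N.factorial : ℝ) / (m + N + 1).factorial := by
  induction N generalizing m with
  | zero =>
    simp only [pow_zero, mul_one, Nat.factorial_zero, Nat.cast_one, add_zero]
    rw [intervalIntegral.integral_const_mul, integral_pow, Nat.factorial_succ]
    have : (m.factorial : ℝ) ≠ 0 := by positivity
    push_cast
    field_simp
    simp
    ring
  | succ N ih =>
    have hd : ∀ r : ℝ, HasDerivAt (fun r : ℝ => r ^ (2 * m + 2) * (1 - r ^ 2) ^ (N + 1))
        ((m + 1) * (2 * r ^ (2 * m + 1) * (1 - r ^ 2) ^ (N + 1)) -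
         (N + 1) * (2 * r ^ (2 * (m + 1) + 1) * (1 - r ^ 2) ^ N)) r := by
      intro r
      have h1 := (hasDerivAt_pow (2 * m + 2) r).mul
        ((((hasDerivAt_pow 2 r).const_sub 1)).pow (N + 1))
      refine (h1.congr_deriv ?_)
      simp
      ring
    have hi := intervalIntegral.integral_eq_sub_of_hasDerivAt (a := 0) (b := 1)
      (fun r _ => hd r) (Continuous.intervalIntegrable (by fun_prop) _ _)
    rw [intervalIntegral.integral_sub (Continuous.intervalIntegrable (by fun_prop) _ _)
      (Continuous.intervalIntegrable (by fun_prop) _ _),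
      intervalIntegral.integral_const_mul, intervalIntegral.integral_const_mul, ih (m + 1)] at hi
    simp only [one_pow, sub_self, ne_eq, Nat.add_eq_zero_iff, one_ne_zero, and_false,
      not_false_eq_true, zero_pow, mul_zero, sub_zero, zero_mul, OfNat.ofNat_ne_zero] at hi
    have e : m + 1 + N + 1 = m + (N + 1) + 1 := by ring
    rw [e] at hi
    have hm : (m + 1 : ℝ) ≠ 0 := by positivity
    apply mul_left_cancel₀ hm
    rw [sub_eq_zero.mp hi, Nat.factorial_succ m, Nat.factorial_succ N]
    push_cast
    ring

lemma dd_tele (p : ℕ → ℝ) (hp : ∀ i, 0 < p i) (t : ℕ → ℂ) (V : ℕ → ℂ) (W : ℕ → ℝ)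
    (hV0 : V 0 = p 0 * t 0) (hW0 : W 0 = p 0)
    (hV : ∀ m, V (m + 1) = V m + p (m + 1) * t (m + 1))
    (hW : ∀ m, W (m + 1) = W m + p (m + 1))
    (hs : Summable fun i => p i * ‖t i‖ ^ 2)
    (hlim : Filter.Tendsto (fun m => ‖V m‖ ^ 2 / W m) Filter.atTop (nhds 0)) :
    HasSum (fun m => p (m + 1) / (W m * W (m + 1)) * ‖V m - W m * t (m + 1)‖ ^ 2)
      (∑' i, p i * ‖t i‖ ^ 2) := by
  have hWpos : ∀ m, 0 < W m := by
    intro m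
    induction m with
    | zero => rw [hW0]; exact hp 0
    | succ m ih => rw [hW]; exact add_pos ih (hp _)
  rw [hasSum_iff_tendsto_nat_of_nonneg]
  · have key : ∀ K, ∑ m ∈ Finset.range K,
        p (m + 1) / (W m * W (m + 1)) * ‖V m - W m * t (m + 1)‖ ^ 2 =
        ∑ i ∈ Finset.range (K + 1), p i * ‖t i‖ ^ 2 - ‖V K‖ ^ 2 / W K := by
      intro K
      induction K with
      | zero =>
        have := (hp 0).ne'
        simp [hV0, hW0, norm_mul, abs_of_pos (hp 0)]
        field_simp
        ring
      | succ K ih =>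
        rw [Finset.sum_range_succ, ih, Finset.sum_range_succ _ (K + 1)]
        have h1 : ‖V (K + 1)‖ ^ 2 = ‖V K‖ ^ 2 + p (K + 1) ^ 2 * ‖t (K + 1)‖ ^ 2 +
            2 * p (K + 1) * (V K * (starRingEnd ℂ) (t (K + 1))).re := by
          rw [hV, ← Complex.normSq_eq_norm_sq, ← Complex.normSq_eq_norm_sq,
            ← Complex.normSq_eq_norm_sq, Complex.normSq_apply, Complex.normSq_apply,
            Complex.normSq_apply]
          simp
          ring
        have h2 : ‖V K - W K * t (K + 1)‖ ^ 2 = ‖V K‖ ^ 2 + W K ^ 2 * ‖t (K + 1)‖ ^ 2 -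
            2 * W K * (V K * (starRingEnd ℂ) (t (K + 1))).re := by
          rw [← Complex.normSq_eq_norm_sq, ← Complex.normSq_eq_norm_sq,
            ← Complex.normSq_eq_norm_sq, Complex.normSq_apply, Complex.normSq_apply,
            Complex.normSq_apply]
          simp
          ring
        rw [h1, h2]
        have a1 := (hWpos K).ne'
        have a2 := (hWpos (K + 1)).ne'
        have hp' : p (K + 1) = W (K + 1) - W K := by rw [hW]; ring
        rw [hp']
        field_simp
        ring
    simp_rw [key]
    have := (hs.hasSum.tendsto_sum_nat.comp (Filter.tendsto_add_atTop_nat 1)).sub hlim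
    simpa using this
  · intro m
    have := hWpos m
    have := hWpos (m + 1)
    have := hp (m + 1)
    positivity
/-- Poisson kernel. -/
noncomputable def ddk (z ζ : ℂ) : ℝ := (1 - ‖z‖ ^ 2) / ‖z - ζ‖ ^ 2

/-- Partial sums. -/
noncomputable def ddS (b : ℕ → ℂ) (ζ : ℂ) (m : ℕ) : ℂ := ∑ k ∈ Finset.range (m + 1), b k * ζ ^ k

lemma ddk_measurable : Measurable (Function.uncurry ddk) := by
  unfold ddk Function.uncurry
  fun_prop

lemma ddk_nonneg {z : ℂ} (hz : ‖z‖ < 1) (ζ : ℂ) : 0 ≤ ddk z ζ := by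
  unfold ddk
  have : 0 ≤ 1 - ‖z‖ ^ 2 := by nlinarith [norm_nonneg z]
  positivity

lemma dd_norm_sub {z ζ : ℂ} (hζ : ‖ζ‖ = 1) : ‖z - ζ‖ = ‖1 - z * (starRingEnd ℂ) ζ‖ := by
  have h : ζ * (starRingEnd ℂ) ζ = 1 := by rw [Complex.mul_conj']; simp [hζ]
  have : 1 - z * (starRingEnd ℂ) ζ = - ((z - ζ) * (starRingEnd ℂ) ζ) := by
    rw [sub_mul, h]; ring
  rw [this, norm_neg, norm_mul, RCLike.norm_conj, hζ, mul_one]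

lemma ddk_eq {z ζ : ℂ} (hζ : ‖ζ‖ = 1) (w : ℂ) :
    ddk z ζ * ‖w‖ ^ 2 = (1 - ‖z‖ ^ 2) * ‖w / (1 - z * (starRingEnd ℂ) ζ)‖ ^ 2 := by
  rw [norm_div, ← dd_norm_sub hζ, ddk, div_pow]; ring

lemma dd_cauchy {b : ℕ → ℂ} {g : ℂ → ℂ}
    (hg : ∀ z : ℂ, ‖z‖ < 1 → HasSum (fun k => b k * z ^ k) (g z)) {ζ : ℂ} (hζ : ‖ζ‖ = 1)
    {z : ℂ} (hz : ‖z‖ < 1) :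
    (Summable fun m => ‖ddS b ζ m * (starRingEnd ℂ) ζ ^ m * z ^ m‖) ∧
    HasSum (fun m => ddS b ζ m * (starRingEnd ℂ) ζ ^ m * z ^ m)
      (g z / (1 - z * (starRingEnd ℂ) ζ)) := by
  have h : ζ * (starRingEnd ℂ) ζ = 1 := by rw [Complex.mul_conj']; simp [hζ]
  set w := z * (starRingEnd ℂ) ζ with hw
  have hwn : ‖w‖ < 1 := by rw [hw, norm_mul, RCLike.norm_conj, hζ, mul_one]; exact hz
  have hs1 : Summable fun k => ‖b k * z ^ k‖ := (hg z hz).summable.norm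
  have hs2 : Summable fun k => ‖w ^ k‖ := (summable_geometric_of_norm_lt_one hwn).norm
  have e : ∀ m, ∑ k ∈ Finset.range (m + 1), (b k * z ^ k) * w ^ (m - k) =
      ddS b ζ m * (starRingEnd ℂ) ζ ^ m * z ^ m := by
    intro m
    rw [ddS, Finset.sum_mul, Finset.sum_mul]
    refine Finset.sum_congr rfl fun k hk => ?_
    have hk' : k ≤ m := by simpa [Nat.lt_succ_iff] using hk
    obtain ⟨j, rfl⟩ := Nat.exists_eq_add_of_le hk'
    have : ζ ^ k * (starRingEnd ℂ) ζ ^ k = 1 := by rw [← mul_pow, h, one_pow]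
    rw [Nat.add_sub_cancel_left, hw]
    calc b k * z ^ k * (z * (starRingEnd ℂ) ζ) ^ j
        = b k * z ^ k * (z * (starRingEnd ℂ) ζ) ^ j * 1 := by ring
      _ = _ := by rw [← this]; ring
  have hs3 := summable_norm_sum_mul_range_of_summable_norm hs1 hs2
  simp_rw [e] at hs3
  refine ⟨hs3, ?_⟩
  have ht := tsum_mul_tsum_eq_tsum_sum_range_of_summable_norm hs1 hs2
  simp_rw [e] at ht
  rw [(hg z hz).tsum_eq, tsum_geometric_of_norm_lt_one hwn] at ht
  rw [div_eq_mul_inv, ht]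
  exact hs3.of_norm.hasSum

lemma dd_circle {b : ℕ → ℂ} {g : ℂ → ℂ}
    (hg : ∀ z : ℂ, ‖z‖ < 1 → HasSum (fun k => b k * z ^ k) (g z)) {ζ : ℂ} (hζ : ‖ζ‖ = 1)
    {r : ℝ} (hr0 : 0 ≤ r) (hr1 : r < 1) (x y : ℝ) (hxy : y = x + 2 * Real.pi) :
    (Summable fun m => r ^ (2 * m) * ‖ddS b ζ m‖ ^ 2) ∧
    Continuous (fun θ : ℝ => ddk (r * Complex.exp (θ * Complex.I)) ζ *
      ‖g (r * Complex.exp (θ * Complex.I))‖ ^ 2) ∧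
    ∫ θ in x..y, ddk (r * Complex.exp (θ * Complex.I)) ζ *
      ‖g (r * Complex.exp (θ * Complex.I))‖ ^ 2 =
      2 * Real.pi * ((1 - r ^ 2) * ∑' m, r ^ (2 * m) * ‖ddS b ζ m‖ ^ 2) := by
  have hz : ∀ θ : ℝ, ‖(r * Complex.exp (θ * Complex.I) : ℂ)‖ = r := by
    intro θ
    rw [norm_mul, Complex.norm_exp_ofReal_mul_I, mul_one, Complex.norm_real, Real.norm_eq_abs,
      abs_of_nonneg hr0]
  set c : ℕ → ℂ := fun m => ddS b ζ m * (starRingEnd ℂ) ζ ^ m * r ^ m with hc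
  have hcn : ∀ m, ‖c m‖ ^ 2 = r ^ (2 * m) * ‖ddS b ζ m‖ ^ 2 := by
    intro m
    simp only [hc, norm_mul, norm_pow, RCLike.norm_conj, hζ, Complex.norm_real, Real.norm_eq_abs,
      abs_of_nonneg hr0]
    ring
  have hcs : Summable fun m => ‖c m‖ := by
    have := (dd_cauchy hg hζ (z := r) (by
      rw [Complex.norm_real, Real.norm_eq_abs, abs_of_nonneg hr0]; exact hr1)).1
    exact this
  set F : ℝ → ℂ := fun θ => g (r * Complex.exp (θ * Complex.I)) /
    (1 - (r * Complex.exp (θ * Complex.I)) * (starRingEnd ℂ) ζ) with hFdef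
  have hF : ∀ θ : ℝ, HasSum (fun m : ℕ => c m * Complex.exp (θ * Complex.I) ^ m) (F θ) := by
    intro θ
    have := (dd_cauchy hg hζ (z := r * Complex.exp (θ * Complex.I)) (by rw [hz]; exact hr1)).2
    convert this using 2
    simp only [hc]; ring
  have hFc : Continuous F := by
    have : F = fun θ : ℝ => ∑' m, c m * Complex.exp (θ * Complex.I) ^ m := by
      funext θ; exact (hF θ).tsum_eq.symm
    rw [this]
    refine continuous_tsum (fun m => by fun_prop) hcs (fun m θ => ?_)
    rw [norm_mul, norm_pow, Complex.norm_exp_ofReal_mul_I, one_pow, mul_one]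
  have hP : ∀ θ : ℝ, ddk (r * Complex.exp (θ * Complex.I)) ζ *
      ‖g (r * Complex.exp (θ * Complex.I))‖ ^ 2 = (1 - r ^ 2) * ‖F θ‖ ^ 2 := by
    intro θ; rw [ddk_eq hζ, hz]
  simp_rw [hP]
  refine ⟨?_, by fun_prop, ?_⟩
  · simp_rw [← hcn]
    refine Summable.of_nonneg_of_le (fun _ => by positivity) (fun m => ?_)
      (hcs.mul_left (∑' m, ‖c m‖))
    rw [sq]
    exact mul_le_mul_of_nonneg_right (hcs.le_tsum m (fun _ _ => norm_nonneg _)) (norm_nonneg _)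
  · rw [intervalIntegral.integral_const_mul, dd_parseval c hcs F hF x y hxy]
    simp_rw [hcn]
    ring

lemma dd_disc {b : ℕ → ℂ} {g : ℂ → ℂ} (hgm : Measurable g)
    (hg : ∀ z : ℂ, ‖z‖ < 1 → HasSum (fun k => b k * z ^ k) (g z)) {ζ : ℂ} (hζ : ‖ζ‖ = 1) (N : ℕ) :
    ∫⁻ z in Metric.ball (0 : ℂ) 1, ENNReal.ofReal (ddk z ζ * ‖g z‖ ^ 2 * (1 - ‖z‖ ^ 2) ^ N) =
      ∑' m, ENNReal.ofReal (Real.pi * ‖ddS b ζ m‖ ^ 2 *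
        ((m.factorial * (N + 1).factorial : ℝ) / (m + N + 2).factorial)) := by
  have hkm : Measurable fun z => ddk z ζ := by unfold ddk; fun_prop
  set G : ℂ → ℝ≥0∞ := fun z => ENNReal.ofReal (ddk z ζ * ‖g z‖ ^ 2 * (1 - ‖z‖ ^ 2) ^ N) with hG
  have hGm : Measurable G := by
    rw [hG]; fun_prop
  rw [← lintegral_indicator Metric.isOpen_ball.measurableSet,
    ← Complex.lintegral_comp_polarCoord_symm]
  have hGi : Measurable ((Metric.ball (0 : ℂ) 1).indicator G) :=
    hGm.indicator Metric.isOpen_ball.measurableSet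
  have hps : Measurable (fun p : ℝ × ℝ => Complex.polarCoord.symm p) := by
    simp only [Complex.polarCoord_symm_apply]
    fun_prop
  have hmeas : Measurable fun p : ℝ × ℝ => ENNReal.ofReal p.1 •
      (Metric.ball (0 : ℂ) 1).indicator G (Complex.polarCoord.symm p) := by
    simp only [smul_eq_mul]
    exact (by fun_prop : Measurable fun p : ℝ × ℝ => ENNReal.ofReal p.1).mul (hGi.comp hps)
  rw [polarCoord_target, Measure.volume_eq_prod, ← Measure.prod_restrict,
    lintegral_prod _ hmeas.aemeasurable]
  have hsym : ∀ r θ : ℝ, Complex.polarCoord.symm (r, θ) = r * Complex.exp (θ * Complex.I) := by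
    intro r θ
    rw [Complex.polarCoord_symm_apply, Complex.exp_mul_I]
    simp
  have hnorm : ∀ r θ : ℝ, 0 < r → ‖(r * Complex.exp (θ * Complex.I) : ℂ)‖ = r := by
    intro r θ hr
    rw [norm_mul, Complex.norm_exp_ofReal_mul_I, mul_one, Complex.norm_real, Real.norm_eq_abs,
      abs_of_pos hr]
  have hinner : ∀ r ∈ Set.Ioi (0:ℝ), ∫⁻ θ in Set.Ioo (-Real.pi) Real.pi, ENNReal.ofReal (r, θ).1 •
      (Metric.ball (0 : ℂ) 1).indicator G (Complex.polarCoord.symm (r, θ)) =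
      (Set.Ioo (0:ℝ) 1).indicator (fun r => ∑' m, ENNReal.ofReal (Real.pi * ‖ddS b ζ m‖ ^ 2 *
        (2 * r ^ (2 * m + 1) * (1 - r ^ 2) ^ (N + 1)))) r := by
    intro r hr
    have hr' : 0 < r := hr
    by_cases h1 : r < 1
    · rw [Set.indicator_of_mem (show r ∈ Set.Ioo (0:ℝ) 1 from ⟨hr, h1⟩)]
      obtain ⟨hsum, hcont, hint⟩ := dd_circle hg hζ hr'.le h1 (-Real.pi) Real.pi (by ring)
      have h1r : 0 < 1 - r ^ 2 := by nlinarith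
      have e1 : ∀ θ : ℝ, ENNReal.ofReal (r, θ).1 •
        (Metric.ball (0 : ℂ) 1).indicator G (Complex.polarCoord.symm (r, θ)) =
        ENNReal.ofReal (r * (1 - r ^ 2) ^ N) *
          ENNReal.ofReal (ddk (r * Complex.exp (θ * Complex.I)) ζ *
            ‖g (r * Complex.exp (θ * Complex.I))‖ ^ 2) := by
        intro θ
        rw [hsym, Set.indicator_of_mem (by simpa using (hnorm r θ hr').trans_lt h1), hG]
        simp only [smul_eq_mul, hnorm r θ hr']
        rw [← ENNReal.ofReal_mul hr'.le, ← ENNReal.ofReal_mul (by positivity)]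
        congr 1; ring
      simp_rw [e1]
      rw [lintegral_const_mul _ (by fun_prop), ← ofReal_integral_eq_lintegral_ofReal,
        ← integral_Ioc_eq_integral_Ioo,
        ← intervalIntegral.integral_of_le (by linarith [Real.pi_pos]), hint,
        ← ENNReal.ofReal_mul (by positivity)]
      · rw [← ENNReal.ofReal_tsum_of_nonneg]
        · congr 1
          rw [← tsum_mul_left, ← tsum_mul_left, ← tsum_mul_left]
          congr 1; funext m; ring
        · intro m; positivity
        · refine (hsum.mul_left (2 * Real.pi * r * (1 - r ^ 2) ^ (N + 1))).congr fun m => ?_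
          ring
      · exact (hcont.integrableOn_Icc (a := -Real.pi) (b := Real.pi)).mono_set Set.Ioo_subset_Icc_self
      · refine Filter.Eventually.of_forall fun θ => ?_
        exact mul_nonneg (ddk_nonneg (by rw [hnorm r θ hr']; exact h1) _) (by positivity)
    · rw [Set.indicator_of_notMem (by simp [h1])]
      have : ∀ θ : ℝ, ENNReal.ofReal (r, θ).1 •
        (Metric.ball (0 : ℂ) 1).indicator G (Complex.polarCoord.symm (r, θ)) = 0 := by
        intro θ
        rw [hsym, Set.indicator_of_notMem, smul_zero]
        rw [mem_ball_zero_iff, hnorm r θ hr']; exact h1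
      simp_rw [this]; simp
  rw [setLIntegral_congr_fun measurableSet_Ioi hinner,
    lintegral_indicator measurableSet_Ioo,
    Measure.restrict_restrict measurableSet_Ioo,
    Set.inter_eq_left.mpr (fun x hx => hx.1), lintegral_tsum (fun m => by fun_prop)]
  congr 1; funext m
  rw [← ofReal_integral_eq_lintegral_ofReal, ← integral_Ioc_eq_integral_Ioo,
    ← intervalIntegral.integral_of_le zero_le_one, intervalIntegral.integral_const_mul, dd_beta]
  · rfl
  · exact (Continuous.integrableOn_Icc (a := 0) (b := 1) (by fun_prop)).mono_set
      Set.Ioo_subset_Icc_self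
  · filter_upwards [ae_restrict_mem measurableSet_Ioo] with r hr
    have h1r : 0 ≤ 1 - r ^ 2 := by nlinarith [hr.1, hr.2]
    have := hr.1
    show 0 ≤ _
    positivity
/-- Tails. -/
noncomputable def ddT (f : ℂ → ℂ) (a : ℕ → ℂ) (ζ : ℂ) (j : ℕ) : ℂ :=
  f ζ - ∑ k ∈ Finset.range (j + 1), a k * ζ ^ k

lemma ddT_succ (f : ℂ → ℂ) (a : ℕ → ℂ) (ζ : ℂ) (j : ℕ) :
    ddT f a ζ (j + 1) = ddT f a ζ j - a (j + 1) * ζ ^ (j + 1) := by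
  unfold ddT; rw [Finset.sum_range_succ _ (j + 1)]; ring

lemma dd_tail {f : ℂ → ℂ} {a : ℕ → ℂ} {R : ℝ} (hR : 1 < R)
    (hf : ∀ z : ℂ, ‖z‖ < R → HasSum (fun k => a k * z ^ k) (f z)) :
    ∃ C ρ : ℝ, 0 ≤ C ∧ 0 < ρ ∧ ρ < 1 ∧ ∀ ζ : ℂ, ‖ζ‖ = 1 → ∀ j, ‖ddT f a ζ j‖ ≤ C * ρ ^ j := by
  obtain ⟨s, hs1, hsR⟩ := exists_between hR
  have hs0 : 0 < s := by linarith
  have hsum : Summable fun k => ‖a k‖ * s ^ k := by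
    have := (hf s (by rw [Complex.norm_real, Real.norm_eq_abs, abs_of_pos hs0]; exact hsR)).summable.norm
    refine this.congr fun k => ?_
    rw [norm_mul, norm_pow, Complex.norm_real, Real.norm_eq_abs, abs_of_pos hs0]
  refine ⟨∑' k, ‖a k‖ * s ^ k, s⁻¹, tsum_nonneg fun k => by positivity, by positivity,
    inv_lt_one_of_one_lt₀ hs1, fun ζ hζ j => ?_⟩
  have h1 := hf ζ (by rw [hζ]; exact hR)
  have h2 : HasSum (fun k => a (k + (j + 1)) * ζ ^ (k + (j + 1))) (ddT f a ζ j) := by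
    rw [hasSum_nat_add_iff (f := fun k => a k * ζ ^ k)]
    simpa [ddT] using h1
  rw [← h2.tsum_eq, ← tsum_mul_right]
  have hle : ∀ k, ‖a (k + (j + 1)) * ζ ^ (k + (j + 1))‖ ≤
      (‖a (k + (j + 1))‖ * s ^ (k + (j + 1))) * s⁻¹ ^ j := by
    intro k
    rw [norm_mul, norm_pow, hζ, one_pow, mul_assoc]
    refine mul_le_mul_of_nonneg_left ?_ (norm_nonneg _)
    have : s ^ (k + (j + 1)) * s⁻¹ ^ j = s ^ (k + 1) := by
      rw [inv_pow, ← add_assoc, add_right_comm, pow_add, mul_assoc, mul_inv_cancel₀ (by positivity), mul_one]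
    rw [this]
    exact one_le_pow₀ hs1.le
  have hs' := (summable_nat_add_iff (j + 1)).mpr hsum
  have hs'' := hs'.mul_right (s⁻¹ ^ j)
  refine (norm_tsum_le_tsum_norm h2.summable.norm).trans ?_
  refine (h2.summable.norm.tsum_le_tsum hle hs'').trans ?_
  rw [tsum_mul_right, tsum_mul_right]
  refine mul_le_mul_of_nonneg_right ?_ (by positivity)
  rw [← hsum.sum_add_tsum_nat_add (j + 1)]
  have : 0 ≤ ∑ k ∈ Finset.range (j + 1), ‖a k‖ * s ^ k := Finset.sum_nonneg fun k _ => by positivity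
  linarith

lemma dd_key {f : ℂ → ℂ} {a : ℕ → ℂ} {R : ℝ} (hR : 1 < R)
    (hf : ∀ z : ℂ, ‖z‖ < R → HasSum (fun k => a k * z ^ k) (f z)) (N : ℕ) {ζ : ℂ} (hζ : ‖ζ‖ = 1)
    (b : ℕ → ℂ) (hb : ∀ k, b k = ((k + N + 1).factorial / k.factorial : ℂ) * a (k + N + 1)) :
    (Summable fun j : ℕ => (j.choose N : ℝ) * ‖ddT f a ζ j‖ ^ 2) ∧
    HasSum (fun m : ℕ => ((N + 1).factorial * N.factorial : ℝ)⁻¹ * (‖ddS b ζ m‖ ^ 2 *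
        ((m.factorial * (N + 1).factorial : ℝ) / (m + N + 2).factorial)))
      (∑' j : ℕ, (j.choose N : ℝ) * ‖ddT f a ζ j‖ ^ 2) := by
  obtain ⟨C, ρ, hC, hρ0, hρ1, hT⟩ := dd_tail hR hf
  set p : ℕ → ℝ := fun i => ((i + N).choose N : ℝ) with hpdef
  set t : ℕ → ℂ := fun i => ddT f a ζ (i + N) with htdef
  set W : ℕ → ℝ := fun m => ((m + N + 1).choose (N + 1) : ℝ) with hWdef
  set V : ℕ → ℂ := fun m => ∑ i ∈ Finset.range (m + 1), p i * t i with hVdef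
  have hp1 : ∀ i, 1 ≤ p i := by
    intro i
    have : 0 < (i + N).choose N := Nat.choose_pos (by omega)
    simp only [hpdef]; exact_mod_cast this
  have hp : ∀ i, 0 < p i := fun i => by linarith [hp1 i]
  have hV : ∀ m, V (m + 1) = V m + p (m + 1) * t (m + 1) := by
    intro m; simp only [hVdef]; rw [Finset.sum_range_succ]
  have hW : ∀ m, W (m + 1) = W m + p (m + 1) := by
    intro m
    simp only [hWdef, hpdef]
    have : m + 1 + N + 1 = (m + N + 1) + 1 := by ring
    rw [this, Nat.choose_succ_succ, show m + 1 + N = m + N + 1 by ring]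
    push_cast; ring
  have hV0 : V 0 = p 0 * t 0 := by simp [hVdef]
  have hW0 : W 0 = p 0 := by simp [hWdef, hpdef]
  have ht : ∀ i, ‖t i‖ ≤ C * ρ ^ i := by
    intro i
    refine (hT ζ hζ (i + N)).trans (mul_le_mul_of_nonneg_left ?_ hC)
    exact pow_le_pow_of_le_one hρ0.le hρ1.le (by omega)
  have hgeo : Summable fun i => p i * ρ ^ i :=
    summable_choose_mul_geometric_of_norm_lt_one N (by rw [Real.norm_eq_abs, abs_of_pos hρ0]; exact hρ1)
  have hs : Summable fun i => p i * ‖t i‖ ^ 2 := by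
    refine Summable.of_nonneg_of_le (fun i => mul_nonneg (hp i).le (by positivity)) (fun i => ?_)
      (hgeo.mul_left (C ^ 2))
    have h1 : ‖t i‖ ^ 2 ≤ (C * ρ ^ i) ^ 2 := pow_le_pow_left₀ (norm_nonneg _) (ht i) 2
    have h2 : (ρ ^ i) ^ 2 ≤ ρ ^ i := by
      rw [sq]; exact mul_le_of_le_one_left (by positivity) (pow_le_one₀ hρ0.le hρ1.le)
    calc p i * ‖t i‖ ^ 2 ≤ p i * (C ^ 2 * ρ ^ i) := by
          refine mul_le_mul_of_nonneg_left (h1.trans ?_) (hp i).le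
          rw [mul_pow]
          exact mul_le_mul_of_nonneg_left h2 (by positivity)
      _ = _ := by ring
  have hWge : ∀ m : ℕ, (m + 1 : ℝ) ≤ W m := by
    intro m
    induction m with
    | zero => rw [hW0]; simpa using hp1 0
    | succ m ih => rw [hW]; push_cast; linarith [hp1 (m + 1)]
  have hVb : ∀ m, ‖V m‖ ≤ C * ∑' i, p i * ρ ^ i := by
    intro m
    simp only [hVdef]
    refine (norm_sum_le _ _).trans ?_
    refine le_trans (Finset.sum_le_sum (g := fun i => C * (p i * ρ ^ i)) fun i _ => ?_) ?_
    · rw [norm_mul, Complex.norm_real, Real.norm_eq_abs, abs_of_pos (hp i)]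
      calc p i * ‖t i‖ ≤ p i * (C * ρ ^ i) := mul_le_mul_of_nonneg_left (ht i) (hp i).le
        _ = _ := by ring
    · rw [← Finset.mul_sum]
      exact mul_le_mul_of_nonneg_left (hgeo.sum_le_tsum _ fun i _ => mul_nonneg (hp i).le (by positivity)) hC
  have hlim : Filter.Tendsto (fun m => ‖V m‖ ^ 2 / W m) Filter.atTop (nhds 0) := by
    have h0 : Filter.Tendsto (fun m : ℕ => (C * ∑' i, p i * ρ ^ i) ^ 2 * (1 / ((m : ℝ) + 1)))
        Filter.atTop (nhds 0) := by
      simpa using tendsto_one_div_add_atTop_nhds_zero_nat.const_mul ((C * ∑' i, p i * ρ ^ i) ^ 2)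
    refine squeeze_zero (fun m => div_nonneg (by positivity) (le_trans (by positivity) (hWge m))) (fun m => ?_) h0
    rw [mul_one_div]
    exact div_le_div₀ (by positivity) (pow_le_pow_left₀ (norm_nonneg _) (hVb m) 2) (by positivity) (hWge m)
  have htele := dd_tele p hp t V W hV0 hW0 hV hW hs hlim
  have hWf : ∀ m : ℕ, W m = ((m + N + 1).factorial : ℝ) / ((N + 1).factorial * m.factorial) := by
    intro m
    simp only [hWdef]
    rw [show m + N + 1 = N + 1 + m by ring, Nat.cast_add_choose]
  have hpf : ∀ m : ℕ, p m = ((m + N).factorial : ℝ) / (N.factorial * m.factorial) := by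
    intro m
    simp only [hpdef]
    rw [show m + N = N + m by ring, Nat.cast_add_choose]
  have hSV : ∀ m, ddS b ζ m * ζ ^ (N + 1) = (N + 1).factorial * (V m - W m * t (m + 1)) := by
    have hstep : ∀ m : ℕ, b m * ζ ^ m * ζ ^ (N + 1) = (N + 1).factorial * (W m * (t m - t (m + 1))) := by
      intro m
      have h1 : t m - t (m + 1) = a (m + N + 1) * ζ ^ (m + N + 1) := by
        simp only [htdef]
        rw [show m + 1 + N = m + N + 1 by ring, ddT_succ]; ring
      rw [h1, hb, hWf]
      have : ((N + 1).factorial : ℂ) ≠ 0 := by exact_mod_cast (N + 1).factorial_ne_zero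
      have : (m.factorial : ℂ) ≠ 0 := by exact_mod_cast m.factorial_ne_zero
      push_cast
      field_simp
      ring
    intro m
    induction m with
    | zero =>
      have := hstep 0
      rw [hV0, ← hW0]
      simp only [ddS, zero_add, Finset.range_one, Finset.sum_singleton] at this ⊢
      rw [this]; ring
    | succ m ih =>
      rw [ddS, Finset.sum_range_succ, add_mul, hstep, ← ddS, ih, hV, hW]
      push_cast; ring
  have hSn : ∀ m, ‖ddS b ζ m‖ = (N + 1).factorial * ‖V m - W m * t (m + 1)‖ := by
    intro m
    have := congrArg norm (hSV m)
    rw [norm_mul, norm_pow, hζ, one_pow, mul_one, norm_mul, Complex.norm_natCast] at this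
    exact this
  have hz : ∑ j ∈ Finset.range N, (j.choose N : ℝ) * ‖ddT f a ζ j‖ ^ 2 = 0 := by
    refine Finset.sum_eq_zero fun j hj => ?_
    rw [Nat.choose_eq_zero_of_lt (by simpa using hj)]; simp
  have hsum : Summable fun j : ℕ => (j.choose N : ℝ) * ‖ddT f a ζ j‖ ^ 2 :=
    (summable_nat_add_iff (f := fun j : ℕ => (j.choose N : ℝ) * ‖ddT f a ζ j‖ ^ 2) N).mp hs
  refine ⟨hsum, ?_⟩
  rw [← hsum.sum_add_tsum_nat_add N, hz, zero_add]
  convert htele using 1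
  funext m
  rw [hSn, hpf, hWf, hWf, show m + 1 + N + 1 = m + N + 1 + 1 by ring,
    show m + 1 + N = m + N + 1 by ring, show m + N + 2 = m + N + 1 + 1 by ring,
    Nat.factorial_succ (m + N + 1), Nat.factorial_succ m, Nat.factorial_succ N]
  have := (m + N + 1).factorial_ne_zero
  have := m.factorial_ne_zero
  have := N.factorial_ne_zero
  push_cast
  field_simp
/-- Taylor coefficients. -/
noncomputable def ddA (f : ℂ → ℂ) (k : ℕ) : ℂ := iteratedDeriv k f 0 / k.factorial

lemma dd_diff {f : ℂ → ℂ} {R : ℝ} (hf : DifferentiableOn ℂ f (Metric.ball (0 : ℂ) R)) (n : ℕ) :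
    DifferentiableOn ℂ (iteratedDeriv n f) (Metric.ball (0 : ℂ) R) := by
  induction n with
  | zero => simpa using hf
  | succ n ih => rw [iteratedDeriv_succ]; exact ih.deriv Metric.isOpen_ball

lemma dd_taylor {f : ℂ → ℂ} {R : ℝ} (hf : DifferentiableOn ℂ f (Metric.ball (0 : ℂ) R))
    (z : ℂ) (hz : ‖z‖ < R) : HasSum (fun k => ddA f k * z ^ k) (f z) := by
  have := Complex.hasSum_taylorSeries_on_ball hf (z := z) (by simpa using hz)
  have e : (fun k => ddA f k * z ^ k) =
      fun n : ℕ => (n.factorial : ℂ)⁻¹ • (z - 0) ^ n • iteratedDeriv n f 0 := by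
    funext k; simp only [ddA, sub_zero, smul_eq_mul]; ring
  rw [e]
  exact this

lemma ddA_iter (f : ℂ → ℂ) (N k : ℕ) : ddA (iteratedDeriv (N + 1) f) k =
    ((k + N + 1).factorial / k.factorial : ℂ) * ddA f (k + N + 1) := by
  have : iteratedDeriv k (iteratedDeriv (N + 1) f) = iteratedDeriv (k + N + 1) f := by
    simp only [iteratedDeriv_eq_iterate]
    rw [← Function.iterate_add_apply, add_assoc]
  rw [ddA, ddA, this]
  have : ((k + N + 1).factorial : ℂ) ≠ 0 := by exact_mod_cast (k + N + 1).factorial_ne_zero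
  field_simp

lemma ddA_mul {f : ℂ → ℂ} {R : ℝ} (hR : 0 < R) (hf : DifferentiableOn ℂ f (Metric.ball (0 : ℂ) R)) :
    ddA (fun z => z * f z) 0 = 0 ∧ ∀ k, ddA (fun z => z * f z) (k + 1) = ddA f k := by
  refine ⟨by simp [ddA], fun k => ?_⟩
  have key : ∀ k, ∀ z ∈ Metric.ball (0 : ℂ) R, iteratedDeriv (k + 1) (fun z => z * f z) z =
      z * iteratedDeriv (k + 1) f z + (k + 1) * iteratedDeriv k f z := by
    have hat : ∀ n, ∀ z ∈ Metric.ball (0 : ℂ) R, DifferentiableAt ℂ (iteratedDeriv n f) z :=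
      fun n z hz => (dd_diff hf n).differentiableAt (Metric.isOpen_ball.mem_nhds hz)
    intro k
    induction k with
    | zero =>
      intro z hz
      have h := (hasDerivAt_id z).mul (hat 0 z hz).hasDerivAt
      simp only [iteratedDeriv_zero, id] at h
      rw [zero_add, iteratedDeriv_one, iteratedDeriv_one]
      refine (HasDerivAt.deriv (f := fun z => z * f z) h).trans ?_
      simp; ring
    | succ k ih =>
      intro z hz
      rw [iteratedDeriv_succ]
      have he : iteratedDeriv (k + 1) (fun z => z * f z) =ᶠ[nhds z]
        fun z => z * iteratedDeriv (k + 1) f z + (k + 1) * iteratedDeriv k f z := by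
        filter_upwards [Metric.isOpen_ball.mem_nhds hz] with w hw using ih w hw
      rw [he.deriv_eq]
      have h1 := (hasDerivAt_id z).mul (hat (k + 1) z hz).hasDerivAt
      have h2 := ((hat k z hz).hasDerivAt).const_mul ((k : ℂ) + 1)
      have h := h1.add h2
      simp only [id] at h
      refine (HasDerivAt.deriv
        (f := fun z => z * iteratedDeriv (k + 1) f z + (k + 1) * iteratedDeriv k f z) h).trans ?_
      rw [← iteratedDeriv_succ, ← iteratedDeriv_succ]
      push_cast; ring
  rw [ddA, key k 0 (by simpa using hR), ddA, Nat.factorial_succ]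
  have : (k.factorial : ℂ) ≠ 0 := by exact_mod_cast k.factorial_ne_zero
  have : (k + 1 : ℂ) ≠ 0 := by exact_mod_cast k.succ_ne_zero
  push_cast
  field_simp
  ring

lemma dd_point {f : ℂ → ℂ} {R : ℝ} (hR : 1 < R)
    (hf : DifferentiableOn ℂ f (Metric.ball (0 : ℂ) R)) (N : ℕ) {ζ : ℂ} (hζ : ‖ζ‖ = 1) :
    (((N + 1).factorial * N.factorial : ℕ) : ℝ≥0∞)⁻¹ * ((ENNReal.ofReal Real.pi)⁻¹ *
    ∫⁻ z in Metric.ball (0 : ℂ) 1, ENNReal.ofReal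
      (ddk z ζ * ‖iteratedDeriv (N + 1) f z‖ ^ 2 * (1 - ‖z‖ ^ 2) ^ N)) =
    ∑' j : ℕ, ENNReal.ofReal ((j.choose N : ℝ) * ‖ddT f (ddA f) ζ j‖ ^ 2) := by
  have hgm : Measurable (iteratedDeriv (N + 1) f) := by
    rw [iteratedDeriv_succ]; exact measurable_deriv _
  rw [dd_disc hgm (fun z hz => dd_taylor (dd_diff hf (N + 1)) z (hz.trans hR)) hζ N]
  obtain ⟨hs, hsum⟩ := dd_key hR (dd_taylor hf) N hζ _ (ddA_iter f N)
  rw [← ENNReal.ofReal_tsum_of_nonneg (fun j => by positivity) hs, ← hsum.tsum_eq,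
    ENNReal.ofReal_tsum_of_nonneg (fun j => by positivity) hsum.summable,
    ← ENNReal.tsum_mul_left, ← ENNReal.tsum_mul_left]
  congr 1; funext m
  rw [← ENNReal.ofReal_inv_of_pos Real.pi_pos, ← ENNReal.ofReal_natCast,
    ← ENNReal.ofReal_inv_of_pos (by positivity), ← ENNReal.ofReal_mul (by positivity),
    ← ENNReal.ofReal_mul (by positivity)]
  congr 1
  have := Real.pi_pos.ne'
  push_cast
  field_simp

lemma ddk_integrable (μ : Measure ℂ) [IsFiniteMeasure μ] (hμ : ∀ᵐ ζ ∂μ, ‖ζ‖ = 1) {z : ℂ}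
    (hz : ‖z‖ < 1) : Integrable (fun ζ => ddk z ζ) μ := by
  refine Integrable.mono' (integrable_const ((1 - ‖z‖ ^ 2) / (1 - ‖z‖) ^ 2)) ?_ ?_
  · exact Measurable.aestronglyMeasurable (by unfold ddk; fun_prop)
  · filter_upwards [hμ] with ζ hζ
    rw [Real.norm_eq_abs, abs_of_nonneg (ddk_nonneg hz ζ), ddk]
    have h1 : 0 ≤ 1 - ‖z‖ ^ 2 := by nlinarith [norm_nonneg z]
    have h2 : 1 - ‖z‖ ≤ ‖z - ζ‖ := by
      rw [norm_sub_rev, ← hζ]; exact norm_sub_norm_le _ _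
    have h3 : 0 < 1 - ‖z‖ := by linarith
    gcongr

lemma dd_formula (μ : Measure ℂ) [IsFiniteMeasure μ] (hμ : ∀ᵐ ζ ∂μ, ‖ζ‖ = 1)
    {f : ℂ → ℂ} {R : ℝ} (hR : 1 < R)
    (hf : DifferentiableOn ℂ f (Metric.ball (0 : ℂ) R)) (N : ℕ) :
    eDirichlet μ (N + 1) f =
      ∫⁻ ζ, ∑' j : ℕ, ENNReal.ofReal ((j.choose N : ℝ) * ‖ddT f (ddA f) ζ j‖ ^ 2) ∂μ := by
  have hgm : Measurable (iteratedDeriv (N + 1) f) := by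
    rw [iteratedDeriv_succ]; exact measurable_deriv _
  have hkm := ddk_measurable
  have h1 : ∀ z ∈ Metric.ball (0 : ℂ) 1, ENNReal.ofReal
      (poisson μ z * ‖iteratedDeriv (N + 1) f z‖ ^ 2 * (1 - ‖z‖ ^ 2) ^ N) =
      ∫⁻ ζ, ENNReal.ofReal (ddk z ζ * ‖iteratedDeriv (N + 1) f z‖ ^ 2 * (1 - ‖z‖ ^ 2) ^ N) ∂μ := by
    intro z hz
    have hz' : ‖z‖ < 1 := by simpa using hz
    have h0 : 0 ≤ 1 - ‖z‖ ^ 2 := by nlinarith [norm_nonneg z]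
    rw [← ofReal_integral_eq_lintegral_ofReal]
    · rw [integral_mul_const, integral_mul_const]; rfl
    · exact ((ddk_integrable μ hμ hz').mul_const _).mul_const _
    · refine Filter.Eventually.of_forall fun ζ => ?_
      have := ddk_nonneg hz' ζ
      show 0 ≤ _
      positivity
  have hM : Measurable (Function.uncurry fun (z ζ : ℂ) => ENNReal.ofReal
      (ddk z ζ * ‖iteratedDeriv (N + 1) f z‖ ^ 2 * (1 - ‖z‖ ^ 2) ^ N)) := by
    have : Measurable fun p : ℂ × ℂ => ddk p.1 p.2 := hkm
    simp only [Function.uncurry_def]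
    fun_prop
  rw [eDirichlet, area, Measure.restrict_smul, lintegral_smul_measure, Nat.add_sub_cancel,
    setLIntegral_congr_fun Metric.isOpen_ball.measurableSet h1,
    lintegral_lintegral_swap hM.aemeasurable, smul_eq_mul]
  rw [← lintegral_const_mul', ← lintegral_const_mul']
  · refine lintegral_congr_ae ?_
    filter_upwards [hμ] with ζ hζ
    exact dd_point hR hf N hζ
  · simp [Nat.factorial_ne_zero]
  · simp [Real.pi_pos]
lemma ddT_mul {f : ℂ → ℂ} {R : ℝ} (hR : 0 < R) (hf : DifferentiableOn ℂ f (Metric.ball (0 : ℂ) R))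
    (ζ : ℂ) : ddT (fun z => z * f z) (ddA fun z => z * f z) ζ 0 = ζ * f ζ ∧
    ∀ j, ddT (fun z => z * f z) (ddA fun z => z * f z) ζ (j + 1) = ζ * ddT f (ddA f) ζ j := by
  obtain ⟨h0, h1⟩ := ddA_mul hR hf
  refine ⟨by simp [ddT, h0], fun j => ?_⟩
  rw [ddT, Finset.sum_range_succ', h0]
  simp_rw [h1]
  rw [ddT, mul_sub, Finset.mul_sum]
  simp only [zero_mul, add_zero]
  congr 1
  exact Finset.sum_congr rfl fun k _ => by ring

lemma dd_shift {f : ℂ → ℂ} {R : ℝ} (hR : 0 < R) (hf : DifferentiableOn ℂ f (Metric.ball (0 : ℂ) R))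
    {ζ : ℂ} (hζ : ‖ζ‖ = 1) (N : ℕ) :
    ∑' j : ℕ, ENNReal.ofReal ((j.choose N : ℝ) *
      ‖ddT (fun z => z * f z) (ddA fun z => z * f z) ζ j‖ ^ 2) =
    ENNReal.ofReal (((0 : ℕ).choose N : ℝ) * ‖f ζ‖ ^ 2) +
      ∑' j : ℕ, ENNReal.ofReal (((j + 1).choose N : ℝ) * ‖ddT f (ddA f) ζ j‖ ^ 2) := by
  obtain ⟨h0, h1⟩ := ddT_mul hR hf ζ
  rw [tsum_eq_zero_add' ENNReal.summable, h0]
  simp_rw [h1]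
  simp only [norm_mul, hζ, one_mul]

lemma dd_circleAvg (μ : Measure ℂ) [IsFiniteMeasure μ] (hμ : ∀ᵐ ζ ∂μ, ‖ζ‖ = 1)
    {f : ℂ → ℂ} {R : ℝ} (hR : 1 < R) (hf : DifferentiableOn ℂ f (Metric.ball (0 : ℂ) R))
    {M : ℝ} (hM : ∀ z ∈ Metric.closedBall (0 : ℂ) 1, ‖f z‖ ≤ M) {r : ℝ} (hr0 : 0 < r) (hr1 : r < 1) :
    ∃ A : ℂ → ℝ, Integrable A μ ∧ circleAvg μ f r = ∫ ζ, A ζ ∂μ ∧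
      ∀ ζ, ‖ζ‖ = 1 → A ζ = (1 - r ^ 2) * ∑' m, r ^ (2 * m) * ‖ddS (ddA f) ζ m‖ ^ 2 := by
  have hz : ∀ θ : ℝ, ‖(r * Complex.exp (θ * Complex.I) : ℂ)‖ = r := by
    intro θ
    rw [norm_mul, Complex.norm_exp_ofReal_mul_I, mul_one, Complex.norm_real, Real.norm_eq_abs,
      abs_of_pos hr0]
  have hfc : Continuous fun θ : ℝ => f (r * Complex.exp (θ * Complex.I)) := by
    refine hf.continuousOn.comp_continuous (by fun_prop) fun θ => ?_
    rw [mem_ball_zero_iff, hz]; linarith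
  have hint : Integrable (Function.uncurry fun (θ : ℝ) (ζ : ℂ) =>
      ddk (r * Complex.exp (θ * Complex.I)) ζ * ‖f (r * Complex.exp (θ * Complex.I))‖ ^ 2)
      ((volume.restrict (Set.Ioc 0 (2 * Real.pi))).prod μ) := by
    refine Integrable.mono' (integrable_const ((1 - r ^ 2) / (1 - r) ^ 2 * M ^ 2)) ?_ ?_
    · refine Measurable.aestronglyMeasurable ?_
      have h1 : Measurable fun p : ℝ × ℂ => ddk (r * Complex.exp (p.1 * Complex.I)) p.2 := by
        unfold ddk; fun_prop
      have h2 : Measurable fun p : ℝ × ℂ => f (r * Complex.exp (p.1 * Complex.I)) :=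
        hfc.measurable.comp measurable_fst
      exact h1.mul (h2.norm.pow_const 2)
    · filter_upwards [Measure.quasiMeasurePreserving_snd.ae hμ] with p hp
      simp only [Function.uncurry]
      have hk := ddk_nonneg (z := r * Complex.exp (p.1 * Complex.I)) (by rw [hz]; exact hr1) p.2
      rw [Real.norm_eq_abs, abs_of_nonneg (by positivity)]
      have h1 : 0 ≤ 1 - r ^ 2 := by nlinarith
      have h3 : 0 < 1 - r := by linarith
      have h2 : 1 - r ≤ ‖r * Complex.exp (p.1 * Complex.I) - p.2‖ := by
        have := norm_sub_norm_le p.2 (r * Complex.exp (p.1 * Complex.I))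
        rw [norm_sub_rev, hp, hz] at this
        exact this
      have h4 : ‖f (r * Complex.exp (p.1 * Complex.I))‖ ≤ M := hM _ (by
        rw [mem_closedBall_zero_iff, hz]; exact hr1.le)
      unfold ddk
      rw [hz]
      gcongr
  refine ⟨fun ζ => (2 * Real.pi)⁻¹ * ∫ θ in Set.Ioc 0 (2 * Real.pi),
    ddk (r * Complex.exp (θ * Complex.I)) ζ * ‖f (r * Complex.exp (θ * Complex.I))‖ ^ 2,
    hint.integral_prod_right.const_mul _, ?_, ?_⟩
  · rw [integral_const_mul, ← integral_integral_swap hint, circleAvg,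
      intervalIntegral.integral_of_le (by positivity)]
    simp_rw [integral_mul_const]
    rfl
  · intro ζ hζ
    have h := (dd_circle (fun z hz => dd_taylor hf z (hz.trans hR)) hζ hr0.le hr1 0 (2 * Real.pi)
      (by ring)).2.2
    rw [intervalIntegral.integral_of_le (by positivity)] at h
    show (2 * Real.pi)⁻¹ * _ = _
    rw [h]
    have := Real.pi_pos.ne'
    field_simp

lemma dd_limit (μ : Measure ℂ) [IsFiniteMeasure μ] (hμ : ∀ᵐ ζ ∂μ, ‖ζ‖ = 1)
    {f : ℂ → ℂ} {R : ℝ} (hR : 1 < R) (hf : DifferentiableOn ℂ f (Metric.ball (0 : ℂ) R))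
    (hi : Integrable (fun ζ => ‖f ζ‖ ^ 2) μ) :
    Filter.Tendsto (circleAvg μ f) (nhdsWithin 1 (Set.Iio 1)) (nhds (∫ ζ, ‖f ζ‖ ^ 2 ∂μ)) := by
  obtain ⟨C, ρ, hC, hρ0, hρ1, hT⟩ := dd_tail hR (dd_taylor hf)
  obtain ⟨M, hM⟩ := (isCompact_closedBall (0 : ℂ) 1).exists_bound_of_continuousOn
    (hf.continuousOn.mono (Metric.closedBall_subset_ball hR))
  have hM0 : 0 ≤ M := (norm_nonneg _).trans (hM 0 (by simp))
  set K : ℝ := C * (2 * M + C) * (1 - ρ)⁻¹ with hK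
  have hbound : ∀ r : ℝ, 0 < r → r < 1 →
      ‖circleAvg μ f r - ∫ ζ, ‖f ζ‖ ^ 2 ∂μ‖ ≤ (1 - r ^ 2) * K * μ.real Set.univ := by
    intro r hr0 hr1
    obtain ⟨A, hA, hAe, hAζ⟩ := dd_circleAvg μ hμ hR hf hM hr0 hr1
    rw [hAe, ← integral_sub hA hi]
    refine norm_integral_le_of_norm_le_const ?_
    filter_upwards [hμ] with ζ hζ
    have h1r : 0 < 1 - r ^ 2 := by nlinarith
    have hr2 : r ^ 2 < 1 := by linarith
    have hsS := (dd_circle (fun z hz => dd_taylor hf z (hz.trans hR)) hζ hr0.le hr1 0 (2 * Real.pi)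
      (by ring)).1
    have hgeo : HasSum (fun m : ℕ => r ^ (2 * m) * ‖f ζ‖ ^ 2) ((1 - r ^ 2)⁻¹ * ‖f ζ‖ ^ 2) := by
      simp_rw [pow_mul]
      exact (hasSum_geometric_of_lt_one (by positivity) hr2).mul_right _
    have he : A ζ - ‖f ζ‖ ^ 2 =
        (1 - r ^ 2) * ∑' m, r ^ (2 * m) * (‖ddS (ddA f) ζ m‖ ^ 2 - ‖f ζ‖ ^ 2) := by
      simp_rw [mul_sub]
      rw [hsS.tsum_sub hgeo.summable, hgeo.tsum_eq, hAζ ζ hζ, mul_sub, ← mul_assoc _ (_⁻¹),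
        mul_inv_cancel₀ h1r.ne', one_mul]
    rw [he, norm_mul, Real.norm_eq_abs, abs_of_pos h1r]
    refine mul_le_mul_of_nonneg_left ?_ h1r.le
    have hgρ : HasSum (fun m : ℕ => C * (2 * M + C) * ρ ^ m) K :=
      (hasSum_geometric_of_lt_one hρ0.le hρ1).mul_left _
    refine tsum_of_norm_bounded hgρ fun m => ?_
    have hfM : ‖f ζ‖ ≤ M := hM ζ (by simp [hζ])
    have hS : ddS (ddA f) ζ m = f ζ - ddT f (ddA f) ζ m := by simp [ddS, ddT]
    have hTm := hT ζ hζ m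
    have hTC : ‖ddT f (ddA f) ζ m‖ ≤ C :=
      hTm.trans (mul_le_of_le_one_right hC (pow_le_one₀ hρ0.le hρ1.le))
    have hSM : ‖ddS (ddA f) ζ m‖ ≤ M + C := by
      rw [hS]; exact (norm_sub_le _ _).trans (add_le_add hfM hTC)
    have hd : |‖ddS (ddA f) ζ m‖ - ‖f ζ‖| ≤ ‖ddT f (ddA f) ζ m‖ := by
      refine (abs_norm_sub_norm_le _ _).trans ?_
      rw [hS]; simp
    rw [norm_mul, Real.norm_eq_abs, Real.norm_eq_abs, abs_of_nonneg (by positivity), sq_sub_sq, abs_mul,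
      abs_of_nonneg (by positivity : 0 ≤ ‖ddS (ddA f) ζ m‖ + ‖f ζ‖)]
    calc r ^ (2 * m) * ((‖ddS (ddA f) ζ m‖ + ‖f ζ‖) * |‖ddS (ddA f) ζ m‖ - ‖f ζ‖|)
        ≤ 1 * ((M + C + M) * (C * ρ ^ m)) := by
          gcongr
          · exact pow_le_one₀ hr0.le hr1.le
          · exact hd.trans hTm
      _ = _ := by ring
  rw [tendsto_iff_norm_sub_tendsto_zero]
  have hlim : Filter.Tendsto (fun r : ℝ => (1 - r ^ 2) * K * μ.real Set.univ)
      (nhdsWithin 1 (Set.Iio 1)) (nhds 0) := by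
    have : Continuous fun r : ℝ => (1 - r ^ 2) * K * μ.real Set.univ := by fun_prop
    have h := this.tendsto 1
    simp only [one_pow, sub_self, zero_mul] at h
    exact h.mono_left nhdsWithin_le_nhds
  refine squeeze_zero' (Filter.Eventually.of_forall fun r => norm_nonneg _) ?_ hlim
  filter_upwards [Ioo_mem_nhdsLT (show (0:ℝ) < 1 by norm_num)] with r hr
  exact hbound r hr.1 hr.2

/-- For `f` holomorphic on a neighbourhood of the closed unit disc and `n ∈ ℤ₊`,
`D_{μ,n+1}(zf) - D_{μ,n+1}(f) = D_{μ,n}(f)`.  For `n ≥ 1` this is the identity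
`D_{μ,n+1}(zf) = D_{μ,n+1}(f) + D_{μ,n}(f)`; for `n = 0` the right-hand side is
`D_{μ,0}(f) = lim_{R→1⁻} ∫_𝕋 P_μ(Rζ)|f(Rζ)|² dσ(ζ)`. -/
theorem eDirichlet_diff_identity (μ : Measure ℂ) [IsFiniteMeasure μ]
    (hμ : μ {z : ℂ | ‖z‖ ≠ 1} = 0) (n : ℕ) (f : ℂ → ℂ) (R : ℝ) (hR : 1 < R)
    (hf : DifferentiableOn ℂ f (Metric.ball (0 : ℂ) R)) :
    (1 ≤ n →
      eDirichlet μ (n + 1) (fun z => z * f z) = eDirichlet μ (n + 1) f + eDirichlet μ n f) ∧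
    (n = 0 →
      eDirichlet μ 1 (fun z => z * f z) ≠ ⊤ ∧ eDirichlet μ 1 f ≠ ⊤ ∧
      Filter.Tendsto (circleAvg μ f) (nhdsWithin 1 (Set.Iio 1))
        (nhds ((eDirichlet μ 1 (fun z => z * f z)).toReal - (eDirichlet μ 1 f).toReal))) := by
  have hμ' : ∀ᵐ ζ ∂μ, ‖ζ‖ = 1 := hμ
  have hR0 : 0 < R := by linarith
  have hzf : DifferentiableOn ℂ (fun z => z * f z) (Metric.ball (0 : ℂ) R) :=
    differentiableOn_id.mul hf
  have hres : μ.restrict (Metric.ball (0 : ℂ) R) = μ := by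
    refine Measure.restrict_eq_self_of_ae_mem ?_
    filter_upwards [hμ'] with ζ hζ
    rw [mem_ball_zero_iff, hζ]; exact hR
  have haem : ∀ g : ℂ → ℂ, ContinuousOn g (Metric.ball (0 : ℂ) R) → AEMeasurable g μ := by
    intro g hg
    have := hg.aemeasurable (μ := μ) Metric.isOpen_ball.measurableSet
    rwa [hres] at this
  have hfm : AEMeasurable f μ := haem f hf.continuousOn
  have hTm : ∀ j, AEMeasurable (fun ζ => ddT f (ddA f) ζ j) μ := by
    intro j
    refine haem _ ?_
    unfold ddT
    exact hf.continuousOn.sub (Continuous.continuousOn (by fun_prop))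
  have hsm : ∀ N : ℕ, AEMeasurable (fun ζ => ∑' j : ℕ, ENNReal.ofReal ((j.choose N : ℝ) *
      ‖ddT f (ddA f) ζ j‖ ^ 2)) μ := by
    intro N
    refine AEMeasurable.tsum fun j => ?_
    exact (((hTm j).norm.pow_const 2).const_mul _).ennreal_ofReal
  refine ⟨fun hn => ?_, fun _ => ?_⟩
  · obtain ⟨N, rfl⟩ : ∃ N, n = N + 1 := ⟨n - 1, by omega⟩
    rw [dd_formula μ hμ' hR hzf (N + 1), dd_formula μ hμ' hR hf (N + 1), dd_formula μ hμ' hR hf N,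
      ← lintegral_add_left' (hsm (N + 1))]
    refine lintegral_congr_ae ?_
    filter_upwards [hμ'] with ζ hζ
    rw [dd_shift hR0 hf hζ, Nat.choose_zero_succ, Nat.cast_zero, zero_mul, ENNReal.ofReal_zero,
      zero_add, ← ENNReal.tsum_add]
    congr 1; funext j
    rw [← ENNReal.ofReal_add (by positivity) (by positivity), Nat.choose_succ_succ]
    congr 1
    push_cast; ring
  · obtain ⟨C, ρ, hC, hρ0, hρ1, hT⟩ := dd_tail hR (dd_taylor hf)
    obtain ⟨M, hM⟩ := (isCompact_closedBall (0 : ℂ) 1).exists_bound_of_continuousOn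
      (hf.continuousOn.mono (Metric.closedBall_subset_ball hR))
    have hi : Integrable (fun ζ => ‖f ζ‖ ^ 2) μ := by
      refine Integrable.mono' (integrable_const (M ^ 2))
        (hfm.norm.pow_const 2).aestronglyMeasurable ?_
      filter_upwards [hμ'] with ζ hζ
      rw [Real.norm_eq_abs, abs_of_nonneg (by positivity)]
      exact pow_le_pow_left₀ (norm_nonneg _) (hM ζ (by simp [hζ])) 2
    have h1 : eDirichlet μ 1 (fun z => z * f z) =
        ENNReal.ofReal (∫ ζ, ‖f ζ‖ ^ 2 ∂μ) + eDirichlet μ 1 f := by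
      rw [ofReal_integral_eq_lintegral_ofReal hi (Filter.Eventually.of_forall fun ζ => by positivity)]
      have e1 := dd_formula μ hμ' hR hzf 0
      have e2 := dd_formula μ hμ' hR hf 0
      rw [zero_add] at e1 e2
      rw [e1, e2, ← lintegral_add_right' _ (hsm 0)]
      refine lintegral_congr_ae ?_
      filter_upwards [hμ'] with ζ hζ
      rw [dd_shift hR0 hf hζ]
      simp
    have h2 : eDirichlet μ 1 f ≠ ⊤ := by
      have e2 := dd_formula μ hμ' hR hf 0
      rw [zero_add] at e2
      rw [e2]
      have hg : Summable fun j : ℕ => C ^ 2 * ρ ^ j :=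
        (summable_geometric_of_lt_one hρ0.le hρ1).mul_left _
      refine ne_top_of_le_ne_top (b := ∫⁻ _, ENNReal.ofReal (∑' j : ℕ, C ^ 2 * ρ ^ j) ∂μ) ?_ ?_
      · rw [lintegral_const]
        exact ENNReal.mul_ne_top ENNReal.ofReal_ne_top (measure_ne_top _ _)
      · refine lintegral_mono_ae ?_
        filter_upwards [hμ'] with ζ hζ
        rw [ENNReal.ofReal_tsum_of_nonneg (fun j => by positivity) hg]
        refine ENNReal.tsum_le_tsum fun j => ENNReal.ofReal_le_ofReal ?_
        rw [Nat.choose_zero_right, Nat.cast_one, one_mul]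
        calc ‖ddT f (ddA f) ζ j‖ ^ 2 ≤ (C * ρ ^ j) ^ 2 :=
              pow_le_pow_left₀ (norm_nonneg _) (hT ζ hζ j) 2
          _ = C ^ 2 * (ρ ^ j * ρ ^ j) := by ring
          _ ≤ C ^ 2 * ρ ^ j := by
              refine mul_le_mul_of_nonneg_left ?_ (by positivity)
              exact mul_le_of_le_one_left (by positivity) (pow_le_one₀ hρ0.le hρ1.le)
    refine ⟨?_, h2, ?_⟩
    · rw [h1]; exact ENNReal.add_ne_top.mpr ⟨ENNReal.ofReal_ne_top, h2⟩
    · rw [h1, ENNReal.toReal_add ENNReal.ofReal_ne_top h2, add_sub_cancel_right,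
        ENNReal.toReal_ofReal (integral_nonneg fun ζ => by positivity)]
      exact dd_limit μ hμ' hR hf hi
end

section
/- Let μ be a finite positive Borel measure on the unit circle and n ≥ 1. For every holomorphic f on the unit disc with D_{μ,n}(f) < ∞ and every 0 < r < 1, the r-dilation f_r(z) = f(rz) satisfies D_{μ,n}(f_r) ≤ D_{μ,n}(f). -/
open MeasureTheory
open scoped ENNReal

lemma quad_max (a : ℕ → ℝ) (ha : Antitone a) (ha0 : ∀ m, 0 ≤ a m) (d : ℕ → ℂ) (N : ℕ) :
    a N * ‖∑ i ∈ Finset.range N, d i‖ ^ 2 ≤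
      ∑ i ∈ Finset.range N, ∑ j ∈ Finset.range N,
        (d i * (starRingEnd ℂ) (d j)).re * a (max i j) := by
  induction N with
  | zero => simp
  | succ N ih =>
    have e1 : ∑ i ∈ Finset.range (N+1), ∑ j ∈ Finset.range (N+1),
        (d i * (starRingEnd ℂ) (d j)).re * a (max i j) =
        ∑ i ∈ Finset.range N, ∑ j ∈ Finset.range N,
        (d i * (starRingEnd ℂ) (d j)).re * a (max i j)
        + a N * (‖∑ i ∈ Finset.range (N+1), d i‖ ^ 2 - ‖∑ i ∈ Finset.range N, d i‖ ^ 2) := by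
      rw [Finset.sum_range_succ]
      simp_rw [Finset.sum_range_succ (n := N)]
      rw [Finset.sum_add_distrib]
      have h1 : ∑ i ∈ Finset.range N, (d i * (starRingEnd ℂ) (d N)).re * a (max i N)
          = ((∑ i ∈ Finset.range N, d i) * (starRingEnd ℂ) (d N)).re * a N := by
        rw [Finset.sum_mul, Complex.re_sum, Finset.sum_mul]
        refine Finset.sum_congr rfl fun i hi => ?_
        rw [max_eq_right (Finset.mem_range.1 hi).le]
      have h2 : ∑ i ∈ Finset.range N, (d N * (starRingEnd ℂ) (d i)).re * a (max N i)
          = ((∑ i ∈ Finset.range N, d i) * (starRingEnd ℂ) (d N)).re * a N := by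
        rw [Finset.sum_mul, Complex.re_sum, Finset.sum_mul]
        refine Finset.sum_congr rfl fun i hi => ?_
        rw [max_eq_left (Finset.mem_range.1 hi).le]
        congr 1
        simp; ring
      rw [h1, h2, max_self, ← Complex.normSq_eq_norm_sq, ← Complex.normSq_eq_norm_sq,
        Complex.normSq_add]
      rw [Complex.mul_conj, Complex.ofReal_re]
      ring
    rw [e1]
    have := ha (Nat.le_succ N)
    have h3 : a (N+1) * ‖∑ i ∈ Finset.range (N+1), d i‖ ^ 2 ≤
      a N * ‖∑ i ∈ Finset.range (N+1), d i‖ ^ 2 := by gcongr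
    linarith

lemma quad_dil (w : ℕ → ℝ) (r : ℝ) (hr0 : 0 < r) (hr1 : r < 1) (hw0 : ∀ m, 0 ≤ w m)
    (hw : Antitone fun m : ℕ => ((m : ℝ) + 1) * w m) (d : ℕ → ℂ) (N : ℕ) :
    ∑ i ∈ Finset.range N, ∑ j ∈ Finset.range N,
        ((r ^ (i+1) * d i) * (starRingEnd ℂ) (r ^ (j+1) * d j)).re * w (max i j) ≤
    ∑ i ∈ Finset.range N, ∑ j ∈ Finset.range N,
        (d i * (starRingEnd ℂ) (d j)).re * w (max i j) := by
  have hlt : ∀ m : ℕ, r ^ (m+1) < 1 := fun m => pow_lt_one₀ hr0.le hr1 (by omega)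
  have hpos : ∀ m : ℕ, 0 < r ^ (m+1) := fun m => by positivity
  have hwa : Antitone w := by
    apply antitone_nat_of_succ_le
    intro m
    have := hw (Nat.le_succ m)
    simp only [Nat.succ_eq_add_one] at this
    push_cast at this
    have h1 := hw0 (m+1)
    have h2 : (0:ℝ) < m + 1 := by positivity
    nlinarith
  have hgeom : ∀ m : ℕ, ((m:ℝ)+1) * (1 - r^(m+2)) ≤ ((m:ℝ)+2) * (1 - r^(m+1)) := by
    intro m
    have hb : ((m:ℝ)+1) * r^(m+1) * (1 - r) ≤ 1 - r^(m+1) := by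
      induction m with
      | zero => simp; nlinarith
      | succ m ih =>
        push_cast
        have h := hpos m
        rw [pow_succ r (m+1)]
        have : 0 < 1 - r := by linarith
        have hm : (0:ℝ) ≤ m := by positivity
        nlinarith [mul_pos h this, mul_nonneg hm (mul_pos (mul_pos h this) this).le,
          mul_pos (mul_pos h this) this]
    rw [pow_succ r (m+1)]
    nlinarith
  have ha : Antitone fun m : ℕ => w m * (1 - r^(m+1)) := by
    apply antitone_nat_of_succ_le
    intro m
    have h0 := hw (Nat.le_succ m)
    simp only [Nat.succ_eq_add_one] at h0
    push_cast at h0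
    have h1 := hgeom m
    have h2 := hlt m
    have h3 : (0:ℝ) < m + 1 := by positivity
    have h4 := hw0 (m+1)
    have e : ((m:ℝ)+1+1) = m + 2 := by ring
    rw [e] at h0
    have h5 : ((m:ℝ)+1) * (w (m+1) * (1 - r^(m+1+1))) ≤ ((m:ℝ)+1) * (w m * (1 - r^(m+1))) := by
      calc _ = w (m+1) * (((m:ℝ)+1) * (1 - r^(m+2))) := by ring
        _ ≤ w (m+1) * (((m:ℝ)+2) * (1 - r^(m+1))) := by gcongr
        _ = (((m:ℝ)+2) * w (m+1)) * (1 - r^(m+1)) := by ring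
        _ ≤ (((m:ℝ)+1) * w m) * (1 - r^(m+1)) := by
          apply mul_le_mul_of_nonneg_right h0; linarith
        _ = _ := by ring
    exact le_of_mul_le_mul_left h5 h3
  have hb : Antitone fun m : ℕ => w m * (r^(m+1) / (1 - r^(m+1))) := by
    apply antitone_nat_of_succ_le
    intro m
    have h1 := hlt m
    have h2 := hpos m
    have h3 : r^(m+1+1) ≤ r^(m+1) := pow_le_pow_of_le_one hr0.le hr1.le (by omega)
    have h4 := hpos (m+1)
    have := hwa (Nat.le_succ m)
    have h5 := hw0 (m)
    apply mul_le_mul this _ _ h5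
    · apply div_le_div₀ h2.le h3 (by linarith) (by linarith)
    · apply div_nonneg h4.le; linarith
  have q1 := quad_max _ ha (fun m => mul_nonneg (hw0 m) (by linarith [hlt m])) d N
  have q2 := quad_max _ hb (fun m => mul_nonneg (hw0 m)
    (div_nonneg (hpos m).le (by linarith [hlt m]))) (fun i => ((1 - r^(i+1) : ℝ) : ℂ) * d i) N
  have p1 : 0 ≤ w N * (1 - r^(N+1)) * ‖∑ i ∈ Finset.range N, d i‖ ^ 2 :=
    mul_nonneg (mul_nonneg (hw0 N) (by linarith [hlt N])) (by positivity)
  have p2 : 0 ≤ w N * (r^(N+1) / (1 - r^(N+1))) *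
      ‖∑ i ∈ Finset.range N, ((1 - r^(i+1) : ℝ) : ℂ) * d i‖ ^ 2 :=
    mul_nonneg (mul_nonneg (hw0 N) (div_nonneg (hpos N).le (by linarith [hlt N]))) (by positivity)
  have key := add_nonneg (p1.trans q1) (p2.trans q2)
  rw [← sub_nonneg]
  refine key.trans_eq ?_
  simp_rw [← Finset.sum_sub_distrib, ← Finset.sum_add_distrib]
  refine Finset.sum_congr rfl fun i _ => Finset.sum_congr rfl fun j _ => ?_
  have e1 : (((1 - r^(i+1) : ℝ) : ℂ) * d i * (starRingEnd ℂ) (((1 - r^(j+1) : ℝ) : ℂ) * d j)).re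
      = (1 - r^(i+1)) * (1 - r^(j+1)) * (d i * (starRingEnd ℂ) (d j)).re := by
    rw [map_mul, Complex.conj_ofReal, ← Complex.re_ofReal_mul]
    push_cast; congr 1; ring
  have e2 : ((r ^ (i+1) * d i) * (starRingEnd ℂ) (r ^ (j+1) * d j)).re
      = (r^(i+1)) * (r^(j+1)) * (d i * (starRingEnd ℂ) (d j)).re := by
    rw [map_mul, map_pow, Complex.conj_ofReal, ← Complex.re_ofReal_mul]
    push_cast; congr 1; ring
  rw [e1, e2]
  rcases le_total i j with h | h
  · rw [max_eq_right h]
    have : 1 - r^(j+1) ≠ 0 := by linarith [hlt j]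
    field_simp; ring
  · rw [max_eq_left h]
    have : 1 - r^(i+1) ≠ 0 := by linarith [hlt i]
    field_simp; ring

lemma wR_anti (k : ℕ) (R : ℝ) (hR0 : 0 < R) (hR1 : R < 1) :
    Antitone fun m : ℕ => ((m : ℝ) + 1) * ∫ ρ in (0:ℝ)..R, ρ * (1 - ρ^2)^k * ρ^(2*m) := by
  apply antitone_nat_of_succ_le
  intro m
  rw [← intervalIntegral.integral_const_mul, ← intervalIntegral.integral_const_mul,
    ← sub_nonneg, ← intervalIntegral.integral_sub
      (Continuous.intervalIntegrable (by fun_prop) _ _)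
      (Continuous.intervalIntegrable (by fun_prop) _ _)]
  have hd : ∀ x ∈ Set.uIcc 0 R, HasDerivAt (fun ρ : ℝ => (ρ^2)^(m+1) * (1-ρ^2)^(k+1) / 2)
      (x * (1-x^2)^k * (x^2)^m * ((m+1) * (1 - x^2) - (k+1) * x^2)) x := by
    intro x _
    have h1 : HasDerivAt (fun ρ : ℝ => ρ^2) (2*x) x := by simpa using hasDerivAt_pow 2 x
    have h2 := ((h1.pow (m+1)).mul (((h1.const_sub 1)).pow (k+1))).div_const 2
    convert! h2 using 1
    push_cast
    simp only [Nat.add_sub_cancel, Pi.pow_apply]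
    ring
  have hi := intervalIntegral.integral_eq_sub_of_hasDerivAt hd
      (Continuous.intervalIntegrable (by fun_prop) _ _)
  have : ∫ x in (0:ℝ)..R, (x * (1-x^2)^k * (x^2)^m * ((m+1) * (1 - x^2) - (k+1) * x^2)) ≤
      ∫ x in (0:ℝ)..R, (((m:ℝ)+1) * (x * (1 - x^2)^k * x^(2*m)) - (((m+1:ℕ):ℝ)+1) * (x * (1 - x^2)^k * x^(2*(m+1)))) := by
    apply intervalIntegral.integral_mono_on hR0.le
      (Continuous.intervalIntegrable (by fun_prop) _ _)
      (Continuous.intervalIntegrable (by fun_prop) _ _)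
    intro x hx
    rw [← sub_nonneg]
    have hx1 : 0 ≤ 1 - x^2 := by nlinarith [hx.1, hx.2]
    have : 0 ≤ (k:ℝ) * (x * (1 - x^2)^k * (x^2)^(m+1)) := by
      have := hx.1
      positivity
    refine this.trans_eq ?_
    push_cast
    ring
  refine le_trans ?_ this
  rw [hi]
  have : 0 ≤ 1 - R^2 := by nlinarith
  simp
  positivity

lemma polar_ball (R : ℝ) (hR0 : 0 < R) (G : ℂ → ℂ) (hG : ContinuousOn G (Metric.closedBall 0 R)) :
    ∫ z in Metric.ball (0:ℂ) R, G z =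
      ∫ ρ in (0:ℝ)..R, (ρ : ℂ) * ∫ θ in (-Real.pi)..Real.pi, G (circleMap 0 ρ θ) := by
  rw [← integral_indicator Metric.isOpen_ball.measurableSet,
    ← Complex.integral_comp_polarCoord_symm]
  have hs : ∀ p : ℝ × ℝ, Complex.polarCoord.symm p = circleMap 0 p.1 p.2 := by
    intro p
    simp [circleMap, Complex.exp_mul_I]
  have hm : MeasurableSet ((Set.Ioo (0:ℝ) R) ×ˢ (Set.Ioo (-Real.pi) Real.pi)) :=
    measurableSet_Ioo.prod measurableSet_Ioo
  have e1 : ∫ p in polarCoord.target,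
      p.1 • (Metric.ball (0:ℂ) R).indicator G (Complex.polarCoord.symm p)
      = ∫ p in (Set.Ioo (0:ℝ) R) ×ˢ (Set.Ioo (-Real.pi) Real.pi),
        (p.1 : ℂ) * G (circleMap 0 p.1 p.2) := by
    rw [← integral_indicator hm, ← integral_indicator polarCoord.open_target.measurableSet]
    congr 1
    ext p
    have hb : circleMap 0 p.1 p.2 ∈ Metric.ball (0:ℂ) R ↔ |p.1| < R := by
      rw [mem_ball_zero_iff, norm_circleMap_zero]
    simp only [Set.indicator_apply, polarCoord_target, Set.mem_prod, Set.mem_Ioi, Set.mem_Ioo, hs]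
    by_cases h1 : 0 < p.1
    · rw [abs_of_pos h1] at hb
      by_cases h2 : p.1 < R <;> simp [h1, h2, hb, Set.indicator_apply]
    · simp [h1]
  rw [e1, Measure.volume_eq_prod, setIntegral_prod]
  · rw [intervalIntegral.integral_of_le hR0.le, integral_Ioc_eq_integral_Ioo]
    refine setIntegral_congr_fun measurableSet_Ioo fun ρ _ => ?_
    simp only
    rw [intervalIntegral.integral_of_le (by linarith [Real.pi_pos]), integral_Ioc_eq_integral_Ioo,
      integral_const_mul]
  · have hc : IsCompact ((Set.Icc (0:ℝ) R) ×ˢ (Set.Icc (-Real.pi) Real.pi)) :=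
      isCompact_Icc.prod isCompact_Icc
    have : ContinuousOn (fun p : ℝ × ℝ => (p.1 : ℂ) * G (circleMap 0 p.1 p.2))
        ((Set.Icc (0:ℝ) R) ×ˢ (Set.Icc (-Real.pi) Real.pi)) := by
      apply ContinuousOn.mul (by fun_prop)
      apply hG.comp
      · simp only [circleMap]; fun_prop
      · intro p hp
        simp [abs_of_nonneg hp.1.1, hp.1.2]
    rw [← Measure.volume_eq_prod]
    exact (this.integrableOn_compact hc).mono_set
      (Set.prod_mono Set.Ioo_subset_Icc_self Set.Ioo_subset_Icc_self)

lemma ang_aux (ζ : ℂ) (hζ : ‖ζ‖ = 1) (ρ : ℝ) (h0 : 0 ≤ ρ) (h1 : ρ < 1) (m : ℕ) :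
    ∫ θ in (-Real.pi)..Real.pi,
      (((1 - ‖circleMap 0 ρ θ‖^2) / ‖circleMap 0 ρ θ - ζ‖^2 : ℝ) : ℂ) * (circleMap 0 1 θ)^m
      = 2 * Real.pi * (ρ * ζ)^m := by
  have hw : (ρ * ζ : ℂ) ∈ Metric.ball (0:ℂ) 1 := by simp [hζ, abs_of_nonneg h0, h1]
  have hd : DiffContOnCl ℂ (fun z : ℂ => z^m) (Metric.ball 0 1) :=
    (Differentiable.diffContOnCl (by fun_prop))
  have h := hd.circleAverage_poissonKernel_smul' hw
  rw [Real.circleAverage_def] at h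
  have hP : Function.Periodic (fun θ : ℝ => (((1 - ‖circleMap 0 ρ θ‖^2) / ‖circleMap 0 ρ θ - ζ‖^2 : ℝ) : ℂ) * (circleMap 0 1 θ)^m) (2 * Real.pi) := by
    intro θ
    simp only [periodic_circleMap 0 ρ θ, periodic_circleMap 0 1 θ]
  have e := hP.intervalIntegral_add_eq (-Real.pi) 0
  rw [show -Real.pi + 2 * Real.pi = Real.pi by ring, zero_add] at e
  rw [e, ← h, Complex.real_smul]
  have hpi : (2 * Real.pi : ℂ) = ((2 * Real.pi : ℝ) : ℂ) := by push_cast; rfl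
  rw [hpi, ← mul_assoc, ← Complex.ofReal_mul, mul_inv_cancel₀ (by positivity), Complex.ofReal_one,
    one_mul]
  refine intervalIntegral.integral_congr fun θ _ => ?_
  simp only [sub_zero, Complex.real_smul]
  have hn : ‖circleMap 0 ρ θ - ζ‖^2 = ‖circleMap 0 1 θ - ρ * ζ‖^2 := by
    have hz : Complex.normSq ζ = 1 := by rw [Complex.normSq_eq_norm_sq, hζ]; norm_num
    have hcz : circleMap 0 ρ θ = ρ * circleMap 0 1 θ := by simp [circleMap]
    have hc1 : Complex.normSq (circleMap 0 1 θ) = 1 := by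
      rw [Complex.normSq_eq_norm_sq, norm_circleMap_zero]; norm_num
    rw [hcz, ← Complex.normSq_eq_norm_sq, ← Complex.normSq_eq_norm_sq]
    rw [Complex.normSq_sub, Complex.normSq_sub]
    simp only [map_mul, hz, hc1, Complex.normSq_ofReal, Complex.conj_ofReal]
    have : ((ρ:ℂ) * circleMap 0 1 θ * (starRingEnd ℂ) ζ).re = (circleMap 0 1 θ * (ρ * (starRingEnd ℂ) ζ)).re := by
      congr 1; ring
    rw [this]; ring
  rw [hn]
  simp [hζ]

lemma ang_le (ζ : ℂ) (hζ : ‖ζ‖ = 1) (ρ : ℝ) (h0 : 0 ≤ ρ) (h1 : ρ < 1) (i j : ℕ) (hij : j ≤ i) :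
    ∫ θ in (-Real.pi)..Real.pi,
      (((1 - ‖circleMap 0 ρ θ‖^2) / ‖circleMap 0 ρ θ - ζ‖^2 : ℝ) : ℂ) *
        ((circleMap 0 ρ θ)^i * (starRingEnd ℂ) ((circleMap 0 ρ θ)^j))
      = 2 * Real.pi * ρ^(2*i) * (ζ^i * (starRingEnd ℂ) (ζ^j)) := by
  obtain ⟨m, rfl⟩ := Nat.exists_eq_add_of_le hij
  have e : ∀ θ : ℝ, (((1 - ‖circleMap 0 ρ θ‖^2) / ‖circleMap 0 ρ θ - ζ‖^2 : ℝ) : ℂ) *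
        ((circleMap 0 ρ θ)^(j+m) * (starRingEnd ℂ) ((circleMap 0 ρ θ)^j))
      = (ρ:ℂ)^(2*j+m) * ((((1 - ‖circleMap 0 ρ θ‖^2) / ‖circleMap 0 ρ θ - ζ‖^2 : ℝ) : ℂ) * (circleMap 0 1 θ)^m) := by
    intro θ
    have h2 : (circleMap 0 ρ θ)^(j+m) * (starRingEnd ℂ) ((circleMap 0 ρ θ)^j) =
      (ρ:ℂ)^(2*j+m) * (circleMap 0 1 θ)^m := by
      have hcz : circleMap 0 ρ θ = ρ * circleMap 0 1 θ := by simp [circleMap]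
      have hc1 : circleMap 0 1 θ * (starRingEnd ℂ) (circleMap 0 1 θ) = 1 := by
        rw [Complex.mul_conj, Complex.normSq_eq_norm_sq, norm_circleMap_zero]; norm_num
      rw [hcz, map_pow, map_mul, Complex.conj_ofReal]
      calc _ = (ρ:ℂ)^(2*j+m) * (circleMap 0 1 θ)^m * (circleMap 0 1 θ * (starRingEnd ℂ) (circleMap 0 1 θ))^j := by ring
        _ = _ := by rw [hc1]; simp
    rw [h2]; ring
  simp_rw [e]
  rw [intervalIntegral.integral_const_mul, ang_aux ζ hζ ρ h0 h1 m]
  have hz1 : ζ * (starRingEnd ℂ) ζ = 1 := by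
    rw [Complex.mul_conj, Complex.normSq_eq_norm_sq, hζ]; norm_num
  rw [map_pow]
  calc _ = 2 * Real.pi * (ρ:ℂ)^(2*(j+m)) * ζ^m * (1:ℂ)^j := by ring
    _ = _ := by rw [← hz1]; ring

lemma ang (ζ : ℂ) (hζ : ‖ζ‖ = 1) (ρ : ℝ) (h0 : 0 ≤ ρ) (h1 : ρ < 1) (i j : ℕ) :
    ∫ θ in (-Real.pi)..Real.pi,
      (((1 - ‖circleMap 0 ρ θ‖^2) / ‖circleMap 0 ρ θ - ζ‖^2 : ℝ) : ℂ) *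
        ((circleMap 0 ρ θ)^i * (starRingEnd ℂ) ((circleMap 0 ρ θ)^j))
      = 2 * Real.pi * ρ^(2*(max i j)) * (ζ^i * (starRingEnd ℂ) (ζ^j)) := by
  rcases le_total j i with h | h
  · rw [max_eq_left h]; exact ang_le ζ hζ ρ h0 h1 i j h
  · rw [max_eq_right h]
    have := congrArg (starRingEnd ℂ) (ang_le ζ hζ ρ h0 h1 j i h)
    rw [intervalIntegral.integral_of_le (by linarith [Real.pi_pos]), ← integral_conj,
      ← intervalIntegral.integral_of_le (by linarith [Real.pi_pos])] at this
    simp only [map_mul, Complex.conj_ofReal, Complex.conj_conj, map_pow] at this ⊢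
    convert! this using 1
    · refine intervalIntegral.integral_congr fun θ _ => ?_
      ring
    · rw [Complex.conj_ofNat]; ring

lemma ker_cont (ζ : ℂ) (hζ : ‖ζ‖ = 1) :
    ContinuousOn (fun z : ℂ => (1 - ‖z‖^2) / ‖z - ζ‖^2) (Metric.ball 0 1) := by
  apply ContinuousOn.div (by fun_prop) (by fun_prop)
  intro z hz h
  have : z - ζ = 0 := by simpa using h
  have : z = ζ := sub_eq_zero.1 this
  rw [this] at hz; simp [hζ] at hz

lemma mono_int (ζ : ℂ) (hζ : ‖ζ‖ = 1) (R : ℝ) (hR0 : 0 < R) (hR1 : R < 1) (k i j : ℕ) :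
    ∫ z in Metric.ball (0:ℂ) R, (((1 - ‖z‖^2) / ‖z - ζ‖^2 * (1 - ‖z‖^2)^k : ℝ) : ℂ) *
      (z^i * (starRingEnd ℂ) (z^j)) =
    (ζ^i * (starRingEnd ℂ) (ζ^j)) *
      ((2 * Real.pi * ∫ ρ in (0:ℝ)..R, ρ * (1 - ρ^2)^k * ρ^(2*(max i j)) : ℝ) : ℂ) := by
  rw [polar_ball R hR0]
  · rw [← intervalIntegral.integral_const_mul, ← intervalIntegral.integral_ofReal,
      ← intervalIntegral.integral_const_mul]
    refine intervalIntegral.integral_congr fun ρ hρ => ?_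
    rw [Set.uIcc_of_le hR0.le] at hρ
    have e : ∀ θ : ℝ, (((1 - ‖circleMap 0 ρ θ‖^2) / ‖circleMap 0 ρ θ - ζ‖^2 * (1 - ‖circleMap 0 ρ θ‖^2)^k : ℝ) : ℂ) *
      ((circleMap 0 ρ θ)^i * (starRingEnd ℂ) ((circleMap 0 ρ θ)^j)) = (((1 - ρ^2)^k : ℝ) : ℂ) *
      ((((1 - ‖circleMap 0 ρ θ‖^2) / ‖circleMap 0 ρ θ - ζ‖^2 : ℝ) : ℂ) *
        ((circleMap 0 ρ θ)^i * (starRingEnd ℂ) ((circleMap 0 ρ θ)^j))) := by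
      intro θ
      have : (1 - ‖circleMap 0 ρ θ‖^2)^k = (1 - ρ^2)^k := by simp
      rw [this]
      rw [Complex.ofReal_mul]; ring
    simp_rw [e]
    rw [intervalIntegral.integral_const_mul, ang ζ hζ ρ hρ.1 (hρ.2.trans_lt hR1)]
    push_cast; ring
  · have := (ker_cont ζ hζ).mono (Metric.closedBall_subset_ball hR1)
    apply ContinuousOn.mul
    · exact Complex.continuous_ofReal.comp_continuousOn (this.mul (by fun_prop))
    · have : Continuous fun z : ℂ => z^i * (starRingEnd ℂ) (z^j) :=
        (continuous_pow i).mul (Complex.continuous_conj.comp (continuous_pow j))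
      exact this.continuousOn

lemma poly_int (ζ : ℂ) (hζ : ‖ζ‖ = 1) (R : ℝ) (hR0 : 0 < R) (hR1 : R < 1) (k N : ℕ) (c : ℕ → ℂ) :
    ∫ z in Metric.ball (0:ℂ) R, ((1 - ‖z‖^2) / ‖z - ζ‖^2 * (1 - ‖z‖^2)^k) *
      ‖∑ i ∈ Finset.range N, c i * z^i‖^2 =
    ∑ i ∈ Finset.range N, ∑ j ∈ Finset.range N,
      ((c i * ζ^i) * (starRingEnd ℂ) (c j * ζ^j)).re *
      (2 * Real.pi * ∫ ρ in (0:ℝ)..R, ρ * (1 - ρ^2)^k * ρ^(2*(max i j))) := by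
  have hint : ∀ i j : ℕ, IntegrableOn (fun z : ℂ => (((1 - ‖z‖^2) / ‖z - ζ‖^2 * (1 - ‖z‖^2)^k : ℝ) : ℂ) *
      (z^i * (starRingEnd ℂ) (z^j))) (Metric.ball 0 R) := by
    intro i j
    have := (ker_cont ζ hζ).mono (Metric.closedBall_subset_ball hR1)
    refine IntegrableOn.mono_set (ContinuousOn.integrableOn_compact (isCompact_closedBall 0 R) ?_)
      Metric.ball_subset_closedBall
    apply ContinuousOn.mul
    · exact Complex.continuous_ofReal.comp_continuousOn (this.mul (by fun_prop))
    · have : Continuous fun z : ℂ => z^i * (starRingEnd ℂ) (z^j) :=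
        (continuous_pow i).mul (Complex.continuous_conj.comp (continuous_pow j))
      exact this.continuousOn
  have e : ∀ z : ℂ, ((((1 - ‖z‖^2) / ‖z - ζ‖^2 * (1 - ‖z‖^2)^k) *
      ‖∑ i ∈ Finset.range N, c i * z^i‖^2 : ℝ) : ℂ) =
      ∑ i ∈ Finset.range N, ∑ j ∈ Finset.range N, (c i * (starRingEnd ℂ) (c j)) *
      ((((1 - ‖z‖^2) / ‖z - ζ‖^2 * (1 - ‖z‖^2)^k : ℝ) : ℂ) *
      (z^i * (starRingEnd ℂ) (z^j))) := by
    intro z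
    rw [← Complex.normSq_eq_norm_sq (∑ i ∈ Finset.range N, c i * z^i), Complex.ofReal_mul, ← Complex.mul_conj, map_sum,
      Finset.sum_mul_sum, Finset.mul_sum]
    refine Finset.sum_congr rfl fun i _ => ?_
    rw [Finset.mul_sum]
    refine Finset.sum_congr rfl fun j _ => ?_
    rw [map_mul]; ring
  have e' : ∫ z in Metric.ball (0:ℂ) R, ((((1 - ‖z‖^2) / ‖z - ζ‖^2 * (1 - ‖z‖^2)^k) *
      ‖∑ i ∈ Finset.range N, c i * z^i‖^2 : ℝ) : ℂ) =
      ∑ i ∈ Finset.range N, ∑ j ∈ Finset.range N,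
      ((c i * ζ^i) * (starRingEnd ℂ) (c j * ζ^j)) *
      ((2 * Real.pi * ∫ ρ in (0:ℝ)..R, ρ * (1 - ρ^2)^k * ρ^(2*(max i j)) : ℝ) : ℂ) := by
    simp_rw [e]
    rw [integral_finsetSum _ fun i _ => integrable_finsetSum _ fun j _ => (hint i j).const_mul _]
    refine Finset.sum_congr rfl fun i _ => ?_
    rw [integral_finsetSum _ fun j _ => (hint i j).const_mul _]
    refine Finset.sum_congr rfl fun j _ => ?_
    rw [integral_const_mul, mono_int ζ hζ R hR0 hR1]
    rw [map_mul]; ring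
  rw [integral_complex_ofReal] at e'
  have e2 := congrArg Complex.re e'
  rw [Complex.ofReal_re] at e2
  refine e2.trans ?_
  · rw [Complex.re_sum]
    refine Finset.sum_congr rfl fun i _ => ?_
    rw [Complex.re_sum]
    refine Finset.sum_congr rfl fun j _ => ?_
    rw [Complex.re_mul_ofReal]

lemma poly_ineq (ζ : ℂ) (hζ : ‖ζ‖ = 1) (R : ℝ) (hR0 : 0 < R) (hR1 : R < 1) (k N : ℕ) (c : ℕ → ℂ)
    (r : ℝ) (hr0 : 0 < r) (hr1 : r < 1) :
    ∫ z in Metric.ball (0:ℂ) R, ((1 - ‖z‖^2) / ‖z - ζ‖^2 * (1 - ‖z‖^2)^k) *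
      ‖r * ∑ i ∈ Finset.range N, c i * (r * z)^i‖^2 ≤
    ∫ z in Metric.ball (0:ℂ) R, ((1 - ‖z‖^2) / ‖z - ζ‖^2 * (1 - ‖z‖^2)^k) *
      ‖∑ i ∈ Finset.range N, c i * z^i‖^2 := by
  have e : ∀ z : ℂ, r * ∑ i ∈ Finset.range N, c i * (r * z)^i =
      ∑ i ∈ Finset.range N, (r^(i+1) * c i) * z^i := by
    intro z
    rw [Finset.mul_sum]
    refine Finset.sum_congr rfl fun j _ => by ring
  simp_rw [e]
  rw [poly_int ζ hζ R hR0 hR1, poly_int ζ hζ R hR0 hR1]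
  have := quad_dil (fun m => 2 * Real.pi * ∫ ρ in (0:ℝ)..R, ρ * (1 - ρ^2)^k * ρ^(2*m)) r hr0 hr1
    (fun m => by
      apply mul_nonneg (by positivity)
      apply intervalIntegral.integral_nonneg hR0.le
      intro x hx
      have hx0 := hx.1
      have : 0 ≤ 1 - x^2 := by nlinarith [hx.1, hx.2]
      positivity) (by
      have h := (wR_anti k R hR0 hR1).const_mul (a := 2 * Real.pi) (by positivity)
      intro a b hab
      have := h hab
      simp only at this ⊢
      linarith) (fun i => c i * ζ^i) N
  simpa only [mul_assoc] using this

lemma lim_int (ζ : ℂ) (hζ : ‖ζ‖ = 1) (R : ℝ) (hR0 : 0 < R) (hR1 : R < 1) (k : ℕ) (h : ℂ → ℂ)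
    (c : ℕ → ℂ) (hc : ∀ z ∈ Metric.ball (0:ℂ) 1, HasSum (fun i => c i * z^i) (h z))
    (s : ℝ) (hs0 : 0 ≤ s) (hs1 : s ≤ 1) :
    Filter.Tendsto (fun N : ℕ => ∫ z in Metric.ball (0:ℂ) R,
      ((1 - ‖z‖^2) / ‖z - ζ‖^2 * (1 - ‖z‖^2)^k) * ‖s * ∑ i ∈ Finset.range N, c i * (s * z)^i‖^2)
      Filter.atTop (nhds (∫ z in Metric.ball (0:ℂ) R,
      ((1 - ‖z‖^2) / ‖z - ζ‖^2 * (1 - ‖z‖^2)^k) * ‖s * h (s * z)‖^2)) := by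
  have hS : Summable fun i => ‖c i‖ * R^i := by
    have := (hc (R:ℂ) (by simp [abs_of_pos hR0, hR1])).summable.norm
    simpa [abs_of_pos hR0] using this
  have hK : ContinuousOn (fun z : ℂ => (1 - ‖z‖^2) / ‖z - ζ‖^2 * (1 - ‖z‖^2)^k)
      (Metric.closedBall 0 R) :=
    ((ker_cont ζ hζ).mono (Metric.closedBall_subset_ball hR1)).mul (by fun_prop)
  have hKi := (hK.integrableOn_compact (μ := volume) (isCompact_closedBall 0 R)).mono_set
      Metric.ball_subset_closedBall
  apply tendsto_integral_of_dominated_convergence (fun z =>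
    ((1 - ‖z‖^2) / ‖z - ζ‖^2 * (1 - ‖z‖^2)^k) * (∑' i, ‖c i‖ * R^i)^2)
  · intro N
    apply hKi.aestronglyMeasurable.mul
    apply Continuous.aestronglyMeasurable
    fun_prop
  · exact hKi.mul_const _
  · intro N
    refine (ae_restrict_iff' Metric.isOpen_ball.measurableSet).2 (Filter.Eventually.of_forall ?_)
    intro z hz
    rw [mem_ball_zero_iff] at hz
    have h1 : 0 ≤ 1 - ‖z‖^2 := by nlinarith [norm_nonneg z]
    have h2 : ‖s * ∑ i ∈ Finset.range N, c i * (s * z)^i‖ ≤ ∑' i, ‖c i‖ * R^i := by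
      calc _ ≤ 1 * ∑ i ∈ Finset.range N, ‖c i * (s * z)^i‖ := by
            rw [norm_mul, Complex.norm_real, Real.norm_of_nonneg hs0]
            exact mul_le_mul hs1 (norm_sum_le _ _) (norm_nonneg _) zero_le_one
        _ ≤ ∑ i ∈ Finset.range N, ‖c i‖ * R^i := by
          rw [one_mul]
          refine Finset.sum_le_sum fun i _ => ?_
          rw [norm_mul, norm_pow, norm_mul, Complex.norm_real, Real.norm_of_nonneg hs0]
          gcongr
          nlinarith [norm_nonneg z]
        _ ≤ _ := hS.sum_le_tsum _ fun i _ => by positivity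
    rw [Real.norm_of_nonneg (by positivity)]
    gcongr
  · refine (ae_restrict_iff' Metric.isOpen_ball.measurableSet).2 (Filter.Eventually.of_forall ?_)
    intro z hz
    rw [mem_ball_zero_iff] at hz
    have hsz : (s * z : ℂ) ∈ Metric.ball (0:ℂ) 1 := by
      rw [mem_ball_zero_iff, norm_mul, Complex.norm_real, Real.norm_of_nonneg hs0]
      nlinarith [norm_nonneg z]
    exact (((hc _ hsz).tendsto_sum_nat.const_mul _).norm.pow 2).const_mul _

lemma hol_ineq (ζ : ℂ) (hζ : ‖ζ‖ = 1) (R : ℝ) (hR0 : 0 < R) (hR1 : R < 1) (k : ℕ) (h : ℂ → ℂ)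
    (hh : DifferentiableOn ℂ h (Metric.ball 0 1)) (r : ℝ) (hr0 : 0 < r) (hr1 : r < 1) :
    ∫ z in Metric.ball (0:ℂ) R, ((1 - ‖z‖^2) / ‖z - ζ‖^2 * (1 - ‖z‖^2)^k) * ‖r * h (r * z)‖^2 ≤
    ∫ z in Metric.ball (0:ℂ) R, ((1 - ‖z‖^2) / ‖z - ζ‖^2 * (1 - ‖z‖^2)^k) * ‖h z‖^2 := by
  have hc : ∀ z ∈ Metric.ball (0:ℂ) 1,
      HasSum (fun i : ℕ => ((i.factorial : ℂ)⁻¹ * iteratedDeriv i h 0) * z^i) (h z) := by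
    intro z hz
    have := Complex.hasSum_taylorSeries_on_ball hh hz
    convert! this using 2
    simp; ring
  have l1 := lim_int ζ hζ R hR0 hR1 k h _ hc r hr0.le hr1.le
  have l2 := lim_int ζ hζ R hR0 hR1 k h _ hc 1 zero_le_one le_rfl
  simp only [Complex.ofReal_one, one_mul] at l2
  exact le_of_tendsto_of_tendsto' l1 l2 fun N => poly_ineq ζ hζ R hR0 hR1 k N _ r hr0 hr1

lemma hol_lineq_R (ζ : ℂ) (hζ : ‖ζ‖ = 1) (R : ℝ) (hR0 : 0 < R) (hR1 : R < 1) (k : ℕ) (h : ℂ → ℂ)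
    (hh : DifferentiableOn ℂ h (Metric.ball 0 1)) (r : ℝ) (hr0 : 0 < r) (hr1 : r < 1) :
    ∫⁻ z in Metric.ball (0:ℂ) R,
      ENNReal.ofReal (((1 - ‖z‖^2) / ‖z - ζ‖^2 * (1 - ‖z‖^2)^k) * ‖r * h (r * z)‖^2) ≤
    ∫⁻ z in Metric.ball (0:ℂ) R,
      ENNReal.ofReal (((1 - ‖z‖^2) / ‖z - ζ‖^2 * (1 - ‖z‖^2)^k) * ‖h z‖^2) := by
  have key : ∀ G : ℂ → ℂ, ContinuousOn G (Metric.ball 0 1) →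
      ∫⁻ z in Metric.ball (0:ℂ) R,
      ENNReal.ofReal (((1 - ‖z‖^2) / ‖z - ζ‖^2 * (1 - ‖z‖^2)^k) * ‖G z‖^2) =
      ENNReal.ofReal (∫ z in Metric.ball (0:ℂ) R, ((1 - ‖z‖^2) / ‖z - ζ‖^2 * (1 - ‖z‖^2)^k) * ‖G z‖^2) := by
    intro G hG
    rw [ofReal_integral_eq_lintegral_ofReal]
    · refine IntegrableOn.mono_set (ContinuousOn.integrableOn_compact (isCompact_closedBall 0 R) ?_)
        Metric.ball_subset_closedBall
      exact (((ker_cont ζ hζ).mul (by fun_prop)).mul (hG.norm.pow 2)).mono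
        (Metric.closedBall_subset_ball hR1)
    · refine (ae_restrict_iff' Metric.isOpen_ball.measurableSet).2 (Filter.Eventually.of_forall ?_)
      intro z hz
      rw [mem_ball_zero_iff] at hz
      have h1 : 0 ≤ 1 - ‖z‖^2 := by nlinarith [norm_nonneg z]
      simp only [Pi.zero_apply]
      positivity
  rw [key h hh.continuousOn, key (fun z => r * h (r * z))]
  · exact ENNReal.ofReal_le_ofReal (hol_ineq ζ hζ R hR0 hR1 k h hh r hr0 hr1)
  · apply ContinuousOn.mul continuousOn_const
    apply hh.continuousOn.comp (by fun_prop)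
    intro z hz
    rw [mem_ball_zero_iff] at hz ⊢
    rw [norm_mul, Complex.norm_real, Real.norm_of_nonneg hr0.le]
    nlinarith [norm_nonneg z]

lemma hol_lineq (ζ : ℂ) (hζ : ‖ζ‖ = 1) (k : ℕ) (h : ℂ → ℂ)
    (hh : DifferentiableOn ℂ h (Metric.ball 0 1)) (r : ℝ) (hr0 : 0 < r) (hr1 : r < 1) :
    ∫⁻ z in Metric.ball (0:ℂ) 1,
      ENNReal.ofReal (((1 - ‖z‖^2) / ‖z - ζ‖^2 * (1 - ‖z‖^2)^k) * ‖r * h (r * z)‖^2) ≤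
    ∫⁻ z in Metric.ball (0:ℂ) 1,
      ENNReal.ofReal (((1 - ‖z‖^2) / ‖z - ζ‖^2 * (1 - ‖z‖^2)^k) * ‖h z‖^2) := by
  obtain ⟨u, humono, hu, hlim⟩ := exists_seq_strictMono_tendsto' (show (0:ℝ) < 1 by norm_num)
  have hU : Metric.ball (0:ℂ) 1 = ⋃ i, Metric.ball (0:ℂ) (u i) := by
    ext z
    simp only [Set.mem_iUnion, mem_ball_zero_iff]
    constructor
    · intro hz
      exact (hlim.eventually (lt_mem_nhds hz)).exists
    · rintro ⟨i, hi⟩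
      exact hi.trans (hu i).2
  have hsub : ∀ i, Metric.ball (0:ℂ) (u i) ⊆ Metric.ball 0 1 := fun i =>
    Metric.ball_subset_ball (hu i).2.le
  have hdir : Directed (· ⊆ ·) (fun i => Metric.ball (0:ℂ) (u i)) :=
    Monotone.directed_le (fun i j hij => Metric.ball_subset_ball (humono.monotone hij))
  conv_lhs => rw [hU]
  rw [setLIntegral_iUnion_of_directed _ hdir]
  refine iSup_le fun i => (hol_lineq_R ζ hζ (u i) (hu i).1 (hu i).2 k h hh r hr0 hr1).trans ?_
  exact lintegral_mono_set (hsub i)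

lemma tonelli (μ : Measure ℂ) [IsFiniteMeasure μ]
    (hμ : μ {z : ℂ | ‖z‖ ≠ 1} = 0) (k : ℕ) (G : ℂ → ℂ) (hG : ContinuousOn G (Metric.ball 0 1)) :
    ∫⁻ z in Metric.ball (0 : ℂ) 1,
      ENNReal.ofReal (poisson μ z * ‖G z‖ ^ 2 * (1 - ‖z‖ ^ 2) ^ k) =
    ∫⁻ ζ, (∫⁻ z in Metric.ball (0 : ℂ) 1,
      ENNReal.ofReal (((1 - ‖z‖^2) / ‖z - ζ‖^2 * (1 - ‖z‖^2)^k) * ‖G z‖^2)) ∂μ := by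
  have hae : ∀ᵐ ζ ∂μ, ‖ζ‖ = 1 := by
    rw [ae_iff]; exact hμ
  rw [← lintegral_lintegral_swap]
  · refine setLIntegral_congr_fun Metric.isOpen_ball.measurableSet fun z hz => ?_
    rw [mem_ball_zero_iff] at hz
    have h1 : 0 ≤ 1 - ‖z‖^2 := by nlinarith [norm_nonneg z]
    have e : poisson μ z * ‖G z‖ ^ 2 * (1 - ‖z‖ ^ 2) ^ k =
        ∫ ζ, ((1 - ‖z‖^2) / ‖z - ζ‖^2 * (1 - ‖z‖^2)^k) * ‖G z‖^2 ∂μ := by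
      rw [integral_mul_const, integral_mul_const, poisson]; ring
    rw [e, ofReal_integral_eq_lintegral_ofReal]
    · apply Integrable.mul_const
      apply Integrable.mul_const
      refine Integrable.of_bound (C := (1 - ‖z‖^2) / (1 - ‖z‖)^2) ?_ ?_
      · apply Measurable.aestronglyMeasurable
        fun_prop
      · filter_upwards [hae] with ζ hζ
        rw [Real.norm_of_nonneg (by positivity)]
        have h3 : 1 - ‖z‖ ≤ ‖z - ζ‖ := by
          rw [norm_sub_rev, ← hζ]; exact norm_sub_norm_le _ _
        have h4 : 0 < 1 - ‖z‖ := by linarith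
        gcongr
    · refine Filter.Eventually.of_forall fun ζ => ?_
      simp only [Pi.zero_apply]
      positivity
  · apply AEMeasurable.ennreal_ofReal
    apply AEMeasurable.mul
    · apply Measurable.aemeasurable
      fun_prop
    · have : AEMeasurable (fun z => ‖G z‖^2) (volume.restrict (Metric.ball (0:ℂ) 1)) :=
        (hG.norm.pow 2).aemeasurable Metric.isOpen_ball.measurableSet
      exact this.comp_fst

lemma iter_dil (f : ℂ → ℂ) (r : ℂ) (n : ℕ) :
    iteratedDeriv n (fun z => f (r * z)) = fun z => r^n * iteratedDeriv n f (r * z) := by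
  induction n with
  | zero => simp
  | succ n ih =>
    rw [iteratedDeriv_succ, ih]
    ext z
    rw [deriv_const_mul_field, deriv_comp_mul_left, iteratedDeriv_succ, smul_eq_mul]
    ring

lemma iter_diff (f : ℂ → ℂ) (hf : DifferentiableOn ℂ f (Metric.ball (0 : ℂ) 1)) (n : ℕ) :
    DifferentiableOn ℂ (iteratedDeriv n f) (Metric.ball (0 : ℂ) 1) := by
  induction n with
  | zero => simpa
  | succ n ih =>
    rw [iteratedDeriv_succ]
    exact ih.deriv Metric.isOpen_ball

theorem eDirichlet_dilation_le (μ : Measure ℂ) [IsFiniteMeasure μ]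
    (hμ : μ {z : ℂ | ‖z‖ ≠ 1} = 0) (n : ℕ) (hn : 1 ≤ n) (f : ℂ → ℂ)
    (hf : DifferentiableOn ℂ f (Metric.ball (0 : ℂ) 1))
    (hfin : eDirichlet μ n f ≠ ⊤) (r : ℝ) (hr0 : 0 < r) (hr1 : r < 1) :
    eDirichlet μ n (fun z => f ((r : ℂ) * z)) ≤ eDirichlet μ n f := by
  have hae : ∀ᵐ ζ ∂μ, ‖ζ‖ = 1 := by
    rw [ae_iff]; exact hμ
  have hh := iter_diff f hf n
  unfold eDirichlet area
  gcongr 1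
  rw [Measure.restrict_smul, lintegral_smul_measure, lintegral_smul_measure]
  rw [smul_eq_mul, smul_eq_mul]
  gcongr 1
  rw [tonelli μ hμ _ _ hh.continuousOn, iter_dil, tonelli μ hμ]
  · apply lintegral_mono_ae
    filter_upwards [hae] with ζ hζ
    refine le_trans ?_ (hol_lineq ζ hζ (n-1) _ hh r hr0 hr1)
    refine setLIntegral_mono' Metric.isOpen_ball.measurableSet fun z hz => ?_
    rw [mem_ball_zero_iff] at hz
    have h1 : 0 ≤ 1 - ‖z‖^2 := by nlinarith [norm_nonneg z]
    apply ENNReal.ofReal_le_ofReal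
    have h2 : ‖(r:ℂ)^n * iteratedDeriv n f (r * z)‖ ≤ ‖(r:ℂ) * iteratedDeriv n f (r * z)‖ := by
      rw [norm_mul, norm_mul, norm_pow, Complex.norm_real, Real.norm_of_nonneg hr0.le]
      gcongr
      exact pow_le_of_le_one hr0.le hr1.le (by omega)
    gcongr
  · apply ContinuousOn.mul continuousOn_const
    apply hh.continuousOn.comp (by fun_prop)
    intro z hz
    rw [mem_ball_zero_iff] at hz ⊢
    rw [norm_mul, Complex.norm_real, Real.norm_of_nonneg hr0.le]
    nlinarith [norm_nonneg z]
end

section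
/- Let μ be a finite positive Borel measure on the unit circle and n ≥ 1. Define the backward shift Lf(z) = (f(z)-f(0))/z for holomorphic f on the disc. Then D_{μ,n}(Lf) ≤ D_{μ,n}(f) for every holomorphic f on the disc. -/
open MeasureTheory
open scoped ENNReal

/-- The backward shift `Lf(z) = (f(z) - f(0))/z` (with the removable singularity at `0`
filled in by `f'(0)`). -/
noncomputable def bshift (f : ℂ → ℂ) : ℂ → ℂ :=
  fun z => if z = 0 then deriv f 0 else (f z - f 0) / z

/-- Polar point. -/
noncomputable def ppt (r θ : ℝ) : ℂ := (r : ℂ) * Complex.exp (θ * Complex.I)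

/-- Circle integral of a function. -/
noncomputable def cint (F : ℂ → ℂ) (r : ℝ) : ℂ := ∫ θ in (-Real.pi)..Real.pi, F (ppt r θ)

theorem norm_ppt (r θ : ℝ) : ‖ppt r θ‖ = |r| := by
  simp [ppt, Complex.norm_exp_ofReal_mul_I]

theorem ppt_mem {r : ℝ} (hr : r ∈ Set.Ioo (-1 : ℝ) 1) (θ : ℝ) :
    ppt r θ ∈ Metric.ball (0 : ℂ) 1 := by
  rw [mem_ball_zero_iff, norm_ppt]
  exact abs_lt.2 hr

theorem continuous_ppt : Continuous (fun p : ℝ × ℝ => ppt p.1 p.2) := by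
  unfold ppt; fun_prop

theorem continuousOn_comp_ppt {F : ℂ → ℂ} (hF : ContinuousOn F (Metric.ball (0 : ℂ) 1)) :
    ContinuousOn (fun p : ℝ × ℝ => F (ppt p.1 p.2)) (Set.Ioo (-1 : ℝ) 1 ×ˢ Set.univ) :=
  hF.comp continuous_ppt.continuousOn (fun p hp => ppt_mem hp.1 p.2)

theorem continuous_comp_ppt {F : ℂ → ℂ} (hF : ContinuousOn F (Metric.ball (0 : ℂ) 1))
    {r : ℝ} (hr : r ∈ Set.Ioo (-1 : ℝ) 1) : Continuous (fun θ => F (ppt r θ)) := by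
  have : ContinuousOn (fun θ : ℝ => F (ppt r θ)) Set.univ :=
    (continuousOn_comp_ppt hF).comp (f := fun θ : ℝ => (r, θ))
      (by fun_prop) (fun θ _ => ⟨hr, trivial⟩)
  exact continuousOn_univ.1 this

theorem continuousOn_cint {F : ℂ → ℂ} (hF : ContinuousOn F (Metric.ball (0 : ℂ) 1)) :
    ContinuousOn (cint F) (Set.Ioo (-1 : ℝ) 1) := by
  rw [continuousOn_iff_continuous_domRestrict]
  have : Continuous (Function.uncurry
      (fun (x : Set.Ioo (-1 : ℝ) 1) (θ : ℝ) => F (ppt x θ))) := by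
    have h := (continuousOn_comp_ppt hF).comp_continuous
      (f := fun q : Set.Ioo (-1 : ℝ) 1 × ℝ => ((q.1 : ℝ), q.2)) (by fun_prop)
      (fun q => ⟨q.1.2, trivial⟩)
    exact h
  exact intervalIntegral.continuous_parametric_intervalIntegral_of_continuous' this _ _

theorem hasDerivAt_ppt_r (r θ : ℝ) :
    HasDerivAt (fun r : ℝ => ppt r θ) (Complex.exp (θ * Complex.I)) r := by
  simpa [ppt] using (Complex.ofRealCLM.hasDerivAt (x := r)).mul_const (Complex.exp (θ * Complex.I))

theorem hasDerivAt_ppt_θ (r θ : ℝ) :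
    HasDerivAt (fun θ : ℝ => ppt r θ) (ppt r θ * Complex.I) θ := by
  have h := hasDerivAt_circleMap 0 r θ
  have e : (fun θ : ℝ => ppt r θ) = circleMap 0 r := by
    funext θ; simp [circleMap, ppt]
  rw [e]; simpa [circleMap, ppt] using h

theorem hasDerivAt_prod_r {F G : ℂ → ℂ} (hF : DifferentiableOn ℂ F (Metric.ball (0 : ℂ) 1))
    (hG : DifferentiableOn ℂ G (Metric.ball (0 : ℂ) 1)) {r : ℝ} (hr : r ∈ Set.Ioo (-1 : ℝ) 1)
    (θ : ℝ) :
    HasDerivAt (fun r : ℝ => F (ppt r θ) * star (G (ppt r θ)))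
      (deriv F (ppt r θ) * Complex.exp (θ * Complex.I) * star (G (ppt r θ)) +
        F (ppt r θ) * star (deriv G (ppt r θ) * Complex.exp (θ * Complex.I))) r := by
  have hz := ppt_mem hr θ
  have h1 := ((hF.differentiableAt (Metric.isOpen_ball.mem_nhds hz)).hasDerivAt).scomp r
    (hasDerivAt_ppt_r r θ)
  have h2 := ((hG.differentiableAt (Metric.isOpen_ball.mem_nhds hz)).hasDerivAt).scomp r
    (hasDerivAt_ppt_r r θ)
  have := h1.mul h2.star
  refine this.congr_deriv ?_
  simp [mul_comm]

theorem hasDerivAt_prod_θ {F G : ℂ → ℂ} (hF : DifferentiableOn ℂ F (Metric.ball (0 : ℂ) 1))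
    (hG : DifferentiableOn ℂ G (Metric.ball (0 : ℂ) 1)) {r : ℝ} (hr : r ∈ Set.Ioo (-1 : ℝ) 1)
    (θ : ℝ) :
    HasDerivAt (fun θ : ℝ => F (ppt r θ) * star (G (ppt r θ)))
      (deriv F (ppt r θ) * (ppt r θ * Complex.I) * star (G (ppt r θ)) +
        F (ppt r θ) * star (deriv G (ppt r θ) * (ppt r θ * Complex.I))) θ := by
  have hz := ppt_mem hr θ
  have h1 := ((hF.differentiableAt (Metric.isOpen_ball.mem_nhds hz)).hasDerivAt).scomp θ
    (hasDerivAt_ppt_θ r θ)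
  have h2 := ((hG.differentiableAt (Metric.isOpen_ball.mem_nhds hz)).hasDerivAt).scomp θ
    (hasDerivAt_ppt_θ r θ)
  have := h1.mul h2.star
  refine this.congr_deriv ?_
  simp [mul_comm]

theorem contOn_deriv {F : ℂ → ℂ} (hF : DifferentiableOn ℂ F (Metric.ball (0 : ℂ) 1)) :
    ContinuousOn (deriv F) (Metric.ball (0 : ℂ) 1) :=
  (hF.deriv Metric.isOpen_ball).continuousOn

theorem cint_parts {F G : ℂ → ℂ} (hF : DifferentiableOn ℂ F (Metric.ball (0 : ℂ) 1))
    (hG : DifferentiableOn ℂ G (Metric.ball (0 : ℂ) 1)) {r : ℝ} (hr : r ∈ Set.Ioo (-1 : ℝ) 1) :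
    cint (fun z => z * deriv F z * star (G z)) r = cint (fun z => F z * star (z * deriv G z)) r := by
  have cF := hF.continuousOn
  have cG := hG.continuousOn
  have cF' := contOn_deriv hF
  have cG' := contOn_deriv hG
  have c1 : Continuous fun θ => (fun z => z * deriv F z * star (G z)) (ppt r θ) :=
    continuous_comp_ppt (F := fun z => z * deriv F z * star (G z)) (by fun_prop) hr
  have c2 : Continuous fun θ => (fun z => F z * star (z * deriv G z)) (ppt r θ) :=
    continuous_comp_ppt (F := fun z => F z * star (z * deriv G z)) (by fun_prop) hr
  have key := intervalIntegral.integral_eq_sub_of_hasDerivAt (a := -Real.pi) (b := Real.pi)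
    (f := fun θ : ℝ => F (ppt r θ) * star (G (ppt r θ)))
    (f' := fun θ => Complex.I * ((fun z => z * deriv F z * star (G z)) (ppt r θ) -
       (fun z => F z * star (z * deriv G z)) (ppt r θ)))
    (fun θ _ => by
      refine (hasDerivAt_prod_θ hF hG hr θ).congr_deriv ?_
      simp
      ring) ((continuous_const.mul (c1.sub c2)).intervalIntegrable _ _)
  have e : ppt r (-Real.pi) = ppt r Real.pi := by
    simp [ppt, Complex.exp_neg, Complex.exp_pi_mul_I]
  rw [e, sub_self, intervalIntegral.integral_const_mul,
    intervalIntegral.integral_sub (c1.intervalIntegrable _ _) (c2.intervalIntegrable _ _)] at key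
  rcases mul_eq_zero.1 key with h | h
  · exact absurd h Complex.I_ne_zero
  · exact sub_eq_zero.1 h

theorem hasDerivAt_cint {F G : ℂ → ℂ} (hF : DifferentiableOn ℂ F (Metric.ball (0 : ℂ) 1))
    (hG : DifferentiableOn ℂ G (Metric.ball (0 : ℂ) 1)) {r : ℝ} (hr : r ∈ Set.Ioo (0 : ℝ) 1) :
    HasDerivAt (cint (fun z => F z * star (G z)))
      (2 / r * cint (fun z => F z * star (z * deriv G z)) r) r := by
  have hr' : r ∈ Set.Ioo (-1 : ℝ) 1 := ⟨by linarith [hr.1], hr.2⟩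
  have cF := hF.continuousOn
  have cG := hG.continuousOn
  have cF' := contOn_deriv hF
  have cG' := contOn_deriv hG
  have c0 : ContinuousOn (fun z => F z * star (G z)) (Metric.ball 0 1) := by fun_prop
  have k1 := continuousOn_comp_ppt cF
  have k2 := continuousOn_comp_ppt cG
  have k3 := continuousOn_comp_ppt cF'
  have k4 := continuousOn_comp_ppt cG'
  have kc : ContinuousOn (fun p : ℝ × ℝ =>
      deriv F (ppt p.1 p.2) * Complex.exp (p.2 * Complex.I) * star (G (ppt p.1 p.2)) +
        F (ppt p.1 p.2) * star (deriv G (ppt p.1 p.2) * Complex.exp (p.2 * Complex.I)))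
      (Set.Ioo (-1 : ℝ) 1 ×ˢ Set.univ) := by
    have k5 : Continuous (fun p : ℝ × ℝ => Complex.exp (p.2 * Complex.I)) := by fun_prop
    exact ((k3.mul k5.continuousOn).mul k2.star).add (k1.mul (k4.mul k5.continuousOn).star)
  obtain ⟨s, hs1, hs2⟩ := exists_between hr.2
  have hsub : Set.Icc (0:ℝ) s ×ˢ Set.Icc (-Real.pi) Real.pi ⊆ Set.Ioo (-1 : ℝ) 1 ×ˢ Set.univ := by
    rintro ⟨a, b⟩ ⟨h1, h2⟩
    exact ⟨⟨by linarith [h1.1], by linarith [h1.2]⟩, trivial⟩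
  obtain ⟨C, hC⟩ := (isCompact_Icc.prod isCompact_Icc).exists_bound_of_continuousOn (kc.mono hsub)
  have := (intervalIntegral.hasDerivAt_integral_of_dominated_loc_of_deriv_le (μ := volume)
    (a := -Real.pi) (b := Real.pi) (x₀ := r) (s := Set.Ioo 0 s) (bound := fun _ => C)
    (F := fun r θ => F (ppt r θ) * star (G (ppt r θ)))
    (F' := fun r θ => deriv F (ppt r θ) * Complex.exp (θ * Complex.I) * star (G (ppt r θ)) +
        F (ppt r θ) * star (deriv G (ppt r θ) * Complex.exp (θ * Complex.I)))
    (Ioo_mem_nhds hr.1 hs1)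
    (by
      filter_upwards [Ioo_mem_nhds hr'.1 hr'.2] with x hx
      exact (continuous_comp_ppt c0 hx).aestronglyMeasurable)
    ((continuous_comp_ppt c0 hr').intervalIntegrable _ _)
    (by
      have : ContinuousOn (fun θ : ℝ => deriv F (ppt r θ) * Complex.exp (θ * Complex.I) * star (G (ppt r θ)) +
        F (ppt r θ) * star (deriv G (ppt r θ) * Complex.exp (θ * Complex.I))) Set.univ :=
        kc.comp (f := fun θ : ℝ => (r, θ)) (by fun_prop) (fun θ _ => ⟨hr', trivial⟩)
      exact (continuousOn_univ.1 this).aestronglyMeasurable)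
    (by
      refine Filter.Eventually.of_forall fun θ hθ x hx => ?_
      rw [Set.uIoc_of_le (by linarith [Real.pi_pos])] at hθ
      exact hC (x, θ) ⟨⟨hx.1.le, hx.2.le⟩, ⟨hθ.1.le, hθ.2⟩⟩)
    intervalIntegrable_const
    (by
      refine Filter.Eventually.of_forall fun θ hθ x hx => ?_
      exact hasDerivAt_prod_r hF hG ⟨by linarith [hx.1], by linarith [hx.2]⟩ θ)).2
  refine this.congr_deriv ?_
  have hr0 : (r : ℂ) ≠ 0 := by exact_mod_cast hr.1.ne'
  have e1 : ∀ θ : ℝ, deriv F (ppt r θ) * Complex.exp (θ * Complex.I) * star (G (ppt r θ)) +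
        F (ppt r θ) * star (deriv G (ppt r θ) * Complex.exp (θ * Complex.I)) =
      (1 / (r : ℂ)) * ((fun z => z * deriv F z * star (G z)) (ppt r θ) +
       (fun z => F z * star (z * deriv G z)) (ppt r θ)) := by
    intro θ
    have : ppt r θ = r * Complex.exp (θ * Complex.I) := rfl
    simp only [star_mul']
    have h2 : star (ppt r θ) = r * star (Complex.exp (θ * Complex.I)) := by
      rw [this, star_mul']; simp
    generalize star (ppt r θ) = A at *
    generalize hB : ppt r θ = B at *
    rw [h2]
    simp only [this]
    rw [← this]
    field_simp
    rw [this]; ring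
  simp_rw [e1]
  rw [intervalIntegral.integral_const_mul, intervalIntegral.integral_add
    ((continuous_comp_ppt (F := fun z => z * deriv F z * star (G z)) (by fun_prop) hr').intervalIntegrable _ _)
    ((continuous_comp_ppt (F := fun z => F z * star (z * deriv G z)) (by fun_prop) hr').intervalIntegrable _ _)]
  have := cint_parts hF hG hr'
  unfold cint at this ⊢
  rw [this]
  ring

theorem integral_ball_polar {F : ℂ → ℂ} (hF : ContinuousOn F (Metric.ball (0 : ℂ) 1)) {R : ℝ}
    (h0 : 0 < R) (h1 : R < 1) :
    ∫ z in Metric.ball (0 : ℂ) R, F z = ∫ r in (0 : ℝ)..R, (r : ℂ) * cint F r := by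
  have hp : ∀ p : ℝ × ℝ, Complex.polarCoord.symm p = ppt p.1 p.2 := by
    intro p
    rw [Complex.polarCoord_symm_apply, ppt, Complex.exp_mul_I]
    simp
  rw [← integral_indicator Metric.isOpen_ball.measurableSet, ← Complex.integral_comp_polarCoord_symm]
  have e : ∀ p : ℝ × ℝ, p ∈ polarCoord.target →
      p.1 • (Metric.ball (0 : ℂ) R).indicator F (Complex.polarCoord.symm p) =
      (Set.Ioo (0 : ℝ) R ×ˢ Set.Ioo (-Real.pi) Real.pi).indicator
        (fun p : ℝ × ℝ => (p.1 : ℂ) * F (ppt p.1 p.2)) p := by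
    rintro ⟨r, θ⟩ ⟨hr, hθ⟩
    simp only [Set.mem_Ioi] at hr
    rw [hp]
    by_cases hrR : r < R
    · rw [Set.indicator_of_mem, Set.indicator_of_mem]
      · simp
      · exact ⟨⟨hr, hrR⟩, hθ⟩
      · rw [mem_ball_zero_iff, norm_ppt, abs_of_pos hr]; exact hrR
    · rw [Set.indicator_of_notMem, Set.indicator_of_notMem]
      · simp
      · exact fun h => hrR h.1.2
      · rw [mem_ball_zero_iff, norm_ppt, abs_of_pos hr]; exact hrR
  have hm : MeasurableSet (Set.Ioo (0 : ℝ) R ×ˢ Set.Ioo (-Real.pi) Real.pi) :=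
    measurableSet_Ioo.prod measurableSet_Ioo
  rw [setIntegral_congr_fun polarCoord.open_target.measurableSet e, setIntegral_indicator hm]
  have e2 : polarCoord.target ∩ Set.Ioo (0 : ℝ) R ×ˢ Set.Ioo (-Real.pi) Real.pi =
      Set.Ioo (0 : ℝ) R ×ˢ Set.Ioo (-Real.pi) Real.pi := by
    apply Set.inter_eq_right.2
    rintro ⟨r, θ⟩ ⟨hr, hθ⟩
    exact ⟨hr.1, hθ⟩
  rw [e2, Measure.volume_eq_prod, setIntegral_prod]
  · rw [intervalIntegral.integral_of_le h0.le, integral_Ioc_eq_integral_Ioo]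
    refine setIntegral_congr_fun measurableSet_Ioo fun r hr => ?_
    simp only [cint]
    rw [intervalIntegral.integral_of_le (by linarith [Real.pi_pos]), integral_Ioc_eq_integral_Ioo,
      integral_const_mul]
  · have hc : ContinuousOn (fun p : ℝ × ℝ => (p.1 : ℂ) * F (ppt p.1 p.2))
        (Set.Icc (0 : ℝ) R ×ˢ Set.Icc (-Real.pi) Real.pi) := by
      have k : Continuous (fun p : ℝ × ℝ => (p.1 : ℂ)) := by fun_prop
      refine k.continuousOn.mul ((continuousOn_comp_ppt hF).mono ?_)
      rintro ⟨a, b⟩ ⟨h2, h3⟩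
      exact ⟨⟨by linarith [h2.1], by linarith [h2.2]⟩, trivial⟩
    exact (hc.integrableOn_compact (isCompact_Icc.prod isCompact_Icc)).mono_set
      (Set.prod_mono Set.Ioo_subset_Icc_self Set.Ioo_subset_Icc_self)

theorem core_ineq {Q h : ℂ → ℂ} (hQ : DifferentiableOn ℂ Q (Metric.ball (0 : ℂ) 1))
    (hh : DifferentiableOn ℂ h (Metric.ball (0 : ℂ) 1))
    (hpos : ∀ z ∈ Metric.ball (0 : ℂ) 1, 0 ≤ (Q z).re) (m : ℕ) {R : ℝ}
    (h0 : 0 < R) (h1 : R < 1) :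
    0 ≤ (∫ z in Metric.ball (0 : ℂ) R,
      Q z * ((z * deriv h z + (m + 1) * h z) * star (z * deriv h z + (m + 1) * h z)
        - R ^ 2 * (deriv h z * star (deriv h z))) * (((R ^ 2 - ‖z‖ ^ 2) ^ m : ℝ) : ℂ)).re := by
  have cQ := hQ.continuousOn
  have ch := hh.continuousOn
  have ch' := contOn_deriv hh
  have dh' := hh.deriv Metric.isOpen_ball
  rw [integral_ball_polar (by fun_prop) h0 h1]
  set a := cint (fun z => Q z * deriv h z * star (deriv h z)) with ha
  set Ψ := cint (fun z => (Q z * (z * deriv h z)) * star (h z)) with hΨ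
  set Φ := cint (fun z => (Q z * h z) * star (h z)) with hΦ
  set X := cint (fun z => (Q z * h z) * star (z * deriv h z)) with hX
  have ca : ContinuousOn a (Set.Ioo (-1 : ℝ) 1) := continuousOn_cint (by fun_prop)
  have cΨ : ContinuousOn Ψ (Set.Ioo (-1 : ℝ) 1) := continuousOn_cint (by fun_prop)
  have cΦ : ContinuousOn Φ (Set.Ioo (-1 : ℝ) 1) := continuousOn_cint (by fun_prop)
  have cX : ContinuousOn X (Set.Ioo (-1 : ℝ) 1) := continuousOn_cint (by fun_prop)
  have hsub : Set.Icc (0 : ℝ) R ⊆ Set.Ioo (-1 : ℝ) 1 := fun x hx =>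
    ⟨by linarith [hx.1], by linarith [hx.2]⟩
  replace ca := ca.mono hsub
  replace cΨ := cΨ.mono hsub
  replace cΦ := cΦ.mono hsub
  replace cX := cX.mono hsub
  -- expansion of the circle integral
  have hD : ∀ r ∈ Set.Icc (0 : ℝ) R, cint (fun z =>
      Q z * ((z * deriv h z + (m + 1) * h z) * star (z * deriv h z + (m + 1) * h z)
        - R ^ 2 * (deriv h z * star (deriv h z))) * (((R ^ 2 - ‖z‖ ^ 2) ^ m : ℝ) : ℂ)) r =
      ((R : ℂ) ^ 2 - r ^ 2) ^ m * ((r ^ 2 - R ^ 2) * a r + (m + 1) * Ψ r + (m + 1) * X r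
        + (m + 1) ^ 2 * Φ r) := by
    intro r hr
    have hr' := hsub hr
    have i1 := (continuous_comp_ppt (F := fun z => Q z * deriv h z * star (deriv h z))
      (by fun_prop) hr').intervalIntegrable (μ := volume) (-Real.pi) Real.pi
    have i2 := (continuous_comp_ppt (F := fun z => (Q z * (z * deriv h z)) * star (h z))
      (by fun_prop) hr').intervalIntegrable (μ := volume) (-Real.pi) Real.pi
    have i3 := (continuous_comp_ppt (F := fun z => (Q z * h z) * star (h z))
      (by fun_prop) hr').intervalIntegrable (μ := volume) (-Real.pi) Real.pi
    have i4 := (continuous_comp_ppt (F := fun z => (Q z * h z) * star (z * deriv h z))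
      (by fun_prop) hr').intervalIntegrable (μ := volume) (-Real.pi) Real.pi
    simp only [ha, hΨ, hΦ, hX, cint]
    rw [← intervalIntegral.integral_const_mul, ← intervalIntegral.integral_const_mul,
      ← intervalIntegral.integral_const_mul, ← intervalIntegral.integral_const_mul,
      ← intervalIntegral.integral_add (i1.const_mul _) (i2.const_mul _),
      ← intervalIntegral.integral_add ((i1.const_mul _).add (i2.const_mul _)) (i4.const_mul _),
      ← intervalIntegral.integral_add (((i1.const_mul _).add (i2.const_mul _)).add
        (i4.const_mul _)) (i3.const_mul _), ← intervalIntegral.integral_const_mul]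
    congr 1
    funext θ
    have hz : ppt r θ * star (ppt r θ) = (r : ℂ) ^ 2 := by
      have := Complex.mul_conj (ppt r θ)
      rw [Complex.star_def, this, Complex.normSq_eq_norm_sq, norm_ppt, sq_abs]
      simp
    rw [norm_ppt, sq_abs]
    simp only [star_add, star_mul', star_one, star_natCast]
    push_cast
    rw [← hz]
    ring
  -- derivatives
  have dΨ : ∀ r ∈ Set.Ioo (0 : ℝ) R, HasDerivAt Ψ (2 * r * a r) r := by
    intro r hr
    have hr1 : r ∈ Set.Ioo (0 : ℝ) 1 := ⟨hr.1, hr.2.trans h1⟩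
    have hr0 : (r : ℂ) ≠ 0 := by exact_mod_cast hr.1.ne'
    refine (hasDerivAt_cint (F := fun z => Q z * (z * deriv h z)) (G := h)
      (hQ.mul (differentiableOn_id.mul dh')) hh hr1).congr_deriv ?_
    have : cint (fun z => (Q z * (z * deriv h z)) * star (z * deriv h z)) r = r ^ 2 * a r := by
      simp only [ha, cint]
      rw [← intervalIntegral.integral_const_mul]
      congr 1
      funext θ
      have hz : ppt r θ * star (ppt r θ) = (r : ℂ) ^ 2 := by
        have := Complex.mul_conj (ppt r θ)
        rw [Complex.star_def, this, Complex.normSq_eq_norm_sq, norm_ppt, sq_abs]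
        simp
      rw [← hz, star_mul']
      ring
    rw [this]
    field_simp
  have dΦ : ∀ r ∈ Set.Ioo (0 : ℝ) R, HasDerivAt Φ (2 / r * X r) r := by
    intro r hr
    have hr1 : r ∈ Set.Ioo (0 : ℝ) 1 := ⟨hr.1, hr.2.trans h1⟩
    exact hasDerivAt_cint (F := fun z => Q z * h z) (G := h) (hQ.mul hh) hh hr1
  have hK := intervalIntegral.integral_eq_sub_of_hasDerivAt_of_le (a := 0) (b := R) h0.le
    (f := fun r : ℝ => -((R : ℂ) ^ 2 - r ^ 2) ^ (m + 1) * Ψ r / 2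
      + (m + 1) / 2 * r ^ 2 * ((R : ℂ) ^ 2 - r ^ 2) ^ m * Φ r)
    (f' := fun r : ℝ => (r : ℂ) * (((R : ℂ) ^ 2 - r ^ 2) ^ m * ((r ^ 2 - R ^ 2) * a r
        + (m + 1) * Ψ r + (m + 1) * X r + (m + 1) ^ 2 * Φ r)) -
        (((m + 1) * m * r * ((R ^ 2 - r ^ 2) ^ m + r ^ 2 * (R ^ 2 - r ^ 2) ^ (m - 1)) : ℝ) : ℂ) * Φ r)
    (by fun_prop)
    (by
      intro r hr
      have hr0 : (r : ℂ) ≠ 0 := by exact_mod_cast hr.1.ne'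
      have d1 : HasDerivAt (fun r : ℝ => (r : ℂ)) 1 r := Complex.ofRealCLM.hasDerivAt
      have d2 : HasDerivAt (fun r : ℝ => (r : ℂ) ^ 2) (2 * r) r := (d1.pow 2).congr_deriv (by simp)
      have d3 : HasDerivAt (fun r : ℝ => ((R : ℂ) ^ 2 - r ^ 2)) (-(2 * r)) r := d2.const_sub _
      refine ((((d3.pow (m + 1)).neg.mul (dΨ r hr)).div_const 2).add
        ((((d2.const_mul (((m : ℂ) + 1) / 2)).mul (d3.pow m))).mul (dΦ r hr))).congr_deriv ?_
      simp only [Pi.pow_apply, Pi.neg_apply, Pi.mul_apply]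
      push_cast
      field_simp
      ring)
    (by
      refine ContinuousOn.intervalIntegrable ?_
      rw [Set.uIcc_of_le h0.le]
      fun_prop)
  have iK : IntervalIntegrable (fun r : ℝ => (r : ℂ) * (((R : ℂ) ^ 2 - r ^ 2) ^ m *
      ((r ^ 2 - R ^ 2) * a r + (m + 1) * Ψ r + (m + 1) * X r + (m + 1) ^ 2 * Φ r))) volume 0 R := by
    refine ContinuousOn.intervalIntegrable ?_
    rw [Set.uIcc_of_le h0.le]
    fun_prop
  have iL : IntervalIntegrable (fun r : ℝ =>
      (((m + 1) * m * r * ((R ^ 2 - r ^ 2) ^ m + r ^ 2 * (R ^ 2 - r ^ 2) ^ (m - 1)) : ℝ) : ℂ) * Φ r)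
      volume 0 R := by
    refine ContinuousOn.intervalIntegrable ?_
    rw [Set.uIcc_of_le h0.le]
    fun_prop
  rw [intervalIntegral.integral_sub iK iL] at hK
  have hcong : ∫ r in (0 : ℝ)..R, (r : ℂ) * cint (fun z =>
      Q z * ((z * deriv h z + (m + 1) * h z) * star (z * deriv h z + (m + 1) * h z)
        - R ^ 2 * (deriv h z * star (deriv h z))) * (((R ^ 2 - ‖z‖ ^ 2) ^ m : ℝ) : ℂ)) r =
      ∫ r in (0 : ℝ)..R, (r : ℂ) * (((R : ℂ) ^ 2 - r ^ 2) ^ m *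
      ((r ^ 2 - R ^ 2) * a r + (m + 1) * Ψ r + (m + 1) * X r + (m + 1) ^ 2 * Φ r)) := by
    refine intervalIntegral.integral_congr fun r hr => ?_
    rw [Set.uIcc_of_le h0.le] at hr
    simp only [hD r hr]
  rw [hcong, sub_eq_iff_eq_add.1 hK]
  have hΦpos : ∀ r ∈ Set.Icc (0 : ℝ) R, 0 ≤ (Φ r).re := by
    intro r hr
    have hr' := hsub hr
    have i3 := (continuous_comp_ppt (F := fun z => (Q z * h z) * star (h z))
      (by fun_prop) hr').intervalIntegrable (μ := volume) (-Real.pi) Real.pi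
    have : (Φ r).re = ∫ θ in (-Real.pi)..Real.pi, (Q (ppt r θ) * h (ppt r θ) * star (h (ppt r θ))).re := by
      simp only [hΦ, cint]
      exact (Complex.reCLM.intervalIntegral_comp_comm i3).symm
    rw [this]
    refine intervalIntegral.integral_nonneg (by linarith [Real.pi_pos]) fun θ _ => ?_
    rw [mul_assoc, Complex.star_def, Complex.mul_conj, Complex.re_mul_ofReal]
    exact mul_nonneg (hpos _ (ppt_mem hr' θ)) (Complex.normSq_nonneg _)
  have hΨ0 : Ψ 0 = 0 := by
    simp [hΨ, cint, ppt]
  have t1 : 0 ≤ (∫ r in (0 : ℝ)..R,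
      (((m + 1) * m * r * ((R ^ 2 - r ^ 2) ^ m + r ^ 2 * (R ^ 2 - r ^ 2) ^ (m - 1)) : ℝ) : ℂ) * Φ r).re := by
    have := (Complex.reCLM.intervalIntegral_comp_comm iL).symm
    simp only [Complex.reCLM_apply] at this
    rw [this]
    refine intervalIntegral.integral_nonneg h0.le fun r hr => ?_
    rw [Complex.re_ofReal_mul]
    refine mul_nonneg ?_ (hΦpos r hr)
    have hw : 0 ≤ R ^ 2 - r ^ 2 := by nlinarith [hr.1, hr.2]
    have := hr.1
    positivity
  rw [Complex.add_re, Complex.sub_re]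
  have t2 : 0 ≤ ((m + 1) / 2 * (R : ℂ) ^ 2 * ((R : ℂ) ^ 2 - (R : ℂ) ^ 2) ^ m * Φ R).re := by
    have : ((m + 1) / 2 * (R : ℂ) ^ 2 * ((R : ℂ) ^ 2 - (R : ℂ) ^ 2) ^ m) =
      (((m + 1) / 2 * R ^ 2 * (0 : ℝ) ^ m : ℝ) : ℂ) := by push_cast; rw [sub_self]
    rw [this, Complex.re_ofReal_mul]
    exact mul_nonneg (by positivity) (hΦpos R ⟨h0.le, le_rfl⟩)
  rw [Complex.add_re]
  have t3 : (-((R : ℂ) ^ 2 - (R : ℂ) ^ 2) ^ (m + 1) * Ψ R / 2).re = 0 := by simp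
  have t4 : (-((R : ℂ) ^ 2 - ((0 : ℝ) : ℂ) ^ 2) ^ (m + 1) * Ψ 0 / 2
      + (m + 1) / 2 * ((0 : ℝ) : ℂ) ^ 2 * ((R : ℂ) ^ 2 - ((0 : ℝ) : ℂ) ^ 2) ^ m * Φ 0).re = 0 := by
    rw [hΨ0]; simp
  rw [t3, t4]
  linarith

theorem lint_ball_R {Q h : ℂ → ℂ} (hQ : DifferentiableOn ℂ Q (Metric.ball (0 : ℂ) 1))
    (hh : DifferentiableOn ℂ h (Metric.ball (0 : ℂ) 1))
    (hpos : ∀ z ∈ Metric.ball (0 : ℂ) 1, 0 ≤ (Q z).re) (m : ℕ) {R : ℝ}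
    (h0 : 0 < R) (h1 : R < 1) :
    ∫⁻ z in Metric.ball (0 : ℂ) R,
      ENNReal.ofReal ((Q z).re * (R ^ 2 * ‖deriv h z‖ ^ 2) * (R ^ 2 - ‖z‖ ^ 2) ^ m) ≤
    ∫⁻ z in Metric.ball (0 : ℂ) R,
      ENNReal.ofReal ((Q z).re * ‖z * deriv h z + (m + 1) * h z‖ ^ 2 * (R ^ 2 - ‖z‖ ^ 2) ^ m) := by
  have cQ := hQ.continuousOn
  have ch := hh.continuousOn
  have ch' := contOn_deriv hh
  have key := core_ineq hQ hh hpos m h0 h1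
  have hsub : Metric.closedBall (0 : ℂ) R ⊆ Metric.ball 0 1 := Metric.closedBall_subset_ball h1
  have hsub' : Metric.ball (0 : ℂ) R ⊆ Metric.ball 0 1 := Metric.ball_subset_ball h1.le
  have hint : ∀ {E : Type} [NormedAddCommGroup E] (F : ℂ → E), ContinuousOn F (Metric.ball 0 1) →
      IntegrableOn F (Metric.ball (0 : ℂ) R) volume := fun F hF =>
    ((hF.mono hsub).integrableOn_compact (isCompact_closedBall 0 R)).mono_set
      Metric.ball_subset_closedBall
  have cre : ContinuousOn (fun z => (Q z).re) (Metric.ball (0 : ℂ) 1) :=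
    Complex.continuous_re.comp_continuousOn cQ
  have i1 := hint (fun z => (Q z).re * (R ^ 2 * ‖deriv h z‖ ^ 2) * (R ^ 2 - ‖z‖ ^ 2) ^ m)
    (by fun_prop)
  have i2 := hint (fun z => (Q z).re * ‖z * deriv h z + (m + 1) * h z‖ ^ 2 *
    (R ^ 2 - ‖z‖ ^ 2) ^ m) (by fun_prop)
  have i3 := hint (fun z => Q z * ((z * deriv h z + (m + 1) * h z) *
      star (z * deriv h z + (m + 1) * h z)
        - R ^ 2 * (deriv h z * star (deriv h z))) * (((R ^ 2 - ‖z‖ ^ 2) ^ m : ℝ) : ℂ))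
    (by fun_prop)
  have hw : ∀ z ∈ Metric.ball (0 : ℂ) R, 0 ≤ R ^ 2 - ‖z‖ ^ 2 := by
    intro z hz
    rw [mem_ball_zero_iff] at hz
    nlinarith [norm_nonneg z]
  rw [← ofReal_integral_eq_lintegral_ofReal i1, ← ofReal_integral_eq_lintegral_ofReal i2]
  · apply ENNReal.ofReal_le_ofReal
    rw [← sub_nonneg, ← integral_sub i2 i1]
    have e := (Complex.reCLM.integral_comp_comm i3)
    simp only [Complex.reCLM_apply] at e
    rw [← e] at key
    refine key.trans (le_of_eq ?_)
    refine integral_congr_ae (Filter.Eventually.of_forall fun z => ?_)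
    simp only [Complex.star_def, Complex.mul_conj, Complex.normSq_eq_norm_sq]
    have : ∀ (A B C D : ℝ) , (Q z * ((A : ℂ) - (B : ℂ) ^ 2 * (C : ℂ)) * (D : ℂ)).re =
        (Q z).re * A * D - (Q z).re * (B ^ 2 * C) * D := by
      intro A B C D
      have : Q z * ((A : ℂ) - (B : ℂ) ^ 2 * (C : ℂ)) * (D : ℂ) =
        Q z * (((A - B ^ 2 * C) * D : ℝ) : ℂ) := by push_cast; ring
      rw [this, Complex.re_mul_ofReal]; ring
    rw [this]
  · refine (ae_restrict_iff' measurableSet_ball).2 (Filter.Eventually.of_forall fun z hz => ?_)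
    exact mul_nonneg (mul_nonneg (hpos z (hsub' hz)) (by positivity)) (pow_nonneg (hw z hz) _)
  · refine (ae_restrict_iff' measurableSet_ball).2 (Filter.Eventually.of_forall fun z hz => ?_)
    exact mul_nonneg (mul_nonneg (hpos z (hsub' hz)) (by positivity)) (pow_nonneg (hw z hz) _)

theorem lint_ball_one {Q h : ℂ → ℂ} (hQ : DifferentiableOn ℂ Q (Metric.ball (0 : ℂ) 1))
    (hh : DifferentiableOn ℂ h (Metric.ball (0 : ℂ) 1))
    (hpos : ∀ z ∈ Metric.ball (0 : ℂ) 1, 0 ≤ (Q z).re) (m : ℕ) :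
    ∫⁻ z in Metric.ball (0 : ℂ) 1,
      ENNReal.ofReal ((Q z).re * ‖deriv h z‖ ^ 2 * (1 - ‖z‖ ^ 2) ^ m) ≤
    ∫⁻ z in Metric.ball (0 : ℂ) 1,
      ENNReal.ofReal ((Q z).re * ‖z * deriv h z + (m + 1) * h z‖ ^ 2 * (1 - ‖z‖ ^ 2) ^ m) := by
  have cQ := hQ.continuousOn
  have ch' := contOn_deriv hh
  have cre : ContinuousOn (fun z => (Q z).re) (Metric.ball (0 : ℂ) 1) :=
    Complex.continuous_re.comp_continuousOn cQ
  set ρ : ℕ → ℝ := fun k => 1 - 1 / ((k : ℝ) + 2) with hρ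
  have hρ0 : ∀ k, 0 < ρ k := by
    intro k
    have : (0 : ℝ) < (k : ℝ) + 2 := by positivity
    have : 1 / ((k : ℝ) + 2) < 1 := by rw [div_lt_one this]; linarith [(Nat.cast_nonneg k : (0:ℝ) ≤ k)]
    simp only [hρ]; linarith
  have hρ1 : ∀ k, ρ k < 1 := by
    intro k
    have : (0 : ℝ) < 1 / ((k : ℝ) + 2) := by positivity
    simp only [hρ]; linarith
  have hρl : Filter.Tendsto ρ Filter.atTop (nhds 1) := by
    have h := (tendsto_one_div_add_atTop_nhds_zero_nat (𝕜 := ℝ)).comp (Filter.tendsto_add_atTop_nat 1)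
    have h2 := h.const_sub 1
    simp only [sub_zero] at h2
    refine h2.congr fun k => ?_
    simp only [hρ, Function.comp]
    push_cast
    ring
  set Fk : ℕ → ℂ → ℝ≥0∞ := fun k => (Metric.ball (0 : ℂ) (ρ k)).indicator fun z =>
    ENNReal.ofReal ((Q z).re * (ρ k ^ 2 * ‖deriv h z‖ ^ 2) * (ρ k ^ 2 - ‖z‖ ^ 2) ^ m) with hFk
  have hlim : ∀ z ∈ Metric.ball (0 : ℂ) 1, Filter.Tendsto (fun k => Fk k z) Filter.atTop
      (nhds (ENNReal.ofReal ((Q z).re * ‖deriv h z‖ ^ 2 * (1 - ‖z‖ ^ 2) ^ m))) := by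
    intro z hz
    rw [mem_ball_zero_iff] at hz
    have : Filter.Tendsto (fun k => ENNReal.ofReal ((Q z).re * (ρ k ^ 2 * ‖deriv h z‖ ^ 2) *
        (ρ k ^ 2 - ‖z‖ ^ 2) ^ m)) Filter.atTop
      (nhds (ENNReal.ofReal ((Q z).re * (1 ^ 2 * ‖deriv h z‖ ^ 2) * (1 ^ 2 - ‖z‖ ^ 2) ^ m))) := by
      refine ENNReal.tendsto_ofReal ?_
      exact (((hρl.pow 2).mul_const _).const_mul _).mul (((hρl.pow 2).sub_const _).pow m)
    simp only [one_pow, one_mul] at this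
    refine this.congr' ?_
    filter_upwards [hρl.eventually (lt_mem_nhds hz)] with k hk
    simp only [hFk]
    rw [Set.indicator_of_mem]
    rwa [mem_ball_zero_iff]
  have hmeas : ∀ k, AEMeasurable (Fk k) (volume.restrict (Metric.ball (0 : ℂ) 1)) := by
    intro k
    refine AEMeasurable.indicator ?_ measurableSet_ball
    refine AEMeasurable.ennreal_ofReal ?_
    have : ContinuousOn (fun z => (Q z).re * (ρ k ^ 2 * ‖deriv h z‖ ^ 2) * (ρ k ^ 2 - ‖z‖ ^ 2) ^ m)
      (Metric.ball (0 : ℂ) 1) := by fun_prop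
    exact this.aemeasurable measurableSet_ball
  calc _ = ∫⁻ z in Metric.ball (0 : ℂ) 1, Filter.liminf (fun k => Fk k z) Filter.atTop :=
        setLIntegral_congr_fun measurableSet_ball fun z hz => ((hlim z hz).liminf_eq).symm
    _ ≤ Filter.liminf (fun k => ∫⁻ z in Metric.ball (0 : ℂ) 1, Fk k z) Filter.atTop :=
        lintegral_liminf_le' hmeas
    _ ≤ _ := by
        refine Filter.liminf_le_of_le (by isBoundedDefault) fun b hb => ?_
        obtain ⟨k, hk⟩ := hb.exists
        refine hk.trans ?_
        have hs : Metric.ball (0 : ℂ) (ρ k) ⊆ Metric.ball 0 1 := Metric.ball_subset_ball (hρ1 k).le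
        simp only [hFk]
        rw [setLIntegral_indicator measurableSet_ball, Set.inter_eq_left.2 hs]
        refine (lint_ball_R hQ hh hpos m (hρ0 k) (hρ1 k)).trans ?_
        refine le_trans ?_ (lintegral_mono_set hs)
        refine setLIntegral_mono' measurableSet_ball fun z hz => ?_
        apply ENNReal.ofReal_le_ofReal
        have hq := hpos z (hs hz)
        rw [mem_ball_zero_iff] at hz
        have h2 : 0 ≤ ρ k ^ 2 - ‖z‖ ^ 2 := by nlinarith [norm_nonneg z]
        have h3 : ρ k ^ 2 ≤ 1 := by nlinarith [hρ0 k, hρ1 k]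
        gcongr

theorem kernel_re {ζ z : ℂ} (hζ : ‖ζ‖ = 1) :
    ((ζ + z) / (ζ - z)).re = (1 - ‖z‖ ^ 2) / ‖z - ζ‖ ^ 2 := by
  rw [Complex.div_re, ← add_div]
  have h : Complex.normSq (ζ - z) = ‖z - ζ‖ ^ 2 := by
    rw [Complex.normSq_eq_norm_sq, norm_sub_rev]
  rw [h]
  congr 1
  have h1 : ζ.re * ζ.re + ζ.im * ζ.im = 1 := by
    rw [← Complex.normSq_apply, Complex.normSq_eq_norm_sq, hζ, one_pow]
  have h2 : ‖z‖ ^ 2 = z.re * z.re + z.im * z.im := by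
    rw [← Complex.normSq_apply, Complex.normSq_eq_norm_sq]
  rw [h2]
  simp
  linarith

theorem lint_kernel {h : ℂ → ℂ} (hh : DifferentiableOn ℂ h (Metric.ball (0 : ℂ) 1)) (m : ℕ)
    {ζ : ℂ} (hζ : ‖ζ‖ = 1) :
    ∫⁻ z in Metric.ball (0 : ℂ) 1,
      ENNReal.ofReal ((1 - ‖z‖ ^ 2) / ‖z - ζ‖ ^ 2 * ‖deriv h z‖ ^ 2 * (1 - ‖z‖ ^ 2) ^ m) ≤
    ∫⁻ z in Metric.ball (0 : ℂ) 1,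
      ENNReal.ofReal ((1 - ‖z‖ ^ 2) / ‖z - ζ‖ ^ 2 *
        ‖z * deriv h z + (m + 1) * h z‖ ^ 2 * (1 - ‖z‖ ^ 2) ^ m) := by
  have := lint_ball_one (Q := fun z => (ζ + z) / (ζ - z)) (h := h) (by
    refine DifferentiableOn.div (by fun_prop) (by fun_prop) fun z hz => ?_
    rw [mem_ball_zero_iff] at hz
    intro h
    rw [sub_eq_zero.1 h] at hζ
    linarith) hh (fun z hz => by
      rw [kernel_re hζ]
      rw [mem_ball_zero_iff] at hz
      have : ‖z‖ ^ 2 ≤ 1 := by nlinarith [norm_nonneg z]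
      exact div_nonneg (by linarith) (by positivity)) m
  simpa only [kernel_re hζ] using this

theorem lint_poisson (μ : Measure ℂ) [IsFiniteMeasure μ] (hμ : μ {z : ℂ | ‖z‖ ≠ 1} = 0)
    {g : ℂ → ℂ} (hg : ContinuousOn g (Metric.ball (0 : ℂ) 1)) (m : ℕ) :
    ∫⁻ z in Metric.ball (0 : ℂ) 1,
      ENNReal.ofReal (poisson μ z * ‖g z‖ ^ 2 * (1 - ‖z‖ ^ 2) ^ m) =
    ∫⁻ ζ, (∫⁻ z in Metric.ball (0 : ℂ) 1, ENNReal.ofReal ((1 - ‖z‖ ^ 2) / ‖z - ζ‖ ^ 2 *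
        ‖g z‖ ^ 2 * (1 - ‖z‖ ^ 2) ^ m)) ∂μ := by
  have hae : ∀ᵐ ζ ∂μ, ‖ζ‖ = 1 := hμ
  rw [lintegral_lintegral_swap]
  · refine setLIntegral_congr_fun measurableSet_ball fun z hz => ?_
    rw [mem_ball_zero_iff] at hz
    have hw : 0 < 1 - ‖z‖ ^ 2 := by nlinarith [norm_nonneg z]
    simp only [mul_assoc]
    have hc : 0 ≤ ‖g z‖ ^ 2 * (1 - ‖z‖ ^ 2) ^ m := by positivity
    simp only [ENNReal.ofReal_mul' hc]
    rw [lintegral_mul_const _ (by fun_prop)]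
    congr 1
    unfold poisson
    refine ofReal_integral_eq_lintegral_ofReal ?_ (Filter.Eventually.of_forall fun ζ => by
      simp only [Pi.zero_apply]; positivity)
    refine Integrable.of_bound (C := (1 - ‖z‖ ^ 2) / (1 - ‖z‖) ^ 2) (Measurable.aestronglyMeasurable (by fun_prop)) ?_
    filter_upwards [hae] with ζ hζ
    have h1 : 1 - ‖z‖ ≤ ‖z - ζ‖ := by
      have := norm_sub_norm_le ζ z
      rw [hζ, norm_sub_rev] at this
      exact this
    have h2 : 0 < 1 - ‖z‖ := by linarith
    rw [Real.norm_of_nonneg (by positivity)]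
    gcongr
  · have h1 : AEMeasurable (fun p : ℂ × ℂ => g p.2)
        (μ.prod (volume.restrict (Metric.ball (0 : ℂ) 1))) :=
      (hg.aemeasurable measurableSet_ball).comp_snd
    refine AEMeasurable.ennreal_ofReal ?_
    refine AEMeasurable.mul (AEMeasurable.mul ?_ (h1.norm.pow_const 2)) ?_
    · exact Measurable.aemeasurable (by fun_prop)
    · exact Measurable.aemeasurable (by fun_prop)

theorem diffOn_iter {g : ℂ → ℂ} (hg : DifferentiableOn ℂ g (Metric.ball (0 : ℂ) 1)) (k : ℕ) :
    DifferentiableOn ℂ (iteratedDeriv k g) (Metric.ball (0 : ℂ) 1) := by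
  induction k with
  | zero => simpa using hg
  | succ k ih =>
    rw [iteratedDeriv_succ]
    exact ih.deriv Metric.isOpen_ball

theorem iter_shift {f g : ℂ → ℂ} (hg : DifferentiableOn ℂ g (Metric.ball (0 : ℂ) 1)) (c : ℂ)
    (hfg : ∀ z ∈ Metric.ball (0 : ℂ) 1, f z = z * g z + c) (m : ℕ) :
    ∀ z ∈ Metric.ball (0 : ℂ) 1, iteratedDeriv (m + 1) f z =
      z * deriv (iteratedDeriv m g) z + (m + 1) * iteratedDeriv m g z := by
  induction m with
  | zero =>
    intro z hz
    have hz' := Metric.isOpen_ball.mem_nhds hz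
    have e : f =ᶠ[nhds z] fun z => z * g z + c := by
      filter_upwards [hz'] with w hw using hfg w hw
    rw [zero_add, iteratedDeriv_one, e.deriv_eq]
    have hd := (hg.differentiableAt hz').hasDerivAt
    have := ((hasDerivAt_id z).mul hd).add_const c
    refine this.deriv.trans ?_
    simp; ring
  | succ m ih =>
    intro z hz
    have hz' := Metric.isOpen_ball.mem_nhds hz
    have e : iteratedDeriv (m + 1) f =ᶠ[nhds z] fun z =>
        z * deriv (iteratedDeriv m g) z + (m + 1) * iteratedDeriv m g z := by
      filter_upwards [hz'] with w hw using ih w hw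
    rw [iteratedDeriv_succ, e.deriv_eq]
    have hd := ((diffOn_iter hg m).differentiableAt hz').hasDerivAt
    have hd2 := ((diffOn_iter hg (m + 1)).differentiableAt hz').hasDerivAt
    rw [iteratedDeriv_succ] at hd2 ⊢
    have := ((hasDerivAt_id z).mul hd2).add (hd.const_mul ((m : ℂ) + 1))
    refine this.deriv.trans ?_
    simp; ring

theorem bshift_eq_dslope (f : ℂ → ℂ) : bshift f = dslope f 0 := by
  funext z
  by_cases hz : z = 0
  · simp [bshift, hz]
  · simp [bshift, hz, dslope_of_ne, slope, div_eq_inv_mul]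

/-- For a finite positive Borel measure `μ` on the unit circle and `n ≥ 1`, the backward
shift satisfies `D_{μ,n}(Lf) ≤ D_{μ,n}(f)` for every holomorphic `f` on the unit disc. -/
theorem eDirichlet_bshift_le (μ : Measure ℂ) [IsFiniteMeasure μ]
    (hμ : μ {z : ℂ | ‖z‖ ≠ 1} = 0) (n : ℕ) (hn : 1 ≤ n) (f : ℂ → ℂ)
    (hf : DifferentiableOn ℂ f (Metric.ball (0 : ℂ) 1)) :
    eDirichlet μ n (bshift f) ≤ eDirichlet μ n f := by
  obtain ⟨m, rfl⟩ : ∃ m, n = m + 1 := ⟨n - 1, by omega⟩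
  have hg : DifferentiableOn ℂ (bshift f) (Metric.ball (0 : ℂ) 1) := by
    rw [bshift_eq_dslope]
    exact (Complex.differentiableOn_dslope (Metric.ball_mem_nhds 0 one_pos)).2 hf
  have hfg : ∀ z ∈ Metric.ball (0 : ℂ) 1, f z = z * bshift f z + f 0 := by
    intro z _
    by_cases hz : z = 0
    · simp [hz]
    · simp only [bshift, hz, if_false]
      field_simp
      ring
  have hae : ∀ᵐ ζ ∂μ, ‖ζ‖ = 1 := hμ
  unfold eDirichlet
  refine mul_le_mul_right ?_ _
  rw [Nat.add_sub_cancel]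
  unfold area
  rw [Measure.restrict_smul, lintegral_smul_measure, lintegral_smul_measure]
  refine mul_le_mul_right ?_ _
  rw [lint_poisson μ hμ (diffOn_iter hg (m + 1)).continuousOn,
    lint_poisson μ hμ (diffOn_iter hf (m + 1)).continuousOn]
  refine lintegral_mono_ae ?_
  filter_upwards [hae] with ζ hζ
  rw [iteratedDeriv_succ]
  refine (lint_kernel (diffOn_iter hg m) m hζ).trans (le_of_eq ?_)
  refine setLIntegral_congr_fun measurableSet_ball fun z hz => ?_
  simp only [iter_shift hg (f 0) hfg m z hz]
end
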